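/- Let m be a standard Brownian meander with m̄(s) := sup_{u ∈ [0,s]} m(u), let U be a squared four-dimensional Bessel process started at 0, and let τ₁^U := inf{ t ≥ 0 : Ū(t) − U(t) ≥ 1 } with Ū(t) := sup_{s ∈ [0,t]} U(s). Then E[ 1 / sup_{s ∈ [0,1]} ( m̄(s) − m(s) ) ] = (2π)^{1/2} · E[ τ₁^U ]. -/

import Mathlib

open MeasureTheory ProbabilityTheory Real Set Filter

noncomputable section

variable {Ω : Type*} [MeasurableSpace Ω]

/-- A standard one-dimensional Brownian motion (indexed by `ℝ`, with the relevant
properties required for nonnegative times): starts at `0`, has continuous paths,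
independent increments, and Gaussian increments of variance `t - s`. -/
structure IsStdBM (P : Measure Ω) (B : ℝ → Ω → ℝ) : Prop where
  measurable : ∀ t : ℝ, Measurable (B t)
  start : ∀ ω, B 0 ω = 0
  cont : ∀ ω, Continuous fun t => B t ω
  indep : ∀ (n : ℕ) (t : Fin (n + 1) → ℝ), (∀ i, 0 ≤ t i) → Monotone t →
    iIndepFun
      (fun (i : Fin n) ω => B (t i.succ) ω - B (t i.castSucc) ω) P
  gauss : ∀ s t : ℝ, 0 ≤ s → s ≤ t →
    P.map (fun ω => B t ω - B s ω) = gaussianReal 0 (Real.toNNReal (t - s))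

/-- A standard `d`-dimensional Brownian motion started at `0`: the coordinate
processes are independent standard one-dimensional Brownian motions. -/
structure IsStdBMVec (d : ℕ) (P : Measure Ω) (B : ℝ → Ω → EuclideanSpace ℝ (Fin d)) : Prop where
  coord : ∀ i : Fin d, IsStdBM P (fun t ω => B t ω i)
  indepCoord : iIndepFun
    (fun (i : Fin d) ω => fun t : ℝ => B t ω i) P

/-- Last zero of `W` in `[0,1]`. -/
def lastZero (W : ℝ → Ω → ℝ) (ω : Ω) : ℝ := sSup {t ∈ Icc (0:ℝ) 1 | W t ω = 0}

/-- `m` is a standard Brownian meander: obtained from a Brownian motion `W` by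
`m s = |W (g + s (1 - g))| / √(1 - g)`, where `g` is the last zero of `W` before time `1`. -/
def IsBrownianMeander (P : Measure Ω) (m : ℝ → Ω → ℝ) : Prop :=
  ∃ W : ℝ → Ω → ℝ, IsStdBM P W ∧
    ∀ ω, ∀ s ∈ Icc (0:ℝ) 1,
      m s ω = |W (lastZero W ω + s * (1 - lastZero W ω)) ω| / Real.sqrt (1 - lastZero W ω)

/-- Running maximum `X̄(t) = sup_{s ∈ [0,t]} X(s)`. -/
def runMax (X : ℝ → Ω → ℝ) (t : ℝ) (ω : Ω) : ℝ := ⨆ s : Icc (0:ℝ) t, X s ω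

/-- Maximal drawdown on `[0,T]` : `sup_{s ∈ [0,T]} (X̄(s) - X(s))`. -/
def maxDDOn (X : ℝ → Ω → ℝ) (T : ℝ) (ω : Ω) : ℝ := ⨆ s : Icc (0:ℝ) T, (runMax X s ω - X s ω)

/-- Drawdown time `τ_λ^X := inf {t ≥ 0 : X̄(t) - X(t) ≥ λ}`. -/
def ddTime (lam : ℝ) (X : ℝ → Ω → ℝ) (ω : Ω) : ℝ :=
  sInf {t | 0 ≤ t ∧ lam ≤ runMax X t ω - X t ω}

/-- Three-dimensional Bessel process built from a 3-dimensional Brownian motion. -/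
def bessel3 (β : ℝ → Ω → EuclideanSpace ℝ (Fin 3)) (t : ℝ) (ω : Ω) : ℝ := ‖β t ω‖

/-- Squared four-dimensional Bessel process built from a 4-dimensional Brownian motion. -/
def sqBessel4 (γ : ℝ → Ω → EuclideanSpace ℝ (Fin 4)) (t : ℝ) (ω : Ω) : ℝ := ‖γ t ω‖ ^ 2

end

section part1
open MeasureTheory ProbabilityTheory Real Set Filter
open scoped ENNReal NNReal Topology

noncomputable def cl (x : ℝ) : ℝ := max 0 (min x 1)

lemma cl_mem (x : ℝ) : cl x ∈ Icc (0:ℝ) 1 :=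
  ⟨le_max_left _ _, max_le zero_le_one (min_le_right _ _)⟩

lemma cl_of_mem {x : ℝ} (h : x ∈ Icc (0:ℝ) 1) : cl x = x := by
  unfold cl; rw [min_eq_left h.2, max_eq_right h.1]

lemma cl_cont : Continuous cl := by unfold cl; fun_prop

lemma cl_dense : Icc (0:ℝ) 1 ⊆ closure (range fun q : ℚ => cl (q:ℝ)) := by
  intro x hx
  have h1 : x ∈ closure (cl '' (range ((↑) : ℚ → ℝ))) := by
    refine image_closure_subset_closure_image cl_cont ⟨x, ?_, cl_of_mem hx⟩
    rw [(Rat.denseRange_cast (𝕜 := ℝ)).closure_range]; trivial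
  rwa [← range_comp] at h1

lemma iSup_eq_sSup_image {X ι : Type*} [TopologicalSpace X] [Nonempty ι] {K : Set X} (hK : IsCompact K)
    (e : ι → X) (he : ∀ i, e i ∈ K) (hd : K ⊆ closure (range e)) (g : X → ℝ) (hg : Continuous g) :
    ⨆ i, g (e i) = sSup (g '' K) := by
  have hb : BddAbove (g '' K) := (hK.image hg).bddAbove
  have hb' : BddAbove (range fun i => g (e i)) :=
    hb.mono (by rintro _ ⟨i, rfl⟩; exact ⟨_, he i, rfl⟩)
  apply le_antisymm
  · exact ciSup_le fun i => le_csSup hb ⟨_, he i, rfl⟩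
  · have : K.Nonempty := ⟨_, he (Classical.arbitrary ι)⟩
    refine csSup_le (this.image _) ?_
    rintro _ ⟨x, hx, rfl⟩
    have hc : IsClosed {x | g x ≤ ⨆ i, g (e i)} := isClosed_le hg continuous_const
    have : closure (range e) ⊆ {x | g x ≤ ⨆ i, g (e i)} :=
      closure_minimal (by rintro _ ⟨i, rfl⟩; exact le_ciSup hb' i) hc
    exact this (hd hx)

noncomputable def Mx (f : ℝ → ℝ) (s : ℝ) : ℝ := ⨆ q : ℚ, f (s * cl q)
noncomputable def Dx (f : ℝ → ℝ) (s : ℝ) : ℝ :=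
  ⨆ p : ℚ × ℚ, (f (s * cl p.1 * cl p.2) - f (s * cl p.1))

lemma Mx_eq {f : ℝ → ℝ} (hf : Continuous f) (s : ℝ) :
    Mx f s = sSup ((fun r => f (s * r)) '' Icc (0:ℝ) 1) :=
  iSup_eq_sSup_image isCompact_Icc (fun q : ℚ => cl q) (fun q => cl_mem q) cl_dense
    (fun r => f (s * r)) (by fun_prop)

lemma Dx_eq {f : ℝ → ℝ} (hf : Continuous f) (s : ℝ) :
    Dx f s = sSup ((fun p : ℝ × ℝ => f (s * p.1 * p.2) - f (s * p.1)) '' (Icc (0:ℝ) 1 ×ˢ Icc (0:ℝ) 1)) := by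
  refine iSup_eq_sSup_image (isCompact_Icc.prod isCompact_Icc)
    (fun q : ℚ × ℚ => ((cl q.1, cl q.2) : ℝ × ℝ)) (fun q => ⟨cl_mem _, cl_mem _⟩) ?_
    (fun p : ℝ × ℝ => f (s * p.1 * p.2) - f (s * p.1)) (by fun_prop)
  have : (range fun q : ℚ × ℚ => ((cl q.1, cl q.2) : ℝ × ℝ))
      = (range fun q : ℚ => cl (q:ℝ)) ×ˢ (range fun q : ℚ => cl (q:ℝ)) := by
    ext ⟨a, b⟩; simp
  rw [this, closure_prod_eq]
  exact prod_mono cl_dense cl_dense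

section paths
variable {f : ℝ → ℝ} (hf : Continuous f)
include hf

lemma Mx_cont : Continuous (Mx f) := by
  have : Mx f = fun s => sSup ((fun r => f (s * r)) '' Icc (0:ℝ) 1) := funext (Mx_eq hf)
  rw [this]
  exact isCompact_Icc.continuous_sSup (f := fun s r => f (s * r)) (by fun_prop)

lemma Dx_cont : Continuous (Dx f) := by
  have : Dx f = _ := funext (Dx_eq hf)
  rw [this]
  exact (isCompact_Icc.prod isCompact_Icc).continuous_sSup
    (f := fun s (p : ℝ × ℝ) => f (s * p.1 * p.2) - f (s * p.1)) (by fun_prop)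

lemma le_Mx {u s : ℝ} (h0 : 0 ≤ u) (h : u ≤ s) : f u ≤ Mx f s := by
  rw [Mx_eq hf]
  apply le_csSup (isCompact_Icc.image (by fun_prop)).bddAbove
  rcases eq_or_lt_of_le (h0.trans h) with h1 | h1
  · exact ⟨0, by simp, by simp only [mul_zero]; congr 1; linarith⟩
  · exact ⟨u / s, ⟨by positivity, by rw [div_le_one h1]; exact h⟩, by simp only; rw [mul_div_cancel₀ _ h1.ne']⟩

lemma exists_Mx {s : ℝ} (hs : 0 ≤ s) : ∃ u ∈ Icc 0 s, f u = Mx f s := by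
  obtain ⟨r, hr, h⟩ := (isCompact_Icc (a := (0:ℝ)) (b := 1)).exists_sSup_image_eq (by simp)
    (f := fun r => f (s * r)) (by fun_prop)
  exact ⟨s * r, ⟨mul_nonneg hs hr.1, mul_le_of_le_one_right hs hr.2⟩, by rw [Mx_eq hf]; exact h.symm⟩

lemma Mx_mono {s t : ℝ} (hs : 0 ≤ s) (h : s ≤ t) : Mx f s ≤ Mx f t := by
  obtain ⟨u, hu, h'⟩ := exists_Mx hf hs
  rw [← h']; exact le_Mx hf hu.1 (hu.2.trans h)

lemma le_Dx {u v s : ℝ} (h0 : 0 ≤ u) (huv : u ≤ v) (h : v ≤ s) : f u - f v ≤ Dx f s := by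
  rw [Dx_eq hf]
  apply le_csSup ((isCompact_Icc.prod isCompact_Icc).image (by fun_prop)).bddAbove
  have hv := h0.trans huv
  rcases eq_or_lt_of_le (hv.trans h) with h1 | h1
  · exact ⟨(0,0), by simp, by simp only [mul_zero]; congr 2 <;> linarith⟩
  · rcases eq_or_lt_of_le hv with h2 | h2
    · exact ⟨(0,0), by simp, by simp only [mul_zero]; congr 2 <;> linarith⟩
    · refine ⟨(v / s, u / v), ⟨⟨by positivity, by simp only; rw [div_le_one h1]; exact h⟩,
        by simp only; positivity, by simp only; rw [div_le_one h2]; exact huv⟩, ?_⟩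
      simp only; rw [mul_div_cancel₀ _ h1.ne', mul_div_cancel₀ _ h2.ne']

lemma exists_Dx {s : ℝ} (hs : 0 ≤ s) : ∃ u v, 0 ≤ u ∧ u ≤ v ∧ v ≤ s ∧ f u - f v = Dx f s := by
  obtain ⟨r, hr, h⟩ := (isCompact_Icc.prod isCompact_Icc :
      IsCompact (Icc (0:ℝ) 1 ×ˢ Icc (0:ℝ) 1)).exists_sSup_image_eq ⟨(0,0), by simp⟩
    (f := fun p : ℝ × ℝ => f (s * p.1 * p.2) - f (s * p.1)) (by fun_prop)
  have h1 : 0 ≤ s * r.1 := mul_nonneg hs hr.1.1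
  exact ⟨s * r.1 * r.2, s * r.1, mul_nonneg h1 hr.2.1, mul_le_of_le_one_right h1 hr.2.2,
    mul_le_of_le_one_right hs hr.1.2, by rw [Dx_eq hf]; exact h.symm⟩

lemma Dx_nonneg {s : ℝ} (hs : 0 ≤ s) : 0 ≤ Dx f s := by
  have := le_Dx hf le_rfl le_rfl hs
  linarith

lemma Dx_mono {s t : ℝ} (hs : 0 ≤ s) (h : s ≤ t) : Dx f s ≤ Dx f t := by
  obtain ⟨u, v, h0, h1, h2, h'⟩ := exists_Dx hf hs
  rw [← h']; exact le_Dx hf h0 h1 (h2.trans h)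

lemma Mx_sub_le_Dx {s : ℝ} (hs : 0 ≤ s) : Mx f s - f s ≤ Dx f s := by
  obtain ⟨u, hu, h'⟩ := exists_Mx hf hs
  rw [← h']; exact le_Dx hf hu.1 hu.2 le_rfl

lemma exists_Dx' {s : ℝ} (hs : 0 ≤ s) : ∃ v ∈ Icc 0 s, Mx f v - f v = Dx f s := by
  obtain ⟨u, v, h0, h1, h2, h'⟩ := exists_Dx hf hs
  refine ⟨v, ⟨h0.trans h1, h2⟩, le_antisymm ?_ ?_⟩
  · exact (Mx_sub_le_Dx hf (h0.trans h1)).trans (Dx_mono hf (h0.trans h1) h2)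
  · rw [← h']; linarith [le_Mx hf h0 h1]

lemma Mx_zero : Mx f 0 = f 0 := by
  obtain ⟨u, hu, h⟩ := exists_Mx hf le_rfl
  rw [← h]; congr 1; linarith [hu.1, hu.2]

lemma Dx_zero : Dx f 0 = 0 := by
  obtain ⟨u, v, h0, h1, h2, h⟩ := exists_Dx hf le_rfl
  have : u = v := by linarith
  rw [← h, this]; ring

end paths

/-- path stopped at `s` -/
noncomputable def stp (s : ℝ) (f : ℝ → ℝ) (u : ℝ) : ℝ := f (max 0 (min u s))

lemma stp_of {s u : ℝ} (f : ℝ → ℝ) (h0 : 0 ≤ u) (h : u ≤ s) : stp s f u = f u := by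
  unfold stp; rw [min_eq_left h, max_eq_right h0]

lemma measurable_stp (s : ℝ) : Measurable (stp s) := by
  unfold stp; fun_prop

lemma Mx_congr {f g : ℝ → ℝ} {s : ℝ} (hs : 0 ≤ s) (h : ∀ u ∈ Icc 0 s, f u = g u) : Mx f s = Mx g s := by
  unfold Mx; congr 1; ext q
  exact h _ ⟨mul_nonneg hs (cl_mem _).1, mul_le_of_le_one_right hs (cl_mem _).2⟩

lemma Dx_congr {f g : ℝ → ℝ} {s : ℝ} (hs : 0 ≤ s) (h : ∀ u ∈ Icc 0 s, f u = g u) : Dx f s = Dx g s := by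
  unfold Dx; congr 1; ext q
  have h1 : 0 ≤ s * cl q.1 := mul_nonneg hs (cl_mem _).1
  have h2 : s * cl q.1 ≤ s := mul_le_of_le_one_right hs (cl_mem _).2
  rw [h _ ⟨h1, h2⟩, h _ ⟨mul_nonneg h1 (cl_mem _).1, (mul_le_of_le_one_right h1 (cl_mem _).2).trans h2⟩]

lemma Mx_stp {f : ℝ → ℝ} {s r : ℝ} (hr : 0 ≤ r) (h : r ≤ s) : Mx (stp s f) r = Mx f r :=
  Mx_congr hr fun _ hu => stp_of f hu.1 (hu.2.trans h)

lemma Dx_stp {f : ℝ → ℝ} {s r : ℝ} (hr : 0 ≤ r) (h : r ≤ s) : Dx (stp s f) r = Dx f r :=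
  Dx_congr hr fun _ hu => stp_of f hu.1 (hu.2.trans h)

lemma measurable_Mx (s : ℝ) : Measurable (fun f : ℝ → ℝ => Mx f s) := by
  unfold Mx
  exact Measurable.iSup fun q => measurable_pi_apply _

lemma measurable_Dx (s : ℝ) : Measurable (fun f : ℝ → ℝ => Dx f s) := by
  unfold Dx
  exact Measurable.iSup fun q => (measurable_pi_apply _).sub (measurable_pi_apply _)

/-- first time the (nondecreasing) `A` reaches level `a`, truncated at `t` -/
noncomputable def cross (A : ℝ → ℝ) (a t : ℝ) : ℝ := sInf {s | 0 ≤ s ∧ (a ≤ A s ∨ t ≤ s)}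

section cross
variable {A : ℝ → ℝ} (hA : Continuous A) (hmono : ∀ s u, 0 ≤ s → s ≤ u → A s ≤ A u) {a t : ℝ} (ht : 0 ≤ t)
include ht hA

lemma cross_mem : 0 ≤ cross A a t ∧ (a ≤ A (cross A a t) ∨ t ≤ cross A a t) := by
  have hc : IsClosed {s | 0 ≤ s ∧ (a ≤ A s ∨ t ≤ s)} :=
    (isClosed_le continuous_const continuous_id).inter
      ((isClosed_le continuous_const hA).union (isClosed_le continuous_const continuous_id))
  exact hc.csInf_mem ⟨t, ht, Or.inr le_rfl⟩ ⟨0, fun _ h => h.1⟩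

omit hA in
lemma cross_le : cross A a t ≤ t := csInf_le ⟨0, fun _ h => h.1⟩ ⟨ht, Or.inr le_rfl⟩

omit hA ht in
lemma cross_le_of {s : ℝ} (hs : 0 ≤ s) (h : a ≤ A s) : cross A a t ≤ s :=
  csInf_le ⟨0, fun _ h => h.1⟩ ⟨hs, Or.inl h⟩

include hmono in
lemma lt_cross {s : ℝ} (hs : 0 ≤ s) : s < cross A a t ↔ A s < a ∧ s < t := by
  constructor
  · intro h
    refine ⟨?_, h.trans_le (cross_le ht)⟩
    by_contra! h'
    exact absurd (cross_le_of (t := t) hs h') (not_le.2 h)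
  · rintro ⟨h1, h2⟩
    by_contra! h'
    obtain ⟨h3, h4⟩ := cross_mem (a := a) hA ht
    rcases h4 with h4 | h4
    · linarith [hmono _ _ h3 h']
    · linarith

include hmono in
lemma cross_val_le (h0 : A 0 ≤ a) : A (cross A a t) ≤ a := by
  obtain ⟨h3, h4⟩ := cross_mem (a := a) hA ht
  rcases eq_or_lt_of_le h3 with h5 | h5
  · rwa [← h5]
  · have : Tendsto A (𝓝[<] (cross A a t)) (𝓝 (A (cross A a t))) := hA.continuousAt.continuousWithinAt
    refine le_of_tendsto this ?_
    filter_upwards [Ioo_mem_nhdsLT h5] with s hs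
    exact ((lt_cross hA hmono ht hs.1.le).1 hs.2).1.le

include hmono in
lemma cross_val_eq (h0 : A 0 ≤ a) (h : cross A a t < t) : A (cross A a t) = a := by
  apply le_antisymm (cross_val_le hA hmono ht h0)
  rcases (cross_mem (a := a) hA ht).2 with h4 | h4
  · exact h4
  · linarith

end cross

end part1

section part2
open MeasureTheory ProbabilityTheory Real Set Filter
open scoped ENNReal NNReal Topology

section bm
variable {Ω : Type*} [MeasurableSpace Ω] {P : Measure Ω} [IsProbabilityMeasure P] {B : ℝ → Ω → ℝ}

lemma IsStdBM.pre (hB : IsStdBM P B) : IsPreBrownianReal (fun (t : ℝ≥0) ω => B t ω) P := by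
  refine HasIndepIncrements.isPreBrownianReal_of_hasLaw (fun t => ⟨(hB.measurable _).aemeasurable, ?_⟩) ?_
  · have := hB.gauss 0 t le_rfl t.2
    simpa [hB.start] using this
  · intro n t ht
    exact hB.indep n (fun i => t i) (fun i => (t i).2) (fun i j h => by exact_mod_cast ht h)

lemma IsStdBM.of_pre (hm : ∀ t, Measurable (B t)) (h0 : ∀ ω, B 0 ω = 0)
    (hc : ∀ ω, Continuous fun t => B t ω)
    (hp : IsPreBrownianReal (fun (t : ℝ≥0) ω => B t ω) P) : IsStdBM P B where
  measurable := hm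
  start := h0
  cont := hc
  indep n t h0 ht := by
    exact hp.hasIndepIncrements n (fun i => ⟨t i, h0 i⟩) (fun i j h => ht h)
  gauss s t hs hst := by
    lift s to ℝ≥0 using hs
    have := hp.shift s
    have h2 := (this.hasLaw_eval (t - s).toNNReal).map_eq
    have e : ((s + (t - s).toNNReal : ℝ≥0) : ℝ) = t := by
      push_cast; rw [Real.coe_toNNReal _ (sub_nonneg.2 hst)]; ring
    simpa only [e] using h2

lemma IsStdBM.neg (hB : IsStdBM P B) : IsStdBM P (fun t ω => - B t ω) :=
  .of_pre (fun t => (hB.measurable t).neg) (by simp [hB.start]) (fun ω => (hB.cont ω).neg) hB.pre.neg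

lemma IsStdBM.scale (hB : IsStdBM P B) {x : ℝ} (hx : 0 < x) :
    IsStdBM P (fun t ω => x⁻¹ * B (x ^ 2 * t) ω) := by
  refine .of_pre (fun t => (hB.measurable _).const_mul _) (by simp [hB.start])
    (fun ω => continuous_const.mul ((hB.cont ω).comp (by fun_prop))) ?_
  lift x to ℝ≥0 using hx.le
  have h := hB.pre.smul (c := x ^ 2) (by
    have : x ≠ 0 := by rintro rfl; simp at hx
    positivity)
  push_cast at h
  rw [Real.sqrt_sq hx.le] at h
  exact h

lemma IsStdBM.reverse (hB : IsStdBM P B) :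
    IsStdBM P (fun t ω => B (max t 1) ω - B (max (1 - t) 0) ω) := by
  refine .of_pre (fun t => (hB.measurable _).sub (hB.measurable _)) (by simp)
    (fun ω => ((hB.cont ω).comp (by fun_prop)).sub ((hB.cont ω).comp (by fun_prop))) ?_
  have hp := hB.pre
  have key : (fun (t : ℝ≥0) ω => B (max (t:ℝ) 1) ω - B (max (1 - (t:ℝ)) 0) ω)
      = fun (t : ℝ≥0) ω => B ((max t 1 : ℝ≥0) : ℝ) ω - B ((1 - t : ℝ≥0) : ℝ) ω := by
    ext t ω
    rw [NNReal.coe_sub_def]; simp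
  rw [key]
  refine IsGaussianProcess.isPreBrownianReal_of_covariance ?_ (fun t ↦ ?_) (fun s t hst ↦ ?_)
  · apply hp.isGaussianProcess.of_isGaussianProcess
    intro t
    exact ⟨{max t 1, 1 - t},
        { toFun x := x ⟨max t 1, by simp⟩ - x ⟨1 - t, by simp⟩
          map_add' x y := by simp; abel
          map_smul' c x := by simp; ring }, by simp⟩
  · rw [integral_sub, hp.integral_eval, hp.integral_eval, sub_zero]
    all_goals exact (hp.isGaussianProcess.hasGaussianLaw_eval _).integrable
  · have hm : ∀ t : ℝ≥0, MemLp (fun ω => B t ω) 2 P :=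
      fun t => (hp.isGaussianProcess.hasGaussianLaw_eval t).memLp_two
    have hc := hp.covariance_fun_eval
    have hm' : MemLp (fun ω => B ((max t 1 : ℝ≥0) : ℝ) ω - B ((1 - t : ℝ≥0) : ℝ) ω) 2 P := (hm _).sub (hm _)
    rw [covariance_fun_sub_left (hm _) (hm _) hm',
      covariance_fun_sub_right (hm _) (hm _) (hm _), covariance_fun_sub_right (hm _) (hm _) (hm _)]
    rw [hc, hc, hc, hc]
    have e1 : min (max s 1) (max t 1) = max s 1 := min_eq_left (max_le_max_right _ hst)
    have e2 : min (max s 1) (1 - t) = 1 - t :=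
      min_eq_right (tsub_le_self.trans (le_max_right _ _))
    have e3 : min (1 - s) (max t 1) = 1 - s :=
      min_eq_left (tsub_le_self.trans (le_max_right _ _))
    have e4 : min (1 - s) (1 - t) = 1 - t := min_eq_right (tsub_le_tsub_left hst 1)
    rw [e1, e2, e3, e4, NNReal.coe_sub_def, NNReal.coe_sub_def]
    push_cast
    rcases le_total (s:ℝ) 1 with h | h
    · rw [max_eq_right h, max_eq_left (a := 1 - (s:ℝ)) (by linarith)]; ring
    · rw [max_eq_left h, max_eq_right (a := 1 - (s:ℝ)) (by linarith)]; ring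

lemma IsStdBM.measurable_path (hB : IsStdBM P B) : Measurable (fun ω t => B t ω) :=
  measurable_pi_lambda _ hB.measurable

lemma IsStdBM.lintegral_path_eq {B' : ℝ → Ω → ℝ} (hB : IsStdBM P B) (hB' : IsStdBM P B')
    (Φ : (ℝ → ℝ) → ℝ≥0∞) (hΦ : Measurable Φ) (hc : ∀ f g : ℝ → ℝ, (∀ t, 0 ≤ t → f t = g t) → Φ f = Φ g) :
    ∫⁻ ω, Φ (fun t => B t ω) ∂P = ∫⁻ ω, Φ (fun t => B' t ω) ∂P := by
  have m1 : Measurable (fun ω (t : ℝ≥0) => B t ω) := measurable_pi_lambda _ fun t => hB.measurable _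
  have m2 : Measurable (fun ω (t : ℝ≥0) => B' t ω) := measurable_pi_lambda _ fun t => hB'.measurable _
  have key : P.map (fun ω (t : ℝ≥0) => B t ω) = P.map (fun ω (t : ℝ≥0) => B' t ω) := by
    refine (map_eq_iff_forall_finset_map_restrict_eq (X := fun (t : ℝ≥0) ω => B t ω)
      (Y := fun (t : ℝ≥0) ω => B' t ω) m1.aemeasurable m2.aemeasurable).2 fun I => ?_
    rw [(hB.pre.hasLaw I).map_eq, (hB'.pre.hasLaw I).map_eq]
  have me : Measurable (fun (g : ℝ≥0 → ℝ) (u : ℝ) => g u.toNNReal) :=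
    measurable_pi_lambda _ fun t => measurable_pi_apply _
  have e1 := lintegral_map (μ := P) (hΦ.comp me) m1
  have e2 := lintegral_map (μ := P) (hΦ.comp me) m2
  rw [key, e2] at e1
  convert e1.symm using 3 with ω ω
  all_goals exact hc _ _ fun t ht => by simp [Real.coe_toNNReal _ ht]

lemma IsStdBM.indep_past (hB : IsStdBM P B) {s t : ℝ} (hs : 0 ≤ s) (hst : s ≤ t) :
    IndepFun (fun ω => stp s (fun u => B u ω)) (fun ω => B t ω - B s ω) P := by
  lift s to ℝ≥0 using hs
  have h := (hB.pre.indepFun_shift s).symm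
  have h1 : Measurable (fun (g : Set.Iic s → ℝ) (u : ℝ) =>
      g ⟨⟨max 0 (min u s), le_max_left _ _⟩, by
        change max 0 (min u s) ≤ (s:ℝ)
        exact max_le s.2 (min_le_right _ _)⟩) := measurable_pi_lambda _ fun t => measurable_pi_apply _
  have h2 : Measurable (fun g : ℝ≥0 → ℝ => g (t - s).toNNReal) := measurable_pi_apply _
  have e : ((s + (t - s).toNNReal : ℝ≥0) : ℝ) = t := by
      push_cast; rw [Real.coe_toNNReal _ (sub_nonneg.2 hst)]; ring
  have h3 := h.comp h1 h2
  simp only [Function.comp_def, e] at h3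
  exact h3

lemma IsStdBM.freeze (hB : IsStdBM P B) {s t : ℝ} (hs : 0 ≤ s) (hst : s ≤ t)
    (Φ : (ℝ → ℝ) × ℝ → ℝ≥0∞) (hΦ : Measurable Φ) :
    ∫⁻ ω, Φ (stp s (fun u => B u ω), B t ω - B s ω) ∂P
      = ∫⁻ ω, ∫⁻ y, Φ (stp s (fun u => B u ω), y) ∂(gaussianReal 0 (t - s).toNNReal) ∂P := by
  have hi := hB.indep_past hs hst
  have m1 : Measurable (fun ω => stp s (fun u => B u ω)) := (measurable_stp s).comp hB.measurable_path
  have m2 : Measurable (fun ω => B t ω - B s ω) := (hB.measurable t).sub (hB.measurable s)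
  rw [indepFun_iff_map_prod_eq_prod_map_map m1.aemeasurable m2.aemeasurable, hB.gauss s t hs hst] at hi
  have e := lintegral_map (μ := P) hΦ (m1.prodMk m2)
  rw [← e, hi, lintegral_prod _ hΦ.aemeasurable, lintegral_map _ m1]
  exact hΦ.lintegral_prod_right'

end bm

section bmvec
variable {Ω : Type*} [MeasurableSpace Ω] {P : Measure Ω} [IsProbabilityMeasure P]
  {γ : ℝ → Ω → EuclideanSpace ℝ (Fin 4)}

lemma IsStdBMVec.freeze (hγ : IsStdBMVec 4 P γ) {s t : ℝ} (hs : 0 ≤ s) (hst : s ≤ t)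
    (Φ : (Fin 4 → ℝ → ℝ) × (Fin 4 → ℝ) → ℝ≥0∞) (hΦ : Measurable Φ) :
    ∫⁻ ω, Φ (fun i => stp s (fun u => γ u ω i), fun i => γ t ω i - γ s ω i) ∂P
      = ∫⁻ ω, ∫⁻ y, Φ (fun i => stp s (fun u => γ u ω i), y)
        ∂(Measure.pi fun _ : Fin 4 => gaussianReal 0 (t - s).toNNReal) ∂P := by
  have m1 : ∀ i, Measurable (fun ω => stp s (fun u => γ u ω i)) := fun i =>
    (measurable_stp s).comp (hγ.coord i).measurable_path
  have m2 : ∀ i, Measurable (fun ω => γ t ω i - γ s ω i) := fun i =>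
    ((hγ.coord i).measurable t).sub ((hγ.coord i).measurable s)
  have m1' : Measurable (fun ω i => stp s (fun u => γ u ω i)) := measurable_pi_lambda _ m1
  have hind : iIndepFun (fun i ω => (stp s (fun u => γ u ω i), γ t ω i - γ s ω i)) P :=
    hγ.indepCoord.comp (fun i f => (stp s f, f t - f s)) (fun i => (measurable_stp s).prodMk
      ((measurable_pi_apply _).sub (measurable_pi_apply _)))
  have h1 : ∀ i, P.map (fun ω => (stp s (fun u => γ u ω i), γ t ω i - γ s ω i))
      = (P.map (fun ω => stp s (fun u => γ u ω i))).prod (gaussianReal 0 (t - s).toNNReal) := by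
    intro i
    have := (hγ.coord i).indep_past hs hst
    rwa [indepFun_iff_map_prod_eq_prod_map_map (m1 i).aemeasurable (m2 i).aemeasurable,
      (hγ.coord i).gauss s t hs hst] at this
  have m3 : ∀ i, Measurable (fun ω => (stp s (fun u => γ u ω i), γ t ω i - γ s ω i)) :=
    fun i => (m1 i).prodMk (m2 i)
  have : ∀ i, IsProbabilityMeasure (P.map (fun ω => stp s (fun u => γ u ω i))) :=
    fun i => Measure.isProbabilityMeasure_map (m1 i).aemeasurable
  rw [iIndepFun_iff_map_fun_eq_pi_map (fun i => (m3 i).aemeasurable)] at hind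
  simp_rw [h1] at hind
  have hind1 : iIndepFun (fun i ω => stp s (fun u => γ u ω i)) P :=
    hγ.indepCoord.comp (fun i f => stp s f) (fun i => measurable_stp s)
  rw [iIndepFun_iff_map_fun_eq_pi_map (fun i => (m1 i).aemeasurable)] at hind1
  have mp := measurePreserving_arrowProdEquivProdArrow (ℝ → ℝ) ℝ (Fin 4)
    (fun i => P.map (fun ω => stp s (fun u => γ u ω i))) (fun _ => gaussianReal 0 (t - s).toNNReal)
  have e1 := mp.lintegral_comp hΦ
  have e2 := lintegral_map (μ := P) (hΦ.comp mp.measurable) (measurable_pi_lambda _ m3)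
  rw [hind] at e2
  simp only [Function.comp_def] at e2
  rw [e2, ← hind1,
    lintegral_prod _ hΦ.aemeasurable, lintegral_map hΦ.lintegral_prod_right' m1'] at e1
  exact e1

end bmvec

end part2

section part3
open MeasureTheory ProbabilityTheory Real Set Filter
open scoped ENNReal NNReal Topology

lemma sum_stopped (a : ℕ → ℝ) (K n : ℕ) (h : K ≤ n) :
    ∑ k ∈ Finset.range n, (if k < K then a (k+1) - a k else 0) = a K - a 0 := by
  induction n, h using Nat.le_induction with
  | base =>
    rw [← Finset.sum_range_sub]
    apply Finset.sum_congr rfl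
    intro k hk
    rw [if_pos (Finset.mem_range.1 hk)]
  | succ n hn ih =>
    rw [Finset.sum_range_succ, ih, if_neg (by omega), add_zero]

lemma grid_lt_iff {t S : ℝ} (ht : 0 < t) {n k : ℕ} (hn : 0 < n) :
    t * k / n < S ↔ k < ⌈n * S / t⌉₊ := by
  have hn' : (0:ℝ) < n := by exact_mod_cast hn
  rw [Nat.lt_ceil, div_lt_iff₀ hn', lt_div_iff₀ ht]
  constructor <;> intro h <;> nlinarith

lemma grid_tendsto {t S : ℝ} (ht : 0 < t) (hS : 0 ≤ S) :
    Tendsto (fun n : ℕ => t * (⌈(n:ℝ) * S / t⌉₊ : ℝ) / n) atTop (𝓝 S) := by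
  have h1 : Tendsto (fun n : ℕ => S + t / n) atTop (𝓝 (S + 0)) :=
    tendsto_const_nhds.add (tendsto_const_div_atTop_nhds_zero_nat t)
  rw [add_zero] at h1
  refine tendsto_of_tendsto_of_tendsto_of_le_of_le' tendsto_const_nhds h1 ?_ ?_
  · filter_upwards [eventually_gt_atTop 0] with n hn
    have hn' : (0:ℝ) < n := by exact_mod_cast hn
    have := Nat.le_ceil ((n:ℝ) * S / t)
    rw [div_le_iff₀ ht] at this
    rw [le_div_iff₀ hn']; linarith
  · filter_upwards [eventually_gt_atTop 0] with n hn
    have hn' : (0:ℝ) < n := by exact_mod_cast hn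
    have := (Nat.ceil_lt_add_one (a := (n:ℝ) * S / t) (by positivity)).le
    have h3 : t * (⌈(n:ℝ) * S / t⌉₊ : ℝ) ≤ t * ((n:ℝ) * S / t + 1) := by gcongr
    rw [div_le_iff₀ hn']
    refine h3.trans (le_of_eq ?_)
    field_simp

lemma grid_mem {t : ℝ} (ht : 0 ≤ t) {n k : ℕ} (h : k ≤ n) : t * k / n ∈ Icc 0 t := by
  refine ⟨by positivity, ?_⟩
  rcases Nat.eq_zero_or_pos n with rfl | hn
  · simp [ht]
  have hn' : (0:ℝ) < n := by exact_mod_cast hn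
  rw [div_le_iff₀ hn']
  have : (k:ℝ) ≤ n := by exact_mod_cast h
  gcongr

lemma grid_ceil_le {t S : ℝ} (ht : 0 < t) (hS : S ≤ t) (n : ℕ) : ⌈(n:ℝ) * S / t⌉₊ ≤ n := by
  rw [Nat.ceil_le, div_le_iff₀ ht]; gcongr

section os
variable {Ω : Type*} [MeasurableSpace Ω] {P : Measure Ω} [IsProbabilityMeasure P]
  {Z : ℝ → Ω → ℝ} {t : ℝ} {K S : Ω → ℝ}

lemma stop_grid_eq (ht : 0 < t) (hS : ∀ ω, S ω ∈ Icc 0 t) {n : ℕ} (hn : 0 < n) (ω : Ω) :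
    Z (t * (⌈(n:ℝ) * S ω / t⌉₊ : ℝ) / n) ω = Z 0 ω + ∑ k ∈ Finset.range n,
      {ω | t * k / n < S ω}.indicator (fun ω => Z (t * ((k + 1 : ℕ) : ℝ) / n) ω - Z (t * k / n) ω) ω := by
  have := sum_stopped (fun k => Z (t * (k:ℝ) / n) ω) _ n (grid_ceil_le ht (hS ω).2 n)
  simp only [Set.indicator_apply, mem_ofPred_eq, grid_lt_iff ht hn]
  rw [this]; simp

lemma stop_aesm (ht : 0 < t) (hm : ∀ s ∈ Icc 0 t, Measurable (Z s)) (hc : ∀ ω, Continuous fun s => Z s ω)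
    (hS : ∀ ω, S ω ∈ Icc 0 t) (hSm : ∀ s, 0 ≤ s → MeasurableSet {ω | s < S ω}) :
    Measurable (fun ω => Z (S ω) ω) := by
  refine measurable_of_tendsto_metrizable (f := fun (n : ℕ) ω =>
    Z (t * (⌈((n+1:ℕ):ℝ) * S ω / t⌉₊ : ℝ) / ((n+1:ℕ):ℝ)) ω) ?_ ?_
  · intro n
    simp only [stop_grid_eq ht hS (Nat.succ_pos n)]
    refine (hm 0 ⟨le_rfl, ht.le⟩).add (Finset.measurable_sum _ fun k hk => ?_)
    have hk' := Finset.mem_range.1 hk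
    exact ((hm _ (grid_mem ht.le hk')).sub (hm _ (grid_mem ht.le hk'.le))).indicator
      (hSm _ (by positivity))
  · rw [tendsto_pi_nhds]
    intro ω
    exact ((hc ω).tendsto _).comp ((grid_tendsto ht (hS ω).1).comp (tendsto_add_atTop_nat 1))

lemma stop_integrable (ht : 0 < t) (hm : ∀ s ∈ Icc 0 t, Measurable (Z s)) (hc : ∀ ω, Continuous fun s => Z s ω)
    (hK : Integrable K P) (hb : ∀ s ∈ Icc 0 t, ∀ ω, |Z s ω| ≤ K ω)
    (hS : ∀ ω, S ω ∈ Icc 0 t) (hSm : ∀ s, 0 ≤ s → MeasurableSet {ω | s < S ω}) :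
    Integrable (fun ω => Z (S ω) ω) P :=
  hK.mono' (stop_aesm ht hm hc hS hSm).aestronglyMeasurable (ae_of_all _ fun ω => hb _ (hS ω) ω)

lemma optional_stopping (ht : 0 < t) (hm : ∀ s ∈ Icc 0 t, Measurable (Z s)) (hc : ∀ ω, Continuous fun s => Z s ω)
    (hK : Integrable K P) (hb : ∀ s ∈ Icc 0 t, ∀ ω, |Z s ω| ≤ K ω)
    (hS : ∀ ω, S ω ∈ Icc 0 t) (hSm : ∀ s, 0 ≤ s → MeasurableSet {ω | s < S ω}) :
    Tendsto (fun n : ℕ => ∑ k ∈ Finset.range n, ∫ ω in {ω | t * k / n < S ω},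
      (Z (t * ((k + 1 : ℕ) : ℝ) / n) ω - Z (t * k / n) ω) ∂P) atTop
      (𝓝 (∫ ω, Z (S ω) ω ∂P - ∫ ω, Z 0 ω ∂P)) := by
  have hi : ∀ s ∈ Icc 0 t, Integrable (Z s) P := fun s hs =>
    hK.mono' (hm s hs).aestronglyMeasurable (ae_of_all _ fun ω => hb s hs ω)
  have hZS := stop_integrable ht hm hc hK hb hS hSm
  have h0 : (0:ℝ) ∈ Icc 0 t := ⟨le_rfl, ht.le⟩
  have key : Tendsto (fun n : ℕ => ∫ ω, (Z (t * (⌈(n:ℝ) * S ω / t⌉₊ : ℝ) / n) ω - Z 0 ω) ∂P) atTop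
      (𝓝 (∫ ω, (Z (S ω) ω - Z 0 ω) ∂P)) := by
    refine tendsto_integral_filter_of_dominated_convergence (fun ω => 2 * K ω) ?_ ?_ (hK.const_mul 2) ?_
    · filter_upwards [eventually_gt_atTop 0] with n hn
      apply Measurable.aestronglyMeasurable
      refine Measurable.sub ?_ (hm 0 h0)
      simp only [stop_grid_eq ht hS hn]
      refine (hm 0 ⟨le_rfl, ht.le⟩).add (Finset.measurable_sum _ fun k hk => ?_)
      have hk' := Finset.mem_range.1 hk
      exact ((hm _ (grid_mem ht.le hk')).sub (hm _ (grid_mem ht.le hk'.le))).indicator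
        (hSm _ (by positivity))
    · filter_upwards with n
      filter_upwards with ω
      have h1 := hb _ (grid_mem ht.le (grid_ceil_le ht (hS ω).2 n)) ω
      have h2 := hb _ h0 ω
      rw [Real.norm_eq_abs]
      have := abs_sub (Z (t * (⌈(n:ℝ) * S ω / t⌉₊ : ℝ) / n) ω) (Z 0 ω)
      linarith
    · filter_upwards with ω
      exact (((hc ω).tendsto _).comp (grid_tendsto ht (hS ω).1)).sub_const _
  rw [integral_sub hZS (hi 0 h0)] at key
  refine key.congr' ?_
  filter_upwards [eventually_gt_atTop 0] with n hn
  simp only [stop_grid_eq ht hS hn, add_sub_cancel_left]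
  rw [integral_finsetSum]
  · apply Finset.sum_congr rfl
    intro k hk
    rw [integral_indicator (hSm _ (by positivity))]
  · intro k hk
    have hk' := Finset.mem_range.1 hk
    exact ((hi _ (grid_mem ht.le hk')).sub (hi _ (grid_mem ht.le hk'.le))).indicator (hSm _ (by positivity))
end os

lemma doob_path (s : ℕ → ℝ) (h0 : s 0 = 0) (n : ℕ) :
    (partialSups s n) ^ 2 ≤ 4 * (s n) ^ 2 - 4 * ∑ k ∈ Finset.range n, partialSups s k * (s (k+1) - s k) := by
  have key : 2 * (partialSups s n) ^ 2 ≤ 4 * partialSups s n * s n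
      - 4 * ∑ k ∈ Finset.range n, partialSups s k * (s (k+1) - s k) := by
    induction n with
    | zero => simp [h0]
    | succ n ih =>
      rw [Finset.sum_range_succ, partialSups_add_one]
      rcases le_total (partialSups s n) (s (n+1)) with h | h
      · rw [sup_eq_right.2 h]; nlinarith [sq_nonneg (partialSups s n - s (n+1))]
      · rw [sup_eq_left.2 h]; nlinarith
  nlinarith [sq_nonneg (partialSups s n - 2 * s n)]

lemma measurable_partialSups_path (c : ℕ → ℝ) (k : ℕ) :
    Measurable (fun f : ℝ → ℝ => partialSups (fun j => f (c j)) k) := by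
  induction k with
  | zero => simpa using measurable_pi_apply _
  | succ k ih => simp only [partialSups_add_one]; exact ih.sup (measurable_pi_apply _)

lemma partialSups_congr' {f g : ℕ → ℝ} {k : ℕ} (h : ∀ j ≤ k, f j = g j) :
    partialSups f k = partialSups g k := by
  induction k with
  | zero => simp [h 0 le_rfl]
  | succ k ih => rw [partialSups_add_one, partialSups_add_one, ih fun j hj => h j (by omega), h _ le_rfl]

section bm
variable {Ω : Type*} [MeasurableSpace Ω] {P : Measure Ω} [IsProbabilityMeasure P] {B : ℝ → Ω → ℝ}

lemma IsStdBM.integrable (hB : IsStdBM P B) {t : ℝ} (ht : 0 ≤ t) : Integrable (B t) P := by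
  lift t to ℝ≥0 using ht
  exact hB.pre.integrable_eval t

lemma IsStdBM.integral_incr (hB : IsStdBM P B) {s t : ℝ} (hs : 0 ≤ s) (ht : s ≤ t) :
    ∫ ω, (B t ω - B s ω) ∂P = 0 := by
  have h1 : ∀ s, 0 ≤ s → ∫ ω, B s ω ∂P = 0 := by
    intro s hs
    lift s to ℝ≥0 using hs
    exact hB.pre.integral_eval s
  rw [integral_sub (hB.integrable (hs.trans ht)) (hB.integrable hs), h1 _ hs, h1 _ (hs.trans ht), sub_self]

lemma IsStdBM.integrable_sq (hB : IsStdBM P B) {t : ℝ} (ht : 0 ≤ t) : Integrable (fun ω => B t ω ^ 2) P := by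
  lift t to ℝ≥0 using ht
  exact (hB.pre.isGaussianProcess.hasGaussianLaw_eval t).memLp_two.integrable_sq

lemma IsStdBM.integral_sq (hB : IsStdBM P B) {t : ℝ} (ht : 0 ≤ t) : ∫ ω, B t ω ^ 2 ∂P = t := by
  lift t to ℝ≥0 using ht
  have h1 := hB.pre.covariance_fun_eval t t
  have h2 := hB.pre.integral_eval t
  rw [covariance_self (hB.measurable _).aemeasurable, variance_eq_integral (hB.measurable _).aemeasurable, h2] at h1
  simpa using h1

lemma IsStdBM.integral_past_mul (hB : IsStdBM P B) {s t : ℝ} (hs : 0 ≤ s) (ht : s ≤ t)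
    (ψ : (ℝ → ℝ) → ℝ) (hψ : Measurable ψ) :
    ∫ ω, ψ (stp s fun u => B u ω) * (B t ω - B s ω) ∂P = 0 := by
  have h := (hB.indep_past hs ht).comp hψ measurable_id
  have m1 : Measurable (fun ω => stp s (fun u => B u ω)) := (measurable_stp s).comp hB.measurable_path
  have := h.integral_fun_mul_eq_mul_integral (hψ.comp m1).aestronglyMeasurable
    ((hB.measurable t).sub (hB.measurable s)).aestronglyMeasurable
  simp only [Function.comp_def, id] at this
  rw [this, hB.integral_incr hs ht, mul_zero]

lemma IsStdBM.integrable_past_mul (hB : IsStdBM P B) {s t : ℝ} (hs : 0 ≤ s) (ht : s ≤ t)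
    (ψ : (ℝ → ℝ) → ℝ) (hψ : Measurable ψ) (hi : Integrable (fun ω => ψ (stp s fun u => B u ω)) P) :
    Integrable (fun ω => ψ (stp s fun u => B u ω) * (B t ω - B s ω)) P := by
  have h := (hB.indep_past hs ht).comp hψ measurable_id
  exact h.integrable_mul hi ((hB.integrable (hs.trans ht)).sub (hB.integrable hs))

lemma IsStdBM.doob_grid (hB : IsStdBM P B) {t : ℝ} (ht : 0 ≤ t) {n : ℕ} (hn : 0 < n) :
    ∫⁻ ω, ENNReal.ofReal ((partialSups (fun k : ℕ => B (t * k / n) ω) n) ^ 2) ∂P ≤ ENNReal.ofReal (4 * t) := by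
  have hps : ∀ k, k ≤ n → Integrable (fun ω => partialSups (fun k : ℕ => B (t * k / n) ω) k) P := by
    intro k
    induction k with
    | zero => intro _; simpa using hB.integrable (t := 0) le_rfl
    | succ k ih =>
      intro h
      simp only [partialSups_add_one]
      exact (ih (by omega)).sup (hB.integrable (by positivity))
  have hmul : ∀ k, k < n → Integrable (fun ω => partialSups (fun k : ℕ => B (t * k / n) ω) k *
        (B (t * (k + 1 : ℕ) / n) ω - B (t * k / n) ω)) P ∧
      ∫ ω, partialSups (fun k : ℕ => B (t * k / n) ω) k *
        (B (t * (k + 1 : ℕ) / n) ω - B (t * k / n) ω) ∂P = 0 := by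
    intro k hk
    have e : ∀ ω, partialSups (fun k : ℕ => B (t * k / n) ω) k
        = partialSups (fun j : ℕ => (stp (t * k / n) fun u => B u ω) (t * j / n)) k := by
      intro ω
      apply partialSups_congr'
      intro j hj
      rw [stp_of _ (by positivity)]
      gcongr
    have hle : t * k / n ≤ t * (k + 1 : ℕ) / n := by gcongr; simp
    have mm := measurable_partialSups_path (fun j => t * j / n) k
    have hi := hps k hk.le
    simp only [e] at hi ⊢
    exact ⟨hB.integrable_past_mul (by positivity) hle _ mm hi, hB.integral_past_mul (by positivity) hle _ mm⟩
  have hI : Integrable (fun ω => 4 * (B (t * n / n) ω) ^ 2 - 4 * ∑ k ∈ Finset.range n,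
      partialSups (fun k : ℕ => B (t * k / n) ω) k * (B (t * (k + 1 : ℕ) / n) ω - B (t * k / n) ω)) P := by
    refine ((hB.integrable_sq (by positivity)).const_mul 4).sub (Integrable.const_mul ?_ 4)
    exact integrable_finsetSum _ fun k hk => (hmul k (Finset.mem_range.1 hk)).1
  have hle : ∀ ω, (partialSups (fun k : ℕ => B (t * k / n) ω) n) ^ 2 ≤ 4 * (B (t * n / n) ω) ^ 2 - 4 * ∑ k ∈ Finset.range n,
      partialSups (fun k : ℕ => B (t * k / n) ω) k * (B (t * (k + 1 : ℕ) / n) ω - B (t * k / n) ω) := by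
    intro ω
    exact doob_path (fun k : ℕ => B (t * k / n) ω) (by simp [hB.start]) n
  calc _ ≤ ∫⁻ ω, ENNReal.ofReal (4 * (B (t * n / n) ω) ^ 2 - 4 * ∑ k ∈ Finset.range n,
      partialSups (fun k : ℕ => B (t * k / n) ω) k * (B (t * (k + 1 : ℕ) / n) ω - B (t * k / n) ω)) ∂P := by
        gcongr with ω; exact hle ω
    _ = ENNReal.ofReal (∫ ω, (4 * (B (t * n / n) ω) ^ 2 - 4 * ∑ k ∈ Finset.range n,
      partialSups (fun k : ℕ => B (t * k / n) ω) k * (B (t * (k + 1 : ℕ) / n) ω - B (t * k / n) ω)) ∂P) := by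
        rw [ofReal_integral_eq_lintegral_ofReal hI (ae_of_all _ fun ω => (sq_nonneg _).trans (hle ω))]
    _ = ENNReal.ofReal (4 * t) := by
        congr 1
        rw [integral_sub, integral_const_mul, integral_const_mul, integral_finsetSum,
          Finset.sum_eq_zero fun k hk => (hmul k (Finset.mem_range.1 hk)).2, hB.integral_sq (by positivity)]
        · have : (n:ℝ) ≠ 0 := by positivity
          field_simp; ring
        · exact fun k hk => (hmul k (Finset.mem_range.1 hk)).1
        · exact (hB.integrable_sq (by positivity)).const_mul 4
        · exact (integrable_finsetSum _ fun k hk => (hmul k (Finset.mem_range.1 hk)).1).const_mul 4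

lemma IsStdBM.Mx_nonneg (hB : IsStdBM P B) {t : ℝ} (ht : 0 ≤ t) (ω : Ω) : 0 ≤ Mx (fun u => B u ω) t := by
  have := le_Mx (hB.cont ω) le_rfl ht
  rwa [hB.start] at this

lemma IsStdBM.measurable_Mx (hB : IsStdBM P B) (t : ℝ) : Measurable (fun ω => Mx (fun u => B u ω) t) :=
  (_root_.measurable_Mx t).comp hB.measurable_path

lemma IsStdBM.measurable_Dx (hB : IsStdBM P B) (t : ℝ) : Measurable (fun ω => Dx (fun u => B u ω) t) :=
  (_root_.measurable_Dx t).comp hB.measurable_path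

lemma IsStdBM.doob (hB : IsStdBM P B) {t : ℝ} (ht : 0 < t) :
    ∫⁻ ω, ENNReal.ofReal ((Mx (fun u => B u ω) t) ^ 2) ∂P ≤ ENNReal.ofReal (4 * t) := by
  have hmeas : ∀ n : ℕ, Measurable fun ω => ENNReal.ofReal ((partialSups (fun k : ℕ => B (t * k / n) ω) n) ^ 2) := by
    intro n
    have := (measurable_partialSups_path (fun j => t * j / n) n).comp hB.measurable_path
    exact (this.pow_const 2).ennreal_ofReal
  calc _ ≤ ∫⁻ ω, liminf (fun n : ℕ => ENNReal.ofReal ((partialSups (fun k : ℕ => B (t * k / n) ω) n) ^ 2)) atTop ∂P := by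
        gcongr with ω
        obtain ⟨u, hu, h⟩ := exists_Mx (hB.cont ω) ht.le
        rw [← h]
        have h1 : Tendsto (fun n : ℕ => ENNReal.ofReal ((B (t * (⌈(n:ℝ) * u / t⌉₊ : ℝ) / n) ω ⊔ 0) ^ 2)) atTop
            (𝓝 (ENNReal.ofReal ((B u ω ⊔ 0) ^ 2))) := by
          refine (ENNReal.continuous_ofReal.tendsto _).comp ?_
          refine Tendsto.pow ?_ 2
          exact (((hB.cont ω).tendsto _).comp (grid_tendsto ht hu.1)).max tendsto_const_nhds
        have hpos : 0 ≤ B u ω := h ▸ hB.Mx_nonneg ht.le ω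
        rw [sup_eq_left.2 hpos] at h1
        rw [← h1.liminf_eq]
        refine liminf_le_liminf ?_
        · filter_upwards with n
          apply ENNReal.ofReal_le_ofReal
          refine pow_le_pow_left₀ (le_sup_right) ?_ 2
          refine sup_le ?_ ?_
          · exact le_partialSups_of_le (fun k : ℕ => B (t * k / n) ω) (grid_ceil_le ht hu.2 n)
          · have := le_partialSups_of_le (fun k : ℕ => B (t * k / n) ω) (Nat.zero_le n)
            simpa [hB.start] using this
    _ ≤ liminf (fun n : ℕ => ∫⁻ ω, ENNReal.ofReal ((partialSups (fun k : ℕ => B (t * k / n) ω) n) ^ 2) ∂P) atTop :=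
        lintegral_liminf_le hmeas
    _ ≤ liminf (fun n : ℕ => ENNReal.ofReal (4 * t)) atTop := by
        refine liminf_le_liminf ?_
        filter_upwards [eventually_gt_atTop 0] with n hn
        exact hB.doob_grid ht.le hn
    _ = _ := by simp

lemma IsStdBM.integrable_Mx_sq (hB : IsStdBM P B) {t : ℝ} (ht : 0 < t) :
    Integrable (fun ω => (Mx (fun u => B u ω) t) ^ 2) P := by
  refine ⟨((hB.measurable_Mx t).pow_const 2).aestronglyMeasurable, ?_⟩
  rw [hasFiniteIntegral_iff_ofReal (ae_of_all _ fun ω => sq_nonneg _)]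
  exact (hB.doob ht).trans_lt ENNReal.ofReal_lt_top

lemma IsStdBM.integrable_Mx (hB : IsStdBM P B) {t : ℝ} (ht : 0 < t) :
    Integrable (fun ω => Mx (fun u => B u ω) t) P := by
  refine ((integrable_const (1:ℝ)).add (hB.integrable_Mx_sq ht)).mono'
    (hB.measurable_Mx t).aestronglyMeasurable (ae_of_all _ fun ω => ?_)
  have := hB.Mx_nonneg ht.le ω
  rw [Real.norm_eq_abs, abs_of_nonneg this]
  simp only [Pi.add_apply]
  nlinarith [sq_nonneg (Mx (fun u => B u ω) t - 1)]

lemma IsStdBM.abs_le (hB : IsStdBM P B) {s t : ℝ} (hs : s ∈ Icc 0 t) (ω : Ω) :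
    |B s ω| ≤ Mx (fun u => B u ω) t + Mx (fun u => - B u ω) t := by
  have h1 := le_Mx (hB.cont ω) hs.1 hs.2
  have h2 := le_Mx (hB.neg.cont ω) hs.1 hs.2
  have h3 := hB.Mx_nonneg (hs.1.trans hs.2) ω
  have h4 := hB.neg.Mx_nonneg (hs.1.trans hs.2) ω
  rw [_root_.abs_le]; constructor <;> linarith

lemma IsStdBM.sq_le (hB : IsStdBM P B) {s t : ℝ} (hs : s ∈ Icc 0 t) (ω : Ω) :
    (B s ω) ^ 2 ≤ Mx (fun u => B u ω) t ^ 2 + Mx (fun u => - B u ω) t ^ 2 := by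
  have h1 := le_Mx (hB.cont ω) hs.1 hs.2
  have h2 := le_Mx (hB.neg.cont ω) hs.1 hs.2
  have h3 := hB.Mx_nonneg (hs.1.trans hs.2) ω
  have h4 := hB.neg.Mx_nonneg (hs.1.trans hs.2) ω
  rcases le_total 0 (B s ω) with h | h <;> nlinarith
end bm

end part3

section part4
open MeasureTheory ProbabilityTheory Real Set Filter
open scoped ENNReal NNReal Topology

noncomputable def Gc (c u : ℝ) : ℝ := dslope (fun u => 1 - exp (-u / (2 * c))) 0 u
noncomputable def kc (s u : ℝ) : ℝ := 1 / (2 * s ^ 2) * exp (-u / (2 * s))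

lemma Gc_zero (c : ℝ) : Gc c 0 = 1 / (2 * c) := by
  unfold Gc
  rw [dslope_same]
  have : HasDerivAt (fun u : ℝ => 1 - exp (-u / (2 * c))) (-(exp (-0 / (2 * c)) * (-1 / (2 * c)))) 0 := by
    have h := (((hasDerivAt_id (0:ℝ)).neg.div_const (2 * c)).exp).const_sub 1
    simpa using h
  rw [this.deriv]; simp [neg_div]

lemma Gc_of_ne (c : ℝ) {u : ℝ} (hu : u ≠ 0) : Gc c u = (1 - exp (-u / (2 * c))) / u := by
  unfold Gc
  rw [dslope_of_ne _ hu, slope_def_field]; simp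

lemma Gc_cont (c : ℝ) : Continuous (Gc c) := by
  rw [← continuousOn_univ]
  unfold Gc
  rw [continuousOn_dslope univ_mem]
  exact ⟨by fun_prop, by fun_prop⟩

lemma Gc_nonneg {c u : ℝ} (hc : 0 < c) (hu : 0 ≤ u) : 0 ≤ Gc c u := by
  rcases eq_or_lt_of_le hu with rfl | h
  · rw [Gc_zero]; positivity
  · rw [Gc_of_ne c h.ne']
    apply div_nonneg _ hu
    have : exp (-u / (2 * c)) ≤ 1 := exp_le_one_iff.2 (by rw [neg_div]; simp; positivity)
    linarith

lemma Gc_le {c u : ℝ} (hc : 0 < c) (hu : 0 ≤ u) : Gc c u ≤ 1 / (2 * c) := by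
  rcases eq_or_lt_of_le hu with rfl | h
  · rw [Gc_zero]
  · rw [Gc_of_ne c h.ne', div_le_iff₀ h]
    have := add_one_le_exp (-u / (2 * c))
    have e : 1 / (2 * c) * u = - (-u / (2 * c)) := by ring
    rw [e]; linarith

lemma Gc_le_inv (c : ℝ) {u : ℝ} (hu : 0 < u) : Gc c u ≤ 1 / u := by
  rw [Gc_of_ne c hu.ne']
  gcongr
  linarith [exp_pos (-u / (2 * c))]

lemma Gc_diff_nonneg {c δ u : ℝ} (hc : 0 < c) (hδ : 0 ≤ δ) (hu : 0 ≤ u) : Gc (c + δ) u ≤ Gc c u := by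
  rcases eq_or_lt_of_le hu with rfl | h
  · rw [Gc_zero, Gc_zero]; gcongr; linarith
  · rw [Gc_of_ne _ h.ne', Gc_of_ne _ h.ne']
    gcongr ?_ / u
    have : -u / (2 * c) ≤ -u / (2 * (c + δ)) := by
      rw [neg_div, neg_div, neg_le_neg_iff]; gcongr; linarith
    linarith [exp_le_exp.2 this]

lemma Gc_diff_le {c δ u : ℝ} (hc : 0 < c) (hδ : 0 ≤ δ) (hu : 0 ≤ u) :
    Gc c u - Gc (c + δ) u ≤ δ / (2 * c ^ 2) * exp (-u / (2 * (c + δ))) := by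
  have h1 : 1 / (2 * c) - 1 / (2 * (c + δ)) ≤ δ / (2 * c ^ 2) := by
    have : 1 / (2 * c) - 1 / (2 * (c + δ)) = δ / (2 * (c * (c + δ))) := by field_simp; ring
    rw [this]; gcongr; nlinarith
  rcases eq_or_lt_of_le hu with rfl | h
  · rw [Gc_zero, Gc_zero]; simpa using h1
  · rw [Gc_of_ne _ h.ne', Gc_of_ne _ h.ne', ← sub_div, div_le_iff₀ h]
    have e : exp (-u / (2 * c)) = exp (-u / (2 * (c + δ))) * exp (- (u * (1 / (2 * c) - 1 / (2 * (c + δ))))) := by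
      rw [← exp_add]; congr 1; ring
    have h2 := add_one_le_exp (- (u * (1 / (2 * c) - 1 / (2 * (c + δ)))))
    have h3 := exp_pos (-u / (2 * (c + δ)))
    have h4 : u * (1 / (2 * c) - 1 / (2 * (c + δ))) ≤ u * (δ / (2 * c ^ 2)) := by gcongr
    rw [e]; nlinarith

lemma Gc_tendsto {u : ℝ} (hu : 0 < u) :
    Tendsto (fun n : ℕ => Gc (1 / ((n:ℝ) + 1)) u) atTop (𝓝 (1 / u)) := by
  simp_rw [Gc_of_ne _ hu.ne']
  have : Tendsto (fun n : ℕ => exp (-u / (2 * (1 / ((n:ℝ) + 1))))) atTop (𝓝 0) := by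
    apply tendsto_exp_atBot.comp
    have e : (fun n : ℕ => -u / (2 * (1 / ((n:ℝ) + 1)))) = fun n : ℕ => (-(u / 2)) * ((n:ℝ) + 1) := by
      ext n; field_simp
    rw [e]
    apply Tendsto.const_mul_atTop_of_neg (by linarith)
    exact tendsto_atTop_add_const_right _ _ tendsto_natCast_atTop_atTop
  simpa using (this.const_sub 1).div_const u

lemma kc_nonneg (s u : ℝ) : 0 ≤ kc s u := by unfold kc; positivity

lemma kc_lint {c u : ℝ} (hc : 0 < c) (hu : 0 ≤ u) :
    ∫⁻ s in Ioi c, ENNReal.ofReal (kc s u) = ENNReal.ofReal (Gc c u) := by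
  have hder : ∀ s ∈ Ici c, HasDerivAt (fun s => - Gc s u) (kc s u) s := by
    intro s hs
    have hs0 : 0 < s := hc.trans_le hs
    rcases eq_or_lt_of_le hu with rfl | h
    · have h1 : HasDerivAt (fun s : ℝ => -(1/2 * s⁻¹)) (-(1/2 * -(s ^ 2)⁻¹)) s :=
        ((hasDerivAt_inv hs0.ne').const_mul (1/2)).neg
      have e : (fun s : ℝ => - Gc s 0) = fun s : ℝ => -(1/2 * s⁻¹) := by
        ext r; rw [Gc_zero]; ring
      rw [e]
      refine h1.congr_deriv ?_
      unfold kc; simp; ring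
    · have h1 : HasDerivAt (fun s : ℝ => -u / 2 * s⁻¹) (-u / 2 * -(s ^ 2)⁻¹) s :=
        (hasDerivAt_inv hs0.ne').const_mul (-u / 2)
      have h2 : HasDerivAt (fun s : ℝ => -((1 - exp (-u / 2 * s⁻¹)) / u))
        (-(-(exp (-u / 2 * s⁻¹) * (-u / 2 * -(s ^ 2)⁻¹)) / u)) s :=
        ((h1.exp.const_sub 1).div_const u).neg
      have e : (fun s : ℝ => - Gc s u) = fun s : ℝ => -((1 - exp (-u / 2 * s⁻¹)) / u) := by
        ext r; rw [Gc_of_ne _ h.ne']; congr 4; ring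
      rw [e]
      refine h2.congr_deriv ?_
      have e2 : -u / 2 * s⁻¹ = -u / (2 * s) := by ring
      unfold kc; rw [e2]; field_simp
  have hlim : Tendsto (fun s => - Gc s u) atTop (𝓝 0) := by
    have h1 : Tendsto (fun s : ℝ => 1 / (2 * s)) atTop (𝓝 0) :=
      tendsto_const_nhds.div_atTop (tendsto_id.const_mul_atTop two_pos)
    have h2 : Tendsto (fun s : ℝ => Gc s u) atTop (𝓝 0) := by
      refine tendsto_of_tendsto_of_tendsto_of_le_of_le' tendsto_const_nhds h1 ?_ ?_
      · filter_upwards [eventually_gt_atTop 0] with s hs using Gc_nonneg hs hu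
      · filter_upwards [eventually_gt_atTop 0] with s hs using Gc_le hs hu
    simpa using h2.neg
  have hi := integrableOn_Ioi_deriv_of_nonneg' hder (fun s _ => kc_nonneg s u) hlim
  have he := integral_Ioi_of_hasDerivAt_of_nonneg' hder (fun s _ => kc_nonneg s u) hlim
  rw [← ofReal_integral_eq_lintegral_ofReal hi (ae_of_all _ fun s => kc_nonneg s u), he]
  simp

lemma gauss_exp {s δ : ℝ} (hs : 0 < s) (hδ : 0 < δ) (x : ℝ) :
    ∫ y, exp (-(x + y) ^ 2 / (2 * s)) ∂(gaussianReal 0 δ.toNNReal)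
      = √(s / (s + δ)) * exp (-x ^ 2 / (2 * (s + δ))) := by
  rw [integral_gaussianReal_eq_integral_smul (by simpa using hδ)]
  have e : ∀ y : ℝ, gaussianPDFReal 0 δ.toNNReal y • exp (-(x + y) ^ 2 / (2 * s))
      = (√(2 * π * δ))⁻¹ * exp (-x ^ 2 / (2 * (s + δ))) *
        exp (-((s + δ) / (2 * s * δ)) * (y + x * δ / (s + δ)) ^ 2) := by
    intro y
    rw [gaussianPDFReal, Real.coe_toNNReal _ hδ.le, smul_eq_mul, mul_assoc (√(2 * π * δ))⁻¹, mul_assoc (√(2 * π * δ))⁻¹, ← exp_add, ← exp_add]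
    congr 2
    field_simp; ring
  simp_rw [e]
  rw [integral_const_mul, integral_add_right_eq_self (fun y => exp (-((s + δ) / (2 * s * δ)) * y ^ 2)),
    integral_gaussian]
  have : √(π / ((s + δ) / (2 * s * δ))) = √(2 * π * δ) * √(s / (s + δ)) := by
    rw [← Real.sqrt_mul (by positivity)]
    congr 1; field_simp
  rw [this]
  have : √(2 * π * δ) ≠ 0 := by positivity
  field_simp

lemma gauss_kc {s δ : ℝ} (hs : 0 < s) (hδ : 0 < δ) (x : Fin 4 → ℝ) :
    ∫⁻ y, ENNReal.ofReal (kc s (∑ i, (x i + y i) ^ 2)) ∂(Measure.pi fun _ : Fin 4 => gaussianReal 0 δ.toNNReal)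
      = ENNReal.ofReal (kc (s + δ) (∑ i, x i ^ 2)) := by
  have e : ∀ y : Fin 4 → ℝ, kc s (∑ i, (x i + y i) ^ 2)
      = 1 / (2 * s ^ 2) * ∏ i, exp (-(x i + y i) ^ 2 / (2 * s)) := by
    intro y
    rw [← exp_sum, kc, ← Finset.sum_div, Finset.sum_neg_distrib]
  have hI : Integrable (fun y => kc s (∑ i, (x i + y i) ^ 2))
      (Measure.pi fun _ : Fin 4 => gaussianReal 0 δ.toNNReal) := by
    refine (integrable_const (1 / (2 * s ^ 2))).mono' ?_ ?_
    · apply Measurable.aestronglyMeasurable; unfold kc; fun_prop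
    · filter_upwards with y
      rw [Real.norm_eq_abs, abs_of_nonneg (kc_nonneg _ _), kc]
      apply mul_le_of_le_one_right (by positivity)
      apply exp_le_one_iff.2
      rw [neg_div, neg_nonpos]; positivity
  rw [← ofReal_integral_eq_lintegral_ofReal hI (ae_of_all _ fun y => kc_nonneg _ _)]
  congr 1
  simp_rw [e]
  rw [integral_const_mul, integral_fintype_prod_eq_prod (𝕜 := ℝ) (f := fun i y => exp (-(x i + y) ^ 2 / (2 * s)))]
  simp_rw [gauss_exp hs hδ]
  rw [Finset.prod_mul_distrib, ← exp_sum, kc, ← Finset.sum_div, Finset.sum_neg_distrib, ← mul_assoc]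
  congr 1
  simp only [Finset.prod_const, Finset.card_univ, Fintype.card_fin]
  have h4 : √(s / (s + δ)) ^ 4 = (s / (s + δ)) ^ 2 := by
    rw [show (4:ℕ) = 2 * 2 by norm_num, pow_mul, Real.sq_sqrt (by positivity)]
  rw [h4]; field_simp

lemma gauss_Gc {c δ : ℝ} (hc : 0 < c) (hδ : 0 < δ) (x : Fin 4 → ℝ) :
    ∫⁻ y, ENNReal.ofReal (Gc c (∑ i, (x i + y i) ^ 2)) ∂(Measure.pi fun _ : Fin 4 => gaussianReal 0 δ.toNNReal)
      = ENNReal.ofReal (Gc (c + δ) (∑ i, x i ^ 2)) := by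
  have hpos : ∀ z : Fin 4 → ℝ, 0 ≤ ∑ i, z i ^ 2 := fun z => by positivity
  have e : ∀ y : Fin 4 → ℝ, ENNReal.ofReal (Gc c (∑ i, (x i + y i) ^ 2))
      = ∫⁻ s in Ioi c, ENNReal.ofReal (kc s (∑ i, (x i + y i) ^ 2)) :=
    fun y => (kc_lint hc (hpos fun i => x i + y i)).symm
  simp_rw [e]
  rw [lintegral_lintegral_swap]
  · have : ∫⁻ s in Ioi c, ∫⁻ y, ENNReal.ofReal (kc s (∑ i, (x i + y i) ^ 2))
        ∂(Measure.pi fun _ : Fin 4 => gaussianReal 0 δ.toNNReal)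
        = ∫⁻ s in Ioi c, ENNReal.ofReal (kc (s + δ) (∑ i, x i ^ 2)) :=
      setLIntegral_congr_fun measurableSet_Ioi fun s hs => gauss_kc (hc.trans hs) hδ x
    rw [this, ← kc_lint (by linarith) (hpos x), ← lintegral_indicator measurableSet_Ioi,
      ← lintegral_indicator measurableSet_Ioi,
      ← lintegral_add_right_eq_self (fun s => (Ioi (c + δ)).indicator (fun s => ENNReal.ofReal (kc s (∑ i, x i ^ 2))) s) δ]
    congr 1; ext s
    simp [indicator_apply]
  · apply Measurable.aemeasurable
    unfold kc
    simp only [Function.uncurry_def]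
    fun_prop

lemma gauss_sq {δ : ℝ} (hδ : 0 < δ) (x : ℝ) :
    ∫⁻ y, ENNReal.ofReal ((x + y) ^ 2) ∂(gaussianReal 0 δ.toNNReal) = ENNReal.ofReal (x ^ 2 + δ) := by
  have hm : MemLp (fun y : ℝ => y) 2 (gaussianReal 0 δ.toNNReal) := memLp_id_gaussianReal 2
  have h1 : Integrable (fun y : ℝ => y) (gaussianReal 0 δ.toNNReal) := hm.integrable (by norm_num)
  have h2 : Integrable (fun y : ℝ => y ^ 2) (gaussianReal 0 δ.toNNReal) := hm.integrable_sq
  have v : ∫ y, y ^ 2 ∂(gaussianReal 0 δ.toNNReal) = δ := by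
    have := variance_id_gaussianReal (μ := 0) (v := δ.toNNReal)
    rw [variance_eq_integral (by fun_prop)] at this
    simpa [hδ.le] using this
  have m : ∫ y, y ∂(gaussianReal 0 δ.toNNReal) = 0 := integral_id_gaussianReal
  have e : ∀ y : ℝ, (x + y) ^ 2 = x ^ 2 + (2 * x) * y + y ^ 2 := fun y => by ring
  have hI : Integrable (fun y : ℝ => (x + y) ^ 2) (gaussianReal 0 δ.toNNReal) := by
    simp_rw [e]; exact ((integrable_const _).add (h1.const_mul _)).add h2
  rw [← ofReal_integral_eq_lintegral_ofReal hI (ae_of_all _ fun y => sq_nonneg _)]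
  congr 1
  simp_rw [e]
  have h3 : Integrable (fun y => x ^ 2 + (2 * x) * y) (gaussianReal 0 δ.toNNReal) :=
    (integrable_const _).add (h1.const_mul _)
  rw [integral_add h3 h2,
    integral_add (integrable_const _) (h1.const_mul _), integral_const_mul, v, m]
  simp

lemma gauss_sum_sq {δ : ℝ} (hδ : 0 < δ) (x : Fin 4 → ℝ) :
    ∫⁻ y, ENNReal.ofReal (∑ i, (x i + y i) ^ 2) ∂(Measure.pi fun _ : Fin 4 => gaussianReal 0 δ.toNNReal)
      = ENNReal.ofReal (∑ i, x i ^ 2 + 4 * δ) := by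
  simp_rw [ENNReal.ofReal_sum_of_nonneg (fun i _ => sq_nonneg _)]
  rw [lintegral_finsetSum _ (fun i _ => by fun_prop)]
  have : ∀ i, ∫⁻ y : Fin 4 → ℝ, ENNReal.ofReal ((x i + y i) ^ 2) ∂(Measure.pi fun _ : Fin 4 => gaussianReal 0 δ.toNNReal)
      = ENNReal.ofReal (x i ^ 2 + δ) := by
    intro i
    rw [← gauss_sq hδ]
    exact (measurePreserving_eval (fun _ : Fin 4 => gaussianReal 0 δ.toNNReal) i).lintegral_comp
      (f := fun y => ENNReal.ofReal ((x i + y) ^ 2)) (by fun_prop)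
  simp_rw [this]
  rw [← ENNReal.ofReal_sum_of_nonneg (fun i _ => by positivity), Finset.sum_add_distrib]
  simp

end part4

section part5
open MeasureTheory ProbabilityTheory Real Set Filter
open scoped ENNReal NNReal Topology

lemma hit_level {f : ℝ → ℝ} (hf : Continuous f) {S y t : ℝ} (hS : S ∈ Icc 0 t) (h0 : f 0 ≤ y)
    (h : y ≤ Mx f S) : f (min S (cross (Mx f) y t)) = y := by
  have ht : 0 ≤ t := hS.1.trans hS.2
  have hmono : ∀ s u, 0 ≤ s → s ≤ u → Mx f s ≤ Mx f u := fun s u h1 h2 => Mx_mono hf h1 h2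
  have h1 : cross (Mx f) y t ≤ S := cross_le_of hS.1 h
  rw [min_eq_right h1]
  obtain ⟨h3, h4⟩ := cross_mem (a := y) (Mx_cont hf) ht
  have h5 : y ≤ Mx f (cross (Mx f) y t) := by
    rcases h4 with h4 | h4
    · exact h4
    · exact h.trans (Mx_mono hf hS.1 (hS.2.trans h4))
  have h6 := cross_val_le (Mx_cont hf) hmono ht (a := y) (t := t) (by rw [Mx_zero hf]; exact h0)
  obtain ⟨u, hu, hu'⟩ := exists_Mx hf h3
  rcases eq_or_lt_of_le hu.2 with h7 | h7
  · have e : f (cross (Mx f) y t) = Mx f (cross (Mx f) y t) := by rw [h7] at hu'; exact hu'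
    linarith
  · have := ((lt_cross (Mx_cont hf) hmono ht hu.1).1 h7).1
    have := le_Mx hf hu.1 le_rfl
    linarith

lemma no_hit_level {f : ℝ → ℝ} (hf : Continuous f) {S y t : ℝ} (hS : S ∈ Icc 0 t)
    (h : Mx f S < y) : min S (cross (Mx f) y t) = S := by
  have ht : 0 ≤ t := hS.1.trans hS.2
  apply min_eq_left
  by_contra! h1
  obtain ⟨h3, h4⟩ := cross_mem (a := y) (Mx_cont hf) ht
  rcases h4 with h4 | h4
  · have := Mx_mono hf h3 h1.le
    linarith
  · linarith [hS.2]

section A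
variable {Ω : Type*} [MeasurableSpace Ω] {P : Measure Ω} [IsProbabilityMeasure P]
  {γ : ℝ → Ω → EuclideanSpace ℝ (Fin 4)}

omit [MeasurableSpace Ω] in
lemma U_eq (γ : ℝ → Ω → EuclideanSpace ℝ (Fin 4)) (t : ℝ) (ω : Ω) : sqBessel4 γ t ω = ∑ i, (γ t ω i) ^ 2 := by
  unfold sqBessel4
  rw [EuclideanSpace.real_norm_sq_eq]

omit [MeasurableSpace Ω] in
lemma U_nonneg (γ : ℝ → Ω → EuclideanSpace ℝ (Fin 4)) (t : ℝ) (ω : Ω) : 0 ≤ sqBessel4 γ t ω := by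
  unfold sqBessel4; positivity

lemma IsStdBMVec.U_cont (hγ : IsStdBMVec 4 P γ) (ω : Ω) : Continuous fun t => sqBessel4 γ t ω := by
  simp only [U_eq]
  exact continuous_finsetSum _ fun i _ => ((hγ.coord i).cont ω).pow 2

lemma IsStdBMVec.U_zero (hγ : IsStdBMVec 4 P γ) (ω : Ω) : sqBessel4 γ 0 ω = 0 := by
  simp [U_eq, (hγ.coord _).start]

lemma IsStdBMVec.U_meas (hγ : IsStdBMVec 4 P γ) (t : ℝ) : Measurable (sqBessel4 γ t) := by
  have : sqBessel4 γ t = fun ω => ∑ i, (γ t ω i) ^ 2 := funext fun ω => U_eq γ t ω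
  rw [this]
  exact Finset.measurable_sum _ fun i _ => ((hγ.coord i).measurable t).pow_const 2

lemma IsStdBMVec.U_path (hγ : IsStdBMVec 4 P γ) : Measurable (fun ω t => sqBessel4 γ t ω) :=
  measurable_pi_lambda _ fun t => hγ.U_meas t

lemma IsStdBMVec.U_step (hγ : IsStdBMVec 4 P γ) {s t : ℝ} (hs : 0 ≤ s) (hst : s ≤ t)
    {A : Set (ℝ → ℝ)} (hA : MeasurableSet A) (F H : ℝ → ℝ≥0∞) (hF : Measurable F)
    (hFH : ∀ x : Fin 4 → ℝ, ∫⁻ y, F (∑ i, (x i + y i) ^ 2)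
      ∂(Measure.pi fun _ : Fin 4 => gaussianReal 0 (t - s).toNNReal) = H (∑ i, (x i) ^ 2)) :
    ∫⁻ ω in {ω | stp s (fun u => sqBessel4 γ u ω) ∈ A}, F (sqBessel4 γ t ω) ∂P
      = ∫⁻ ω in {ω | stp s (fun u => sqBessel4 γ u ω) ∈ A}, H (sqBessel4 γ s ω) ∂P := by
  classical
  have hE : MeasurableSet {ω | stp s (fun u => sqBessel4 γ u ω) ∈ A} :=
    ((measurable_stp s).comp hγ.U_path) hA
  have hUf : Measurable (fun p : (Fin 4 → ℝ → ℝ) => fun u : ℝ => ∑ i, (p i u) ^ 2) := by fun_prop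
  have hB : MeasurableSet {p : (Fin 4 → ℝ → ℝ) | (fun u : ℝ => ∑ i, (p i u) ^ 2) ∈ A} := hUf hA
  have e1 : ∀ ω, (fun u => ∑ i, (stp s (fun u => γ u ω i) u) ^ 2) = stp s (fun u => sqBessel4 γ u ω) := by
    intro ω; ext u; simp only [stp, U_eq]
  let Φ : (Fin 4 → ℝ → ℝ) × (Fin 4 → ℝ) → ℝ≥0∞ := fun q =>
    ({p : (Fin 4 → ℝ → ℝ) | (fun u : ℝ => ∑ i, (p i u) ^ 2) ∈ A} ×ˢ univ).indicator
      (fun q : (Fin 4 → ℝ → ℝ) × (Fin 4 → ℝ) => F (∑ i, (q.1 i s + q.2 i) ^ 2)) q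
  have hΦ : Measurable Φ := by
    refine Measurable.indicator (hF.comp ?_) (hB.prod MeasurableSet.univ)
    fun_prop
  have key := hγ.freeze hs hst Φ hΦ
  rw [← lintegral_indicator hE, ← lintegral_indicator hE]
  convert key using 1
  · congr 1; ext ω
    simp only [Φ, indicator_apply, mem_ofPred_eq, mem_prod, mem_univ, and_true, e1]
    congr 1
    simp only [stp_of _ hs le_rfl, U_eq]
    congr 2; ext i; congr 1; ring
  · congr 1; ext ω
    simp only [Φ, indicator_apply, mem_ofPred_eq, mem_prod, mem_univ, and_true, e1]
    split_ifs with h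
    · simp only [stp_of _ hs le_rfl, hFH, U_eq]
    · simp

lemma IsStdBMVec.G_step (hγ : IsStdBMVec 4 P γ) {s t c : ℝ} (hc : 0 < c) (hs : 0 ≤ s) (hst : s < t)
    {A : Set (ℝ → ℝ)} (hA : MeasurableSet A) :
    ∫ ω in {ω | stp s (fun u => sqBessel4 γ u ω) ∈ A}, Gc c (sqBessel4 γ t ω) ∂P
      = ∫ ω in {ω | stp s (fun u => sqBessel4 γ u ω) ∈ A}, Gc (c + (t - s)) (sqBessel4 γ s ω) ∂P := by
  have := hγ.U_step hs hst.le hA (fun u => ENNReal.ofReal (Gc c u)) (fun u => ENNReal.ofReal (Gc (c + (t - s)) u))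
    ((Gc_cont c).measurable.ennreal_ofReal) (fun x => gauss_Gc hc (by linarith) x)
  rw [integral_eq_lintegral_of_nonneg_ae (ae_of_all _ fun ω => Gc_nonneg hc (U_nonneg γ _ _))
      ((Gc_cont c).measurable.comp (hγ.U_meas t)).aestronglyMeasurable,
    integral_eq_lintegral_of_nonneg_ae (ae_of_all _ fun ω => Gc_nonneg (by linarith) (U_nonneg γ _ _))
      ((Gc_cont _).measurable.comp (hγ.U_meas s)).aestronglyMeasurable, this]

lemma IsStdBMVec.U_integrable (hγ : IsStdBMVec 4 P γ) {t : ℝ} (ht : 0 ≤ t) : Integrable (sqBessel4 γ t) P := by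
  have : sqBessel4 γ t = fun ω => ∑ i, (γ t ω i) ^ 2 := funext fun ω => U_eq γ t ω
  rw [this]
  exact integrable_finsetSum _ fun i _ => (hγ.coord i).integrable_sq ht

lemma IsStdBMVec.S_step (hγ : IsStdBMVec 4 P γ) {s t : ℝ} (hs : 0 ≤ s) (hst : s < t)
    {A : Set (ℝ → ℝ)} (hA : MeasurableSet A) :
    ∫ ω in {ω | stp s (fun u => sqBessel4 γ u ω) ∈ A}, (sqBessel4 γ t ω - sqBessel4 γ s ω) ∂P
      = ∫ ω in {ω | stp s (fun u => sqBessel4 γ u ω) ∈ A}, 4 * (t - s) ∂P := by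
  have := hγ.U_step hs hst.le hA (fun u => ENNReal.ofReal u) (fun u => ENNReal.ofReal (u + 4 * (t - s)))
    (by fun_prop) (fun x => gauss_sum_sq (by linarith) x)
  rw [integral_sub (hγ.U_integrable (hs.trans hst.le)).integrableOn (hγ.U_integrable hs).integrableOn,
    sub_eq_iff_eq_add, add_comm, ← integral_add (hγ.U_integrable hs).integrableOn (integrable_const _),
    integral_eq_lintegral_of_nonneg_ae (ae_of_all _ fun ω => U_nonneg γ _ _)
      (hγ.U_meas t).aestronglyMeasurable,
    integral_eq_lintegral_of_nonneg_ae (ae_of_all _ fun ω => add_nonneg (U_nonneg γ _ _) (by linarith))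
      ((hγ.U_meas s).add_const _).aestronglyMeasurable, this]

/-- truncated drawdown time -/
noncomputable def tauT (γ : ℝ → Ω → EuclideanSpace ℝ (Fin 4)) (t : ℝ) (ω : Ω) : ℝ :=
  cross (Dx fun u => sqBessel4 γ u ω) 1 t

lemma IsStdBMVec.tauT_mem (hγ : IsStdBMVec 4 P γ) {t : ℝ} (ht : 0 ≤ t) (ω : Ω) : tauT γ t ω ∈ Icc 0 t :=
  ⟨(cross_mem (Dx_cont (hγ.U_cont ω)) ht).1, cross_le ht⟩

lemma IsStdBMVec.lt_tauT (hγ : IsStdBMVec 4 P γ) {t s : ℝ} (ht : 0 ≤ t) (hs : 0 ≤ s) (ω : Ω) :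
    s < tauT γ t ω ↔ Dx (fun u => sqBessel4 γ u ω) s < 1 ∧ s < t :=
  lt_cross (Dx_cont (hγ.U_cont ω)) (fun _ _ h1 h2 => Dx_mono (hγ.U_cont ω) h1 h2) ht hs

lemma IsStdBMVec.meas_lt_tauT (hγ : IsStdBMVec 4 P γ) {t s : ℝ} (ht : 0 ≤ t) (hs : 0 ≤ s) :
    MeasurableSet {ω | s < tauT γ t ω} := by
  simp only [hγ.lt_tauT ht hs]
  exact (measurableSet_lt ((measurable_Dx s).comp hγ.U_path) measurable_const).inter (.const _)

lemma IsStdBMVec.lt_sig (hγ : IsStdBMVec 4 P γ) {t s y : ℝ} (ht : 0 ≤ t) (hs : 0 ≤ s) (ω : Ω) :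
    s < cross (Mx fun u => sqBessel4 γ u ω) y t ↔ Mx (fun u => sqBessel4 γ u ω) s < y ∧ s < t :=
  lt_cross (Mx_cont (hγ.U_cont ω)) (fun _ _ h1 h2 => Mx_mono (hγ.U_cont ω) h1 h2) ht hs

lemma IsStdBMVec.stop_diff (hγ : IsStdBMVec 4 P γ) {t y c : ℝ} (ht : 0 < t) (hy : 0 < y) (hc : 0 < c) :
    let I := ∫ ω in {ω | y ≤ Mx (fun u => sqBessel4 γ u ω) (tauT γ t ω)},
      (Gc c (sqBessel4 γ (tauT γ t ω) ω) - Gc c y) ∂P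
    I ≤ 0 ∧ - (t / (2 * c ^ 2) * exp (-(y - 1) / (2 * c))) ≤ I := by
  intro I
  set Z : ℝ → Ω → ℝ := fun s ω => Gc c (sqBessel4 γ s ω) with hZ
  set S2 : Ω → ℝ := fun ω => min (tauT γ t ω) (cross (Mx fun u => sqBessel4 γ u ω) y t) with hS2d
  have hm : ∀ s ∈ Icc 0 t, Measurable (Z s) := fun s _ => (Gc_cont c).measurable.comp (hγ.U_meas s)
  have hcont : ∀ ω, Continuous fun s => Z s ω := fun ω => (Gc_cont c).comp (hγ.U_cont ω)
  have hK : Integrable (fun _ : Ω => 1 / (2 * c)) P := integrable_const _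
  have hb : ∀ s ∈ Icc 0 t, ∀ ω, |Z s ω| ≤ 1 / (2 * c) := fun s _ ω => by
    rw [abs_of_nonneg (Gc_nonneg hc (U_nonneg γ _ _))]; exact Gc_le hc (U_nonneg γ _ _)
  have hS1 := hγ.tauT_mem ht.le
  have hS2 : ∀ ω, S2 ω ∈ Icc 0 t := fun ω => ⟨le_min (hS1 ω).1 (cross_mem (Mx_cont (hγ.U_cont ω)) ht.le).1,
    (min_le_left _ _).trans (hS1 ω).2⟩
  have hM : ∀ s, 0 ≤ s → MeasurableSet {ω | s < S2 ω} := by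
    intro s hs
    simp only [hS2d, lt_min_iff, hγ.lt_tauT ht.le hs, hγ.lt_sig ht.le hs]
    exact ((measurableSet_lt ((measurable_Dx s).comp hγ.U_path) measurable_const).inter (.const _)).inter
      ((measurableSet_lt ((measurable_Mx s).comp hγ.U_path) measurable_const).inter (.const _))
  have o1 := optional_stopping ht hm hcont hK hb hS1 (fun s hs => hγ.meas_lt_tauT ht.le hs)
  have o2 := optional_stopping ht hm hcont hK hb hS2 hM
  have i1 := stop_integrable ht hm hcont hK hb hS1 (fun s hs => hγ.meas_lt_tauT ht.le hs)
  have i2 := stop_integrable ht hm hcont hK hb hS2 hM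
  have o := o1.sub o2
  have hMm : Measurable (fun ω => Mx (fun u => sqBessel4 γ u ω) (tauT γ t ω)) :=
    stop_aesm (Z := fun s ω => Mx (fun u => sqBessel4 γ u ω) s) ht
      (fun s _ => (measurable_Mx s).comp hγ.U_path) (fun ω => Mx_cont (hγ.U_cont ω)) hS1
      (fun s hs => hγ.meas_lt_tauT ht.le hs)
  have eI : ∫ ω, Z (tauT γ t ω) ω ∂P - ∫ ω, Z 0 ω ∂P - (∫ ω, Z (S2 ω) ω ∂P - ∫ ω, Z 0 ω ∂P) = I := by
    have : I = ∫ ω, (Z (tauT γ t ω) ω - Z (S2 ω) ω) ∂P := by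
      simp only [I]
      rw [← integral_indicator (measurableSet_le measurable_const hMm)]
      congr 1; ext ω
      simp only [indicator_apply, mem_ofPred_eq]
      split_ifs with h
      · simp only [hZ, hS2d]
        rw [hit_level (hγ.U_cont ω) (hS1 ω) (by rw [hγ.U_zero]; exact hy.le) h]
      · simp only [hS2d]
        rw [no_hit_level (hγ.U_cont ω) (hS1 ω) (not_le.1 h)]; simp
    rw [this, integral_sub i1 i2]; ring
  rw [eI] at o
  have bnd : ∀ n : ℕ, 0 < n → ∀ k ∈ Finset.range n,
      - (t / n / (2 * c ^ 2) * exp (-(y - 1) / (2 * (c + t / n)))) ≤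
      (∫ ω in {ω | t * k / n < tauT γ t ω}, (Z (t * ((k + 1 : ℕ) : ℝ) / n) ω - Z (t * k / n) ω) ∂P) -
      (∫ ω in {ω | t * k / n < S2 ω}, (Z (t * ((k + 1 : ℕ) : ℝ) / n) ω - Z (t * k / n) ω) ∂P) ∧
      (∫ ω in {ω | t * k / n < tauT γ t ω}, (Z (t * ((k + 1 : ℕ) : ℝ) / n) ω - Z (t * k / n) ω) ∂P) -
      (∫ ω in {ω | t * k / n < S2 ω}, (Z (t * ((k + 1 : ℕ) : ℝ) / n) ω - Z (t * k / n) ω) ∂P) ≤ 0 := by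
    intro n hn k hk
    have hk := Finset.mem_range.1 hk
    have hn' : (0:ℝ) < n := by exact_mod_cast hn
    set s := t * k / n with hs
    set s' := t * ((k + 1 : ℕ) : ℝ) / n with hs'
    have hsm : s ∈ Icc 0 t := grid_mem ht.le hk.le
    have hsm' : s' ∈ Icc 0 t := grid_mem ht.le hk
    have hδ : s' - s = t / n := by simp only [hs, hs']; push_cast; ring
    have hδ0 : 0 < t / n := by positivity
    have hss : s < s' := by linarith
    have hst : s < t := hss.trans_le hsm'.2
    have iZ : ∀ r ∈ Icc 0 t, Integrable (Z r) P := fun r hr =>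
      hK.mono' (hm r hr).aestronglyMeasurable (ae_of_all _ fun ω => hb r hr ω)
    let A : Set (ℝ → ℝ) := {g | Dx g s < 1 ∧ y ≤ Mx g s}
    have hA : MeasurableSet A := (measurableSet_lt (measurable_Dx s) measurable_const).inter
      (measurableSet_le measurable_const (measurable_Mx s))
    have hE : {ω | stp s (fun u => sqBessel4 γ u ω) ∈ A} = {ω | s < tauT γ t ω} \ {ω | s < S2 ω} := by
      ext ω
      simp only [A, mem_ofPred_eq, Set.mem_sdiff, hS2d, lt_min_iff, hγ.lt_tauT ht.le hsm.1, hγ.lt_sig ht.le hsm.1,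
        Dx_stp hsm.1 le_rfl, Mx_stp hsm.1 le_rfl, hst, and_true, ← not_lt]
      tauto
    have hsub : {ω | s < S2 ω} ⊆ {ω | s < tauT γ t ω} := fun ω h => lt_of_lt_of_le (mem_ofPred_eq ▸ h) (min_le_left _ _)
    have e1 : (∫ ω in {ω | s < tauT γ t ω}, (Z s' ω - Z s ω) ∂P) - (∫ ω in {ω | s < S2 ω}, (Z s' ω - Z s ω) ∂P)
        = ∫ ω in {ω | stp s (fun u => sqBessel4 γ u ω) ∈ A}, (Z s' ω - Z s ω) ∂P := by
      rw [hE]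
      exact (integral_diff (f := fun ω => Z s' ω - Z s ω) (hM s hsm.1) ((iZ s' hsm').sub (iZ s hsm)).integrableOn hsub).symm
    have iG : Integrable (fun ω => Gc (c + t / n) (sqBessel4 γ s ω)) P := by
      refine (integrable_const (1 / (2 * (c + t / n)))).mono'
        ((Gc_cont _).measurable.comp (hγ.U_meas s)).aestronglyMeasurable (ae_of_all _ fun ω => ?_)
      rw [Real.norm_eq_abs, abs_of_nonneg (Gc_nonneg (by positivity) (U_nonneg γ _ _))]
      exact Gc_le (by positivity) (U_nonneg γ _ _)
    have e2 : ∫ ω in {ω | stp s (fun u => sqBessel4 γ u ω) ∈ A}, (Z s' ω - Z s ω) ∂P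
        = - ∫ ω in {ω | stp s (fun u => sqBessel4 γ u ω) ∈ A}, (Z s ω - Gc (c + t / n) (sqBessel4 γ s ω)) ∂P := by
      rw [integral_sub (iZ s' hsm').integrableOn (iZ s hsm).integrableOn,
        integral_sub (iZ s hsm).integrableOn iG.integrableOn, hγ.G_step hc hsm.1 hss hA, hδ]
      ring
    rw [e1, e2]
    have hmE : MeasurableSet {ω | stp s (fun u => sqBessel4 γ u ω) ∈ A} :=
      ((measurable_stp s).comp hγ.U_path) hA
    constructor
    · rw [neg_le_neg_iff]
      calc _ ≤ ∫ ω in {ω | stp s (fun u => sqBessel4 γ u ω) ∈ A},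
            (t / n / (2 * c ^ 2) * exp (-(y - 1) / (2 * (c + t / n)))) ∂P := by
            refine setIntegral_mono_on ((iZ s hsm).sub iG).integrableOn (integrable_const _) hmE ?_
            intro ω hω
            obtain ⟨h1, h2⟩ := hω
            rw [Dx_stp hsm.1 le_rfl] at h1
            rw [Mx_stp hsm.1 le_rfl] at h2
            have h3 := Mx_sub_le_Dx (hγ.U_cont ω) hsm.1
            refine (Gc_diff_le hc hδ0.le (U_nonneg γ _ _)).trans ?_
            gcongr
            linarith
        _ ≤ _ := by
            rw [setIntegral_const, smul_eq_mul]
            exact mul_le_of_le_one_left (by positivity) measureReal_le_one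
    · rw [neg_nonpos]
      exact setIntegral_nonneg hmE fun ω _ => sub_nonneg.2 (Gc_diff_nonneg hc hδ0.le (U_nonneg γ _ _))
  constructor
  · refine le_of_tendsto o ?_
    filter_upwards [eventually_gt_atTop 0] with n hn
    rw [← Finset.sum_sub_distrib]
    exact Finset.sum_nonpos fun k hk => (bnd n hn k hk).2
  · have hl : Tendsto (fun n : ℕ => - (t / (2 * c ^ 2) * exp (-(y - 1) / (2 * (c + t / n))))) atTop
        (𝓝 (- (t / (2 * c ^ 2) * exp (-(y - 1) / (2 * c))))) := by
      have h1 : Tendsto (fun n : ℕ => 2 * (c + t / n)) atTop (𝓝 (2 * (c + 0))) :=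
        (tendsto_const_nhds.add (tendsto_const_div_atTop_nhds_zero_nat t)).const_mul 2
      rw [add_zero] at h1
      have h2 := ((tendsto_const_nhds (x := -(y-1))).div h1 (by positivity))
      exact (((continuous_exp.tendsto _).comp h2).const_mul _).neg
    refine le_of_tendsto_of_tendsto hl o ?_
    filter_upwards [eventually_gt_atTop 0] with n hn
    have hn' : (0:ℝ) < n := by exact_mod_cast hn
    rw [← Finset.sum_sub_distrib]
    calc _ = ∑ k ∈ Finset.range n, - (t / n / (2 * c ^ 2) * exp (-(y - 1) / (2 * (c + t / n)))) := by
          simp only [Finset.sum_const, Finset.card_range, nsmul_eq_mul]; field_simp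
      _ ≤ _ := Finset.sum_le_sum fun k hk => (bnd n hn k hk).1
end A

end part5

section part6
open MeasureTheory ProbabilityTheory Real Set Filter
open scoped ENNReal NNReal Topology

section A
variable {Ω : Type*} [MeasurableSpace Ω] {P : Measure Ω} [IsProbabilityMeasure P]
  {γ : ℝ → Ω → EuclideanSpace ℝ (Fin 4)}

noncomputable def XT (γ : ℝ → Ω → EuclideanSpace ℝ (Fin 4)) (t : ℝ) (ω : Ω) : ℝ := sqBessel4 γ (tauT γ t ω) ω
noncomputable def MT (γ : ℝ → Ω → EuclideanSpace ℝ (Fin 4)) (t : ℝ) (ω : Ω) : ℝ :=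
  Mx (fun u => sqBessel4 γ u ω) (tauT γ t ω)

lemma IsStdBMVec.XT_meas (hγ : IsStdBMVec 4 P γ) {t : ℝ} (ht : 0 < t) : Measurable (XT γ t) :=
  stop_aesm (Z := sqBessel4 γ) ht (fun s _ => hγ.U_meas s) hγ.U_cont (hγ.tauT_mem ht.le)
      (fun s hs => hγ.meas_lt_tauT ht.le hs)

lemma IsStdBMVec.MT_meas (hγ : IsStdBMVec 4 P γ) {t : ℝ} (ht : 0 < t) : Measurable (MT γ t) :=
  stop_aesm (Z := fun s ω => Mx (fun u => sqBessel4 γ u ω) s) ht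
      (fun s _ => (measurable_Mx s).comp hγ.U_path) (fun ω => Mx_cont (hγ.U_cont ω)) (hγ.tauT_mem ht.le)
      (fun s hs => hγ.meas_lt_tauT ht.le hs)

lemma IsStdBMVec.tauT_meas (hγ : IsStdBMVec 4 P γ) {t : ℝ} (ht : 0 < t) : Measurable (tauT γ t) :=
  stop_aesm (Z := fun s _ => s) ht (fun s _ => measurable_const) (fun ω => continuous_id) (hγ.tauT_mem ht.le)
      (fun s hs => hγ.meas_lt_tauT ht.le hs)

lemma IsStdBMVec.MT_sub (hγ : IsStdBMVec 4 P γ) {t : ℝ} (ht : 0 < t) (ω : Ω) : MT γ t ω - XT γ t ω ≤ 1 := by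
  have h1 := Mx_sub_le_Dx (hγ.U_cont ω) (hγ.tauT_mem ht.le ω).1
  have h2 := cross_val_le (Dx_cont (hγ.U_cont ω)) (fun _ _ h1 h2 => Dx_mono (hγ.U_cont ω) h1 h2) ht.le
    (a := 1) (by rw [Dx_zero (hγ.U_cont ω)]; exact zero_le_one)
  exact h1.trans h2

lemma IsStdBMVec.XT_le (hγ : IsStdBMVec 4 P γ) {t : ℝ} (ht : 0 < t) (ω : Ω) : XT γ t ω ≤ MT γ t ω :=
  le_Mx (hγ.U_cont ω) (hγ.tauT_mem ht.le ω).1 le_rfl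

omit [MeasurableSpace Ω] in
lemma XT_nonneg (γ : ℝ → Ω → EuclideanSpace ℝ (Fin 4)) (t : ℝ) (ω : Ω) : 0 ≤ XT γ t ω := U_nonneg _ _ _

/-- A2 -/
lemma IsStdBMVec.A2 (hγ : IsStdBMVec 4 P γ) {t y : ℝ} (ht : 0 < t) (hy : 1 < y) :
    ∫ ω in {ω | y ≤ MT γ t ω}, (1 / XT γ t ω - 1 / y) ∂P = 0 := by
  have hE : MeasurableSet {ω | y ≤ MT γ t ω} := measurableSet_le measurable_const (hγ.MT_meas ht)
  have hpos : ∀ ω ∈ {ω | y ≤ MT γ t ω}, y - 1 ≤ XT γ t ω := by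
    intro ω hω
    have := hγ.MT_sub ht ω
    rw [mem_ofPred_eq] at hω
    linarith
  have hlim : Tendsto (fun n : ℕ => ∫ ω in {ω | y ≤ MT γ t ω},
      (Gc (1 / ((n:ℝ) + 1)) (XT γ t ω) - Gc (1 / ((n:ℝ) + 1)) y) ∂P) atTop
      (𝓝 (∫ ω in {ω | y ≤ MT γ t ω}, (1 / XT γ t ω - 1 / y) ∂P)) := by
    refine tendsto_integral_of_dominated_convergence (fun _ => 1 / (y - 1) + 1 / y) ?_ (integrable_const _) ?_ ?_
    · intro n
      exact (((Gc_cont _).measurable.comp (hγ.XT_meas ht)).sub_const _).aestronglyMeasurable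
    · intro n
      filter_upwards [ae_restrict_mem hE] with ω hω
      have h1 := hpos ω hω
      have hX : 0 < XT γ t ω := by linarith
      have hc : (0:ℝ) < 1 / ((n:ℝ) + 1) := by positivity
      have a1 := Gc_nonneg hc hX.le
      have a2 := Gc_nonneg hc (by linarith : (0:ℝ) ≤ y)
      have a3 := Gc_le_inv (1 / ((n:ℝ) + 1)) hX
      have a4 := Gc_le_inv (1 / ((n:ℝ) + 1)) (by linarith : (0:ℝ) < y)
      have a5 : 1 / XT γ t ω ≤ 1 / (y - 1) := one_div_le_one_div_of_le (by linarith) h1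
      rw [Real.norm_eq_abs, abs_le]; constructor <;> linarith
    · filter_upwards [ae_restrict_mem hE] with ω hω
      have h1 := hpos ω hω
      exact (Gc_tendsto (by linarith)).sub (Gc_tendsto (by linarith))
  have hl2 : Tendsto (fun n : ℕ => - (t / (2 * (1 / ((n:ℝ) + 1)) ^ 2) * exp (-(y - 1) / (2 * (1 / ((n:ℝ) + 1))))))
      atTop (𝓝 0) := by
    have h1 := (tendsto_pow_mul_exp_neg_atTop_nhds_zero 2)
    have h2 : Tendsto (fun n : ℕ => (y - 1) / 2 * ((n:ℝ) + 1)) atTop atTop :=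
      (tendsto_atTop_add_const_right _ _ tendsto_natCast_atTop_atTop).const_mul_atTop (by linarith)
    have h3 := ((h1.comp h2).const_mul (t / 2 * (2 / (y - 1)) ^ 2)).neg
    simp only [mul_zero, neg_zero] at h3
    refine h3.congr fun n => ?_
    simp only [Function.comp_def]
    have e : -(y - 1) / (2 * (1 / ((n:ℝ) + 1))) = -((y - 1) / 2 * ((n:ℝ) + 1)) := by field_simp
    rw [e]
    have : y - 1 ≠ 0 := by linarith
    field_simp
  have hd := fun n : ℕ => hγ.stop_diff (c := 1 / ((n:ℝ) + 1)) ht (by linarith : (0:ℝ) < y) (by positivity)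
  apply le_antisymm
  · exact le_of_tendsto' hlim fun n => (hd n).1
  · exact le_of_tendsto_of_tendsto' hl2 hlim fun n => (hd n).2

lemma IsStdBMVec.A3 (hγ : IsStdBMVec 4 P γ) {t : ℝ} (ht : 0 < t) :
    P {ω | 1 / 2 ≤ MT γ t ω ∧ XT γ t ω = 0} = 0 := by
  have hE : MeasurableSet {ω | 1 / 2 ≤ MT γ t ω} := measurableSet_le measurable_const (hγ.MT_meas ht)
  have hE2 : MeasurableSet {ω | 1 / 2 ≤ MT γ t ω ∧ XT γ t ω = 0} :=
    hE.inter ((hγ.XT_meas ht) (measurableSet_singleton 0))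
  have key : ∀ c : ℝ, 0 < c → P.real {ω | 1 / 2 ≤ MT γ t ω ∧ XT γ t ω = 0} ≤ 4 * c := by
    intro c hc
    have h := (hγ.stop_diff (y := 1/2) ht (by norm_num) hc).1
    have iG : Integrable (fun ω => Gc c (XT γ t ω)) P := by
      refine (integrable_const (1 / (2 * c))).mono'
        ((Gc_cont _).measurable.comp (hγ.XT_meas ht)).aestronglyMeasurable (ae_of_all _ fun ω => ?_)
      rw [Real.norm_eq_abs, abs_of_nonneg (Gc_nonneg hc (XT_nonneg γ _ _))]
      exact Gc_le hc (XT_nonneg γ _ _)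
    have h2 : ∫ ω in {ω | 1 / 2 ≤ MT γ t ω}, (Gc c (XT γ t ω) - Gc c (1/2)) ∂P ≤ 0 := h
    rw [integral_sub iG.integrableOn (integrable_const _), setIntegral_const, smul_eq_mul] at h2
    have h3 : Gc c (1/2) ≤ 2 := by
      have := Gc_le_inv c (u := 1/2) (by norm_num)
      norm_num at this ⊢; exact this
    have h30 : 0 ≤ Gc c (1/2) := Gc_nonneg hc (by norm_num)
    have h4 : ∫ ω in {ω | 1 / 2 ≤ MT γ t ω}, Gc c (XT γ t ω) ∂P ≤ 2 := by
      have : P.real {ω | 1 / 2 ≤ MT γ t ω} ≤ 1 := measureReal_le_one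
      nlinarith [measureReal_nonneg (μ := P) (s := {ω | 1 / 2 ≤ MT γ t ω})]
    have h5 : ∫ ω in {ω | 1 / 2 ≤ MT γ t ω ∧ XT γ t ω = 0}, (1 / (2 * c)) ∂P
        ≤ ∫ ω in {ω | 1 / 2 ≤ MT γ t ω}, Gc c (XT γ t ω) ∂P := by
      calc _ = ∫ ω in {ω | 1 / 2 ≤ MT γ t ω ∧ XT γ t ω = 0}, Gc c (XT γ t ω) ∂P := by
            refine setIntegral_congr_fun hE2 fun ω hω => ?_
            simp only [hω.2, Gc_zero]
        _ ≤ _ := setIntegral_mono_set iG.integrableOn (ae_of_all _ fun ω => Gc_nonneg hc (XT_nonneg γ _ _))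
            (HasSubset.Subset.eventuallyLE fun ω hω => hω.1)
    rw [setIntegral_const, smul_eq_mul] at h5
    have := h5.trans h4
    rw [mul_one_div, div_le_iff₀ (by positivity)] at this
    linarith
  have h0 : P.real {ω | 1 / 2 ≤ MT γ t ω ∧ XT γ t ω = 0} = 0 := by
    apply le_antisymm _ measureReal_nonneg
    apply le_of_forall_pos_le_add
    intro ε hε
    have := key (ε / 4) (by positivity)
    linarith
  rwa [measureReal_eq_zero_iff] at h0

lemma inner_int {X M L a b: ℝ} (hL : 1 ≤ L) (h0 : 0 ≤ X) (ha : 0 ≤ a) (hb : 0 ≤ b) :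
    ∫⁻ y in Ioc 1 L, {y | y ≤ M}.indicator (fun y => ENNReal.ofReal (2 * a * y + b)) y
      = ENNReal.ofReal (a * ((max 1 (min M L)) ^ 2 - 1) + b * (max 1 (min M L) - 1)) := by
  have hm : MeasurableSet {y : ℝ | y ≤ M} := measurableSet_Iic
  rw [lintegral_indicator hm, Measure.restrict_restrict hm]
  have e : {y : ℝ | y ≤ M} ∩ Ioc 1 L = Ioc 1 (max 1 (min M L)) := by
    ext y; simp only [mem_inter_iff, mem_ofPred_eq, mem_Ioc, le_max_iff, le_min_iff]
    constructor
    · rintro ⟨h1, h2, h3⟩; exact ⟨h2, Or.inr ⟨h1, h3⟩⟩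
    · rintro ⟨h1, h2 | h2⟩
      · linarith
      · exact ⟨h2.1, h1, h2.2⟩
  rw [e]
  have hv : 1 ≤ max 1 (min M L) := le_max_left _ _
  set v := max 1 (min M L)
  have hi : IntegrableOn (fun y : ℝ => 2 * a * y + b) (Ioc 1 v) :=
    ((by fun_prop : Continuous fun y : ℝ => 2 * a * y + b).integrableOn_Icc (a := 1) (b := v)).mono_set Ioc_subset_Icc_self
  rw [← ofReal_integral_eq_lintegral_ofReal hi, ← intervalIntegral.integral_of_le hv]
  · congr 1
    rw [intervalIntegral.integral_add (by apply Continuous.intervalIntegrable; fun_prop) (by simp)]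
    rw [intervalIntegral.integral_const_mul, integral_id, intervalIntegral.integral_const, smul_eq_mul]
    ring
  · filter_upwards [ae_restrict_mem measurableSet_Ioc] with y hy
    have := hy.1
    have : 0 ≤ 2 * a * y := by positivity
    exact add_nonneg this hb

/-- A4 -/
lemma IsStdBMVec.A4 (hγ : IsStdBMVec 4 P γ) {t L : ℝ} (ht : 0 < t) (hL : 1 ≤ L) :
    ∫ ω, ((max 1 (min (MT γ t ω) L)) ^ 2 - 1) / XT γ t ω ∂P = ∫ ω, 2 * (max 1 (min (MT γ t ω) L) - 1) ∂P := by
  have mX := hγ.XT_meas ht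
  have mM := hγ.MT_meas ht
  have m1 : Measurable (fun ω => max 1 (min (MT γ t ω) L)) := measurable_const.max (mM.min measurable_const)
  have step : ∀ y ∈ Ioc 1 L, ∫⁻ ω, {y | y ≤ MT γ t ω}.indicator (fun y => ENNReal.ofReal (2 * (1 / XT γ t ω) * y + 0)) y ∂P
      = ∫⁻ ω, {y | y ≤ MT γ t ω}.indicator (fun y => ENNReal.ofReal (2 * 0 * y + 2)) y ∂P := by
    intro y hy
    have hy1 : 1 < y := hy.1
    have hE : MeasurableSet {ω | y ≤ MT γ t ω} := measurableSet_le measurable_const mM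
    have h := hγ.A2 ht hy1
    have hpos : ∀ ω ∈ {ω | y ≤ MT γ t ω}, y - 1 ≤ XT γ t ω := by
      intro ω hω
      have := hγ.MT_sub ht ω
      rw [mem_ofPred_eq] at hω
      linarith
    have i1 : IntegrableOn (fun ω => 1 / XT γ t ω) {ω | y ≤ MT γ t ω} P := by
      refine Integrable.mono' (g := fun _ => 1 / (y - 1)) (integrable_const _) (measurable_const.div mX).aestronglyMeasurable ?_
      filter_upwards [ae_restrict_mem hE] with ω hω
      rw [Real.norm_eq_abs, abs_of_nonneg (one_div_nonneg.2 (XT_nonneg γ _ _))]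
      exact one_div_le_one_div_of_le (by linarith) (hpos ω hω)
    rw [integral_sub i1 (integrable_const _), setIntegral_const, smul_eq_mul, sub_eq_zero] at h
    have e : ∀ g : Ω → ℝ → ℝ≥0∞, ∫⁻ ω, {y | y ≤ MT γ t ω}.indicator (g ω) y ∂P
        = ∫⁻ ω in {ω | y ≤ MT γ t ω}, g ω y ∂P := by
      intro g
      rw [← lintegral_indicator hE]; rfl
    rw [e, e, ← ofReal_integral_eq_lintegral_ofReal, ← ofReal_integral_eq_lintegral_ofReal]
    · congr 1
      simp only [mul_zero, zero_mul, zero_add, add_zero]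
      rw [integral_mul_const, integral_const_mul, h, setIntegral_const, smul_eq_mul]
      field_simp
    · exact integrable_const _
    · exact ae_of_all _ fun ω => by simp
    · simpa using (i1.const_mul 2).mul_const y
    · refine ae_of_all _ fun ω => ?_
      have := XT_nonneg γ t ω
      simp only [Pi.zero_apply]; positivity
  have sw : ∫⁻ ω, (∫⁻ y in Ioc 1 L, {y | y ≤ MT γ t ω}.indicator (fun y => ENNReal.ofReal (2 * (1 / XT γ t ω) * y + 0)) y) ∂P
      = ∫⁻ ω, (∫⁻ y in Ioc 1 L, {y | y ≤ MT γ t ω}.indicator (fun y => ENNReal.ofReal (2 * 0 * y + 2)) y) ∂P := by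
    have hS : MeasurableSet {p : Ω × ℝ | p.2 ≤ MT γ t p.1} := measurableSet_le measurable_snd (mM.comp measurable_fst)
    refine (lintegral_lintegral_swap ?_).trans ((setLIntegral_congr_fun measurableSet_Ioc step).trans (lintegral_lintegral_swap ?_).symm)
    · have : Measurable ({p : Ω × ℝ | p.2 ≤ MT γ t p.1}.indicator (fun p : Ω × ℝ => ENNReal.ofReal (2 * (1 / XT γ t p.1) * p.2 + 0))) := by
        refine Measurable.indicator (Measurable.ennreal_ofReal ?_) hS
        exact ((measurable_const.mul (measurable_const.div (mX.comp measurable_fst))).mul measurable_snd).add_const _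
      exact this.aemeasurable
    · have : Measurable ({p : Ω × ℝ | p.2 ≤ MT γ t p.1}.indicator (fun p : Ω × ℝ => ENNReal.ofReal (2 * 0 * p.2 + 2))) :=
        Measurable.indicator (by fun_prop) hS
      exact this.aemeasurable
  have sw' : ∫⁻ ω, ENNReal.ofReal (((max 1 (min (MT γ t ω) L)) ^ 2 - 1) / XT γ t ω) ∂P
      = ∫⁻ ω, ENNReal.ofReal (2 * (max 1 (min (MT γ t ω) L) - 1)) ∂P := by
    convert sw using 1
    · congr 1; ext ω
      rw [inner_int hL (XT_nonneg γ t ω) (one_div_nonneg.2 (XT_nonneg γ t ω)) le_rfl]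
      congr 1; ring
    · congr 1; ext ω
      rw [inner_int hL (XT_nonneg γ t ω) le_rfl (by norm_num)]
      congr 1; ring
  rw [integral_eq_lintegral_of_nonneg_ae, integral_eq_lintegral_of_nonneg_ae, sw']
  · refine ae_of_all _ fun ω => ?_
    have : 1 ≤ max 1 (min (MT γ t ω) L) := le_max_left _ _
    simp only [Pi.zero_apply]; linarith
  · exact ((m1.sub_const _).const_mul 2).aestronglyMeasurable
  · refine ae_of_all _ fun ω => ?_
    have : 1 ≤ max 1 (min (MT γ t ω) L) := le_max_left _ _
    exact div_nonneg (by nlinarith) (XT_nonneg γ t ω)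
  · exact (((m1.pow_const 2).sub_const _).div mX).aestronglyMeasurable

lemma ratio_bound {M X L : ℝ} (hX : 0 ≤ X) (h : M - X ≤ 1) :
    0 ≤ ((max 1 (min M L)) ^ 2 - 1) / X ∧ ((max 1 (min M L)) ^ 2 - 1) / X ≤ max 1 (min M L) + 1 := by
  have h1 : 1 ≤ max 1 (min M L) := le_max_left _ _
  have h2 : max 1 (min M L) ≤ X + 1 := max_le (by linarith) ((min_le_left _ _).trans (by linarith))
  set v := max 1 (min M L)
  refine ⟨div_nonneg (by nlinarith) hX, ?_⟩
  rcases eq_or_lt_of_le hX with h3 | h3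
  · rw [← h3]; simp; linarith
  · rw [div_le_iff₀ h3]; nlinarith

lemma v_le {M L : ℝ} (hL : 1 ≤ L) : max 1 (min M L) ≤ L := max_le hL (min_le_right _ _)

lemma IsStdBMVec.EMT (hγ : IsStdBMVec 4 P γ) {t : ℝ} (ht : 0 < t) :
    ∫⁻ ω, ENNReal.ofReal (MT γ t ω) ∂P ≤ 3 := by
  have mM := hγ.MT_meas ht
  have hL : ∀ n : ℕ, ∫⁻ ω, ENNReal.ofReal (max 1 (min (MT γ t ω) (n + 1))) ∂P ≤ 3 := by
    intro n
    have hL1 : (1:ℝ) ≤ n + 1 := by linarith [n.cast_nonneg (α := ℝ)]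
    have m1 : Measurable (fun ω => max 1 (min (MT γ t ω) ((n:ℝ) + 1))) := measurable_const.max (mM.min measurable_const)
    have i1 : Integrable (fun ω => max 1 (min (MT γ t ω) ((n:ℝ) + 1))) P := by
      refine (integrable_const ((n:ℝ) + 1)).mono' m1.aestronglyMeasurable (ae_of_all _ fun ω => ?_)
      rw [Real.norm_eq_abs, abs_of_nonneg (zero_le_one.trans (le_max_left _ _))]
      exact v_le hL1
    have h := hγ.A4 ht hL1
    have h2 : ∫ ω, ((max 1 (min (MT γ t ω) ((n:ℝ)+1))) ^ 2 - 1) / XT γ t ω ∂P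
        ≤ ∫ ω, (max 1 (min (MT γ t ω) ((n:ℝ)+1)) + 1) ∂P := by
      refine integral_mono_of_nonneg (ae_of_all _ fun ω => (ratio_bound (XT_nonneg γ t ω) (hγ.MT_sub ht ω)).1)
        (i1.add (integrable_const _)) (ae_of_all _ fun ω => (ratio_bound (XT_nonneg γ t ω) (hγ.MT_sub ht ω)).2)
    rw [h, integral_const_mul, integral_sub i1 (integrable_const _), integral_add i1 (integrable_const _)] at h2
    simp at h2
    rw [← ofReal_integral_eq_lintegral_ofReal i1 (ae_of_all _ fun ω => zero_le_one.trans (le_max_left _ _))]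
    rw [show (3:ℝ≥0∞) = ENNReal.ofReal 3 by simp]
    exact ENNReal.ofReal_le_ofReal (by linarith)
  calc _ ≤ ∫⁻ ω, liminf (fun n : ℕ => ENNReal.ofReal (max 1 (min (MT γ t ω) (n + 1)))) atTop ∂P := by
        refine lintegral_mono fun ω => ?_
        refine le_liminf_of_le (by isBoundedDefault) ?_
        filter_upwards [tendsto_natCast_atTop_atTop.eventually_ge_atTop (MT γ t ω)] with n hn
        apply ENNReal.ofReal_le_ofReal
        apply le_max_of_le_right
        rw [min_eq_left (by linarith)]
    _ ≤ liminf (fun n : ℕ => ∫⁻ ω, ENNReal.ofReal (max 1 (min (MT γ t ω) (n + 1))) ∂P) atTop :=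
        lintegral_liminf_le fun n => (measurable_const.max (mM.min measurable_const)).ennreal_ofReal
    _ ≤ liminf (fun n : ℕ => (3:ℝ≥0∞)) atTop := by
        refine liminf_le_liminf ?_
        exact Eventually.of_forall hL
    _ = 3 := by simp
end A

end part6

section part7
open MeasureTheory ProbabilityTheory Real Set Filter
open scoped ENNReal NNReal Topology

section RM
variable {Ω : Type*}
lemma runMax_eq {X : ℝ → Ω → ℝ} {ω : Ω} (hf : Continuous fun u => X u ω) {t : ℝ} (ht : 0 ≤ t) :
    runMax X t ω = Mx (fun u => X u ω) t := by
  unfold runMax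
  have hb : BddAbove (range fun s : Icc (0:ℝ) t => X s ω) := by
    refine ⟨Mx (fun u => X u ω) t, ?_⟩
    rintro _ ⟨s, rfl⟩
    exact le_Mx hf s.2.1 s.2.2
  have : Nonempty (Icc (0:ℝ) t) := ⟨⟨0, le_rfl, ht⟩⟩
  apply le_antisymm
  · exact ciSup_le fun s => le_Mx hf s.2.1 s.2.2
  · obtain ⟨u, hu, h⟩ := exists_Mx hf ht
    rw [← h]
    exact le_ciSup hb ⟨u, hu⟩

lemma cross_eq_ddTime {X : ℝ → Ω → ℝ} {ω : Ω} (hf : Continuous fun u => X u ω) {s t : ℝ} (hs : 0 ≤ s) (hst : s ≤ t)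
    (h : 1 ≤ Dx (fun u => X u ω) s) : cross (Dx fun u => X u ω) 1 t = ddTime 1 X ω := by
  have ht := hs.trans hst
  obtain ⟨h0, h1⟩ := cross_mem (a := 1) (Dx_cont hf) ht
  set τ := cross (Dx fun u => X u ω) 1 t with hτ
  have h2 : 1 ≤ Dx (fun u => X u ω) τ := by
    rcases h1 with h1 | h1
    · exact h1
    · exact h.trans (Dx_mono hf hs (hst.trans h1))
  obtain ⟨v, hv, hv'⟩ := exists_Dx' hf h0
  have hbd : BddBelow {t | 0 ≤ t ∧ 1 ≤ runMax X t ω - X t ω} := ⟨0, fun r hr => hr.1⟩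
  have hmem : v ∈ {t | 0 ≤ t ∧ 1 ≤ runMax X t ω - X t ω} := by
    refine ⟨hv.1, ?_⟩
    rw [runMax_eq hf hv.1, hv']; exact h2
  unfold ddTime
  apply le_antisymm
  · refine le_csInf ⟨v, hmem⟩ ?_
    rintro r ⟨hr0, hr⟩
    rw [runMax_eq hf hr0] at hr
    exact cross_le_of hr0 (hr.trans (Mx_sub_le_Dx hf hr0))
  · exact (csInf_le hbd hmem).trans hv.2
end RM

section A
variable {Ω : Type*} [MeasurableSpace Ω] {P : Measure Ω} [IsProbabilityMeasure P]
  {γ : ℝ → Ω → EuclideanSpace ℝ (Fin 4)}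

lemma IsStdBMVec.EG (hγ : IsStdBMVec 4 P γ) {t : ℝ} (ht : 0 < t) :
    ∫⁻ ω, ENNReal.ofReal (Gc 1 (sqBessel4 γ t ω)) ∂P = ENNReal.ofReal (1 / (2 * (1 + t))) := by
  have := hγ.U_step le_rfl ht.le MeasurableSet.univ (fun u => ENNReal.ofReal (Gc 1 u))
    (fun u => ENNReal.ofReal (Gc (1 + (t - 0)) u))
    ((Gc_cont 1).measurable.ennreal_ofReal) (fun x => gauss_Gc one_pos (by linarith) x)
  simp only [mem_univ, sub_zero, hγ.U_zero, Gc_zero] at this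
  simpa using this

lemma Gc_one_ge {u : ℝ} (hu : 0 ≤ u) : 1 / (2 + u) ≤ Gc 1 u := by
  rcases eq_or_lt_of_le hu with rfl | h
  · rw [Gc_zero]; norm_num
  · rw [Gc_of_ne _ h.ne', div_le_div_iff₀ (by positivity) h]
    have h1 : exp (-u / (2 * 1)) ≤ 2 / (2 + u) := by
      rw [show -u / (2 * 1) = -(u / 2) by ring, exp_neg, inv_le_comm₀ (exp_pos _) (by positivity), inv_div]
      linarith [add_one_le_exp (u / 2)]
    have h2 : exp (-u / (2 * 1)) * (2 + u) ≤ 2 := by rwa [le_div_iff₀ (by positivity)] at h1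
    linarith

lemma IsStdBMVec.fin_ae (hγ : IsStdBMVec 4 P γ) :
    ∀ᵐ ω ∂P, ∃ n : ℕ, 1 ≤ Dx (fun u => sqBessel4 γ u ω) n := by
  rw [ae_iff]
  set F := {ω | ¬ ∃ n : ℕ, 1 ≤ Dx (fun u => sqBessel4 γ u ω) n} with hF
  have hFm : MeasurableSet F := by
    have : F = ⋂ n : ℕ, {ω | 1 ≤ Dx (fun u => sqBessel4 γ u ω) n}ᶜ := by
      ext ω; simp [hF]
    rw [this]
    exact MeasurableSet.iInter fun n => (measurableSet_le measurable_const ((measurable_Dx n).comp hγ.U_path)).compl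
  have key : ∀ a : ℝ, 0 < a → ∀ n : ℕ, 0 < n → P F ≤ ENNReal.ofReal (5 * a + a⁻¹ * (1 / (2 * (1 + n)))) := by
    intro a ha n hn
    have hn' : (0:ℝ) < n := by exact_mod_cast hn
    calc P F = ∫⁻ ω, F.indicator (fun _ => 1) ω ∂P := by rw [lintegral_indicator hFm]; simp
      _ ≤ ∫⁻ ω, (ENNReal.ofReal (2 * a) + ENNReal.ofReal a * ENNReal.ofReal (MT γ n ω)
          + ENNReal.ofReal (a⁻¹) * ENNReal.ofReal (Gc 1 (sqBessel4 γ n ω))) ∂P := by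
          refine lintegral_mono fun ω => ?_
          by_cases hω : ω ∈ F
          · rw [indicator_of_mem hω]
            have h1 : tauT γ n ω = n := by
              apply le_antisymm (hγ.tauT_mem hn'.le ω).2
              rcases (cross_mem (a := 1) (Dx_cont (hγ.U_cont ω)) hn'.le).2 with h | h
              · exfalso
                apply hω
                exact ⟨n, h.trans (Dx_mono (hγ.U_cont ω) (hγ.tauT_mem hn'.le ω).1 (hγ.tauT_mem hn'.le ω).2)⟩
              · exact h
            have h2 : sqBessel4 γ n ω ≤ MT γ n ω := by
              have := hγ.XT_le hn' ω
              unfold XT at this; rwa [h1] at this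
            have h0 := U_nonneg γ n ω
            have h3 := Gc_one_ge h0
            set u := sqBessel4 γ n ω
            rw [← ENNReal.ofReal_mul ha.le, ← ENNReal.ofReal_mul (by positivity), ← ENNReal.ofReal_add (by positivity) (mul_nonneg ha.le (h0.trans h2)),
              ← ENNReal.ofReal_add (add_nonneg (by positivity) (mul_nonneg ha.le (h0.trans h2))) (mul_nonneg (by positivity) (Gc_nonneg one_pos h0)),
              ← ENNReal.ofReal_one]
            apply ENNReal.ofReal_le_ofReal
            have h4 : a⁻¹ * (1 / (2 + u)) ≤ a⁻¹ * Gc 1 u := by gcongr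
            have h5 : a * u ≤ a * MT γ n ω := by gcongr
            have h6 : 1 ≤ a * (2 + u) + a⁻¹ * (1 / (2 + u)) := by
              have hp : 0 < a * (2 + u) := by positivity
              have e : a⁻¹ * (1 / (2 + u)) = 1 / (a * (2 + u)) := by field_simp
              rw [e]
              rcases le_total 1 (a * (2 + u)) with h7 | h7
              · have : 0 < 1 / (a * (2 + u)) := by positivity
                linarith
              · have : 1 ≤ 1 / (a * (2 + u)) := by rw [le_div_iff₀ hp]; linarith
                linarith
            linarith
          · rw [indicator_of_notMem hω]; simp
      _ ≤ ENNReal.ofReal (2 * a) + ENNReal.ofReal a * 3 + ENNReal.ofReal (a⁻¹) * ENNReal.ofReal (1 / (2 * (1 + n))) := by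
          have m1 : Measurable fun ω => ENNReal.ofReal (MT γ n ω) := (hγ.MT_meas hn').ennreal_ofReal
          have m2 : Measurable fun ω => ENNReal.ofReal (Gc 1 (sqBessel4 γ n ω)) :=
            ((Gc_cont 1).measurable.comp (hγ.U_meas n)).ennreal_ofReal
          rw [lintegral_add_right _ (m2.const_mul _), lintegral_add_right _ (m1.const_mul _), lintegral_const_mul _ m1,
            lintegral_const_mul _ m2, hγ.EG hn']
          simp only [lintegral_const, measure_univ, mul_one]
          gcongr
          exact hγ.EMT hn'
      _ = _ := by
          rw [show (3:ℝ≥0∞) = ENNReal.ofReal 3 by simp, ← ENNReal.ofReal_mul ha.le, ← ENNReal.ofReal_mul (by positivity),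
            ← ENNReal.ofReal_add (by positivity) (by positivity), ← ENNReal.ofReal_add (by positivity) (by positivity)]
          congr 1; ring
  have key2 : ∀ a : ℝ, 0 < a → P F ≤ ENNReal.ofReal (5 * a) := by
    intro a ha
    have hl : Tendsto (fun n : ℕ => ENNReal.ofReal (5 * a + a⁻¹ * (1 / (2 * (1 + n))))) atTop (𝓝 (ENNReal.ofReal (5 * a))) := by
      apply ENNReal.tendsto_ofReal
      have : Tendsto (fun n : ℕ => 5 * a + a⁻¹ * (1 / 2 * (1 / ((n:ℝ) + 1)))) atTop (𝓝 (5 * a + a⁻¹ * (1 / 2 * 0))) :=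
        (((tendsto_one_div_add_atTop_nhds_zero_nat).const_mul _).const_mul _).const_add _
      simp only [mul_zero, add_zero] at this
      refine this.congr fun n => ?_
      field_simp; ring
    refine ge_of_tendsto hl ?_
    filter_upwards [eventually_gt_atTop 0] with n hn using key a ha n hn
  have hl : Tendsto (fun n : ℕ => ENNReal.ofReal (5 * (1 / ((n:ℝ) + 1)))) atTop (𝓝 (ENNReal.ofReal (5 * 0))) :=
    ENNReal.tendsto_ofReal ((tendsto_one_div_add_atTop_nhds_zero_nat).const_mul _)
  simp only [mul_zero, ENNReal.ofReal_zero] at hl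
  exact le_antisymm (ge_of_tendsto' hl fun n => key2 _ (by positivity)) bot_le

lemma IsStdBMVec.tauT_ae (hγ : IsStdBMVec 4 P γ) :
    ∀ᵐ ω ∂P, ∃ N : ℕ, ∀ n : ℕ, N ≤ n → tauT γ ((n:ℝ) + 1) ω = ddTime 1 (sqBessel4 γ) ω := by
  filter_upwards [hγ.fin_ae] with ω ⟨N, hN⟩
  refine ⟨N, fun n hn => ?_⟩
  have : (N:ℝ) ≤ n := by exact_mod_cast hn
  exact cross_eq_ddTime (hγ.U_cont ω) (Nat.cast_nonneg N) (by linarith) hN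

lemma IsStdBMVec.A7 (hγ : IsStdBMVec 4 P γ) {t : ℝ} (ht : 0 < t) :
    Integrable (XT γ t) P ∧ ∫ ω, XT γ t ω ∂P = 4 * ∫ ω, tauT γ t ω ∂P := by
  have hS1 := hγ.tauT_mem ht.le
  have hSm := fun s (hs : 0 ≤ s) => hγ.meas_lt_tauT ht.le hs
  set K : Ω → ℝ := fun ω => ∑ i : Fin 4, (Mx (fun u => γ u ω i) t ^ 2 + Mx (fun u => - γ u ω i) t ^ 2) with hKd
  have hK : Integrable K P := integrable_finsetSum _ fun i _ =>
    ((hγ.coord i).integrable_Mx_sq ht).add ((hγ.coord i).neg.integrable_Mx_sq ht)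
  have hb : ∀ s ∈ Icc 0 t, ∀ ω, |sqBessel4 γ s ω| ≤ K ω := by
    intro s hs ω
    rw [abs_of_nonneg (U_nonneg γ s ω), U_eq]
    exact Finset.sum_le_sum fun i _ => (hγ.coord i).sq_le hs ω
  refine ⟨stop_integrable (Z := sqBessel4 γ) ht (fun s _ => hγ.U_meas s) hγ.U_cont hK hb hS1 hSm, ?_⟩
  have o1 := optional_stopping ht (fun s _ => hγ.U_meas s) hγ.U_cont hK hb hS1 hSm
  have o2 := optional_stopping (P := P) (Z := fun s _ => 4 * s) (K := fun _ => 4 * t) ht (fun s _ => measurable_const)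
    (fun ω => by fun_prop) (integrable_const _) (fun s hs ω => by
      have := hs.1; have := hs.2
      rw [abs_of_nonneg (by linarith)]; linarith) hS1 hSm
  have e : ∀ n : ℕ, 0 < n → ∀ k ∈ Finset.range n, ∫ ω in {ω | t * k / n < tauT γ t ω},
      (sqBessel4 γ (t * ((k + 1 : ℕ) : ℝ) / n) ω - sqBessel4 γ (t * k / n) ω) ∂P
      = ∫ ω in {ω | t * k / n < tauT γ t ω}, (4 * (t * ((k + 1 : ℕ) : ℝ) / n) - 4 * (t * k / n)) ∂P := by
    intro n hn k hk
    have hk := Finset.mem_range.1 hk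
    have hn' : (0:ℝ) < n := by exact_mod_cast hn
    set s := t * k / n with hs
    set s' := t * ((k + 1 : ℕ) : ℝ) / n with hs'
    have hsm : s ∈ Icc 0 t := grid_mem ht.le hk.le
    have hsm' : s' ∈ Icc 0 t := grid_mem ht.le hk
    have hδ : s' - s = t / n := by simp only [hs, hs']; push_cast; ring
    have hδ0 : 0 < t / n := by positivity
    have hst : s < t := by linarith [hsm'.2]
    have hE : {ω | s < tauT γ t ω} = {ω | stp s (fun u => sqBessel4 γ u ω) ∈ {g | Dx g s < 1}} := by
      ext ω
      simp only [mem_ofPred_eq, hγ.lt_tauT ht.le hsm.1, Dx_stp hsm.1 le_rfl, hst, and_true]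
    rw [hE, hγ.S_step hsm.1 (by linarith) (measurableSet_lt (measurable_Dx s) measurable_const)]
    congr 1; ext; ring
  have o3 := o1.congr' (by
    filter_upwards [eventually_gt_atTop 0] with n hn
    exact Finset.sum_congr rfl (e n hn))
  have := tendsto_nhds_unique o3 o2
  simp only [hγ.U_zero, mul_zero, integral_zero, sub_zero, integral_const_mul] at this
  exact this

theorem IsStdBMVec.main (hγ : IsStdBMVec 4 P γ) : ∫ ω, ddTime 1 (sqBessel4 γ) ω ∂P = 1 / 2 := by
  set τ : Ω → ℝ := fun ω => ddTime 1 (sqBessel4 γ) ω with hτ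
  set m : Ω → ℝ := fun ω => Mx (fun u => sqBessel4 γ u ω) (τ ω) with hm
  have pos : ∀ n : ℕ, (0:ℝ) < n + 1 := fun n => by positivity
  -- a.e. facts
  have hae : ∀ᵐ ω ∂P, (∃ N : ℕ, ∀ n : ℕ, N ≤ n → tauT γ ((n:ℝ) + 1) ω = τ ω ∧ MT γ ((n:ℝ) + 1) ω = m ω
      ∧ XT γ ((n:ℝ) + 1) ω = m ω - 1) ∧ 1 < m ω ∧ (∀ n : ℕ, MT γ ((n:ℝ) + 1) ω ≤ m ω) := by
    have h3 : ∀ᵐ ω ∂P, ∀ n : ℕ, ¬ (1 / 2 ≤ MT γ ((n:ℝ) + 1) ω ∧ XT γ ((n:ℝ) + 1) ω = 0) := by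
      rw [ae_all_iff]; intro n
      have := hγ.A3 (pos n)
      rw [ae_iff]; simpa using this
    filter_upwards [hγ.tauT_ae, hγ.fin_ae, h3] with ω ⟨N, hN⟩ ⟨N', hN'⟩ h3
    have hN : ∀ n : ℕ, N ≤ n → tauT γ ((n:ℝ) + 1) ω = τ ω := hN
    have hX : ∀ n : ℕ, N ≤ n → N' ≤ n → XT γ ((n:ℝ) + 1) ω = m ω - 1 := by
      intro n hn hn2
      have hn3 : (N':ℝ) ≤ n := by exact_mod_cast hn2
      have h5 : 1 ≤ Dx (fun u => sqBessel4 γ u ω) (tauT γ ((n:ℝ) + 1) ω) := by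
        rcases (cross_mem (a := 1) (Dx_cont (hγ.U_cont ω)) (pos n).le).2 with h | h
        · exact h
        · exact hN'.trans (Dx_mono (hγ.U_cont ω) (Nat.cast_nonneg _) (le_trans (by linarith) h))
      obtain ⟨v, hv, hv'⟩ := exists_Dx' (hγ.U_cont ω) (hγ.tauT_mem (pos n).le ω).1
      have h6 : v = tauT γ ((n:ℝ) + 1) ω := by
        apply le_antisymm hv.2
        refine cross_le_of hv.1 ?_
        exact (h5.trans hv'.symm.le).trans (Mx_sub_le_Dx (hγ.U_cont ω) hv.1)
      rw [← hv', h6] at h5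
      have h7 := hγ.MT_sub (pos n) ω
      simp only [MT, XT] at h7 ⊢
      simp only [hm]
      rw [← hN n hn]
      linarith
    have hM : ∀ n : ℕ, N ≤ n → MT γ ((n:ℝ) + 1) ω = m ω := fun n hn => by
      simp only [MT, hm]
      rw [hN n hn]
    refine ⟨⟨max N N', fun n hn => ⟨hN n ((le_max_left _ _).trans hn), hM n ((le_max_left _ _).trans hn),
      hX n ((le_max_left _ _).trans hn) ((le_max_right _ _).trans hn)⟩⟩, ?_, ?_⟩
    · have h1 := hX _ (le_max_left N N') (le_max_right _ _)
      have h2 := hM _ (le_max_left N N')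
      have h4 := XT_nonneg γ (((max N N' : ℕ) : ℝ) + 1) ω
      have h5 := h3 (max N N')
      rw [h2, h1] at h5
      rw [h1] at h4
      rcases lt_or_eq_of_le (sub_nonneg.1 h4) with h6 | h6
      · exact h6
      · exfalso; apply h5; rw [← h6]; norm_num
    · intro n
      rw [← hM _ (le_max_left N n)]
      refine Mx_mono (hγ.U_cont ω) (hγ.tauT_mem (pos n).le ω).1 ?_
      -- monotone in t
      have hb : BddBelow {s | 0 ≤ s ∧ (1 ≤ Dx (fun u => sqBessel4 γ u ω) s ∨ (n:ℝ) + 1 ≤ s)} := ⟨0, fun r hr => hr.1⟩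
      refine csInf_le hb ⟨(hγ.tauT_mem (pos _).le ω).1, ?_⟩
      rcases (cross_mem (a := 1) (Dx_cont (hγ.U_cont ω)) (pos (max N n)).le).2 with h | h
      · exact Or.inl h
      · refine Or.inr (le_trans ?_ h)
        have : (n:ℝ) ≤ ((max N n : ℕ):ℝ) := by exact_mod_cast le_max_right _ _
        linarith
  have tM : ∀ᵐ ω ∂P, Tendsto (fun n : ℕ => MT γ ((n:ℝ) + 1) ω) atTop (𝓝 (m ω)) := by
    filter_upwards [hae] with ω ⟨⟨N, hN⟩, _⟩
    refine tendsto_const_nhds.congr' ?_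
    filter_upwards [eventually_ge_atTop N] with n hn using (hN n hn).2.1.symm
  have tX : ∀ᵐ ω ∂P, Tendsto (fun n : ℕ => XT γ ((n:ℝ) + 1) ω) atTop (𝓝 (m ω - 1)) := by
    filter_upwards [hae] with ω ⟨⟨N, hN⟩, _⟩
    refine tendsto_const_nhds.congr' ?_
    filter_upwards [eventually_ge_atTop N] with n hn using (hN n hn).2.2.symm
  have tT : ∀ᵐ ω ∂P, Tendsto (fun n : ℕ => tauT γ ((n:ℝ) + 1) ω) atTop (𝓝 (τ ω)) := by
    filter_upwards [hae] with ω ⟨⟨N, hN⟩, _⟩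
    refine tendsto_const_nhds.congr' ?_
    filter_upwards [eventually_ge_atTop N] with n hn using (hN n hn).1.symm
  have am : AEMeasurable m P := aemeasurable_of_tendsto_metrizable_ae atTop
    (fun n => (hγ.MT_meas (pos n)).aemeasurable) tM
  have aτ : AEMeasurable τ P := aemeasurable_of_tendsto_metrizable_ae atTop
    (fun n => (hγ.tauT_meas (pos n)).aemeasurable) tT
  have im : Integrable m P := by
    refine ⟨am.aestronglyMeasurable, ?_⟩
    rw [hasFiniteIntegral_iff_ofReal (by filter_upwards [hae] with ω h; simp; linarith [h.2.1])]
    calc _ = ∫⁻ ω, liminf (fun n : ℕ => ENNReal.ofReal (MT γ ((n:ℝ) + 1) ω)) atTop ∂P := by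
          refine lintegral_congr_ae ?_
          filter_upwards [tM] with ω h
          exact (ENNReal.tendsto_ofReal h).liminf_eq.symm
      _ ≤ liminf (fun n : ℕ => ∫⁻ ω, ENNReal.ofReal (MT γ ((n:ℝ) + 1) ω) ∂P) atTop :=
          lintegral_liminf_le fun n => (hγ.MT_meas (pos n)).ennreal_ofReal
      _ ≤ liminf (fun n : ℕ => (3:ℝ≥0∞)) atTop := by
          refine liminf_le_liminf ?_
          exact Eventually.of_forall fun n => hγ.EMT (pos n)
      _ < ⊤ := by simp
  -- A5
  have A5 : ∀ L : ℝ, 1 ≤ L → ∫ ω, ((max 1 (min (m ω) L)) ^ 2 - 1) / (m ω - 1) ∂P = ∫ ω, 2 * (max 1 (min (m ω) L) - 1) ∂P := by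
    intro L hL
    have mv : ∀ n : ℕ, Measurable (fun ω => max 1 (min (MT γ ((n:ℝ)+1) ω) L)) := fun n =>
      measurable_const.max ((hγ.MT_meas (pos n)).min measurable_const)
    have l1 : Tendsto (fun n : ℕ => ∫ ω, ((max 1 (min (MT γ ((n:ℝ)+1) ω) L)) ^ 2 - 1) / XT γ ((n:ℝ)+1) ω ∂P) atTop
        (𝓝 (∫ ω, ((max 1 (min (m ω) L)) ^ 2 - 1) / (m ω - 1) ∂P)) := by
      refine tendsto_integral_of_dominated_convergence (fun _ => L + 1) ?_ (integrable_const _) ?_ ?_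
      · intro n
        exact ((((mv n).pow_const 2).sub_const _).div (hγ.XT_meas (pos n))).aestronglyMeasurable
      · intro n
        refine ae_of_all _ fun ω => ?_
        have := ratio_bound (L := L) (XT_nonneg γ ((n:ℝ)+1) ω) (hγ.MT_sub (pos n) ω)
        rw [Real.norm_eq_abs, abs_of_nonneg this.1]
        exact this.2.trans (by linarith [v_le (M := MT γ ((n:ℝ)+1) ω) hL])
      · filter_upwards [tM, tX, hae] with ω h1 h2 h3
        refine Tendsto.div ?_ h2 (by linarith [h3.2.1])
        exact ((tendsto_const_nhds.max (h1.min tendsto_const_nhds)).pow 2).sub_const 1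
    have l2 : Tendsto (fun n : ℕ => ∫ ω, 2 * (max 1 (min (MT γ ((n:ℝ)+1) ω) L) - 1) ∂P) atTop
        (𝓝 (∫ ω, 2 * (max 1 (min (m ω) L) - 1) ∂P)) := by
      refine tendsto_integral_of_dominated_convergence (fun _ => 2 * L) ?_ (integrable_const _) ?_ ?_
      · intro n
        exact (((mv n).sub_const _).const_mul 2).aestronglyMeasurable
      · intro n
        refine ae_of_all _ fun ω => ?_
        have h1 := v_le (M := MT γ ((n:ℝ)+1) ω) hL
        have h2 := le_max_left 1 (min (MT γ ((n:ℝ)+1) ω) L)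
        rw [Real.norm_eq_abs, abs_of_nonneg (by linarith)]
        linarith
      · filter_upwards [tM] with ω h1
        exact ((tendsto_const_nhds.max (h1.min tendsto_const_nhds)).sub_const 1).const_mul 2
    refine tendsto_nhds_unique l1 (l2.congr fun n => (hγ.A4 (pos n) hL).symm)
  have A6 : ∫ ω, (m ω + 1) ∂P = ∫ ω, 2 * (m ω - 1) ∂P := by
    have amv : ∀ n : ℕ, AEMeasurable (fun ω => max 1 (min (m ω) ((n:ℝ) + 1))) P := fun n =>
      aemeasurable_const.max (am.min aemeasurable_const)
    have tl : ∀ ω, 1 < m ω → Tendsto (fun n : ℕ => max 1 (min (m ω) ((n:ℝ) + 1))) atTop (𝓝 (m ω)) := by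
      intro ω h
      refine tendsto_const_nhds.congr' ?_
      filter_upwards [tendsto_natCast_atTop_atTop.eventually_ge_atTop (m ω)] with n hn
      rw [min_eq_left (by linarith), max_eq_right h.le]
    have l1 : Tendsto (fun n : ℕ => ∫ ω, ((max 1 (min (m ω) ((n:ℝ)+1))) ^ 2 - 1) / (m ω - 1) ∂P) atTop
        (𝓝 (∫ ω, (m ω + 1) ∂P)) := by
      refine tendsto_integral_of_dominated_convergence (fun ω => m ω + 1) ?_ (im.add (integrable_const _)) ?_ ?_
      · intro n
        exact ((((amv n).pow_const 2).sub_const _).div (am.sub_const _)).aestronglyMeasurable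
      · intro n
        filter_upwards [hae] with ω h
        have := ratio_bound (M := m ω) (X := m ω - 1) (L := (n:ℝ)+1) (by linarith [h.2.1]) (by linarith)
        rw [Real.norm_eq_abs, abs_of_nonneg this.1]
        refine this.2.trans ?_
        have : max 1 (min (m ω) ((n:ℝ)+1)) ≤ m ω := max_le h.2.1.le (min_le_left _ _)
        linarith
      · filter_upwards [hae] with ω h
        have h1 : m ω - 1 ≠ 0 := by linarith [h.2.1]
        have e : m ω + 1 = (m ω ^ 2 - 1) / (m ω - 1) := by field_simp; ring
        rw [e]
        exact (((tl ω h.2.1).pow 2).sub_const 1).div_const _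
    have l2 : Tendsto (fun n : ℕ => ∫ ω, 2 * (max 1 (min (m ω) ((n:ℝ)+1)) - 1) ∂P) atTop
        (𝓝 (∫ ω, 2 * (m ω - 1) ∂P)) := by
      refine tendsto_integral_of_dominated_convergence (fun ω => 2 * (m ω)) ?_ (im.const_mul _) ?_ ?_
      · intro n
        exact (((amv n).sub_const _).const_mul 2).aestronglyMeasurable
      · intro n
        filter_upwards [hae] with ω h
        have h1 : max 1 (min (m ω) ((n:ℝ)+1)) ≤ m ω := max_le h.2.1.le (min_le_left _ _)
        have h2 := le_max_left 1 (min (m ω) ((n:ℝ)+1))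
        rw [Real.norm_eq_abs, abs_of_nonneg (by linarith)]
        linarith
      · filter_upwards [hae] with ω h
        exact ((tl ω h.2.1).sub_const 1).const_mul 2
    refine tendsto_nhds_unique l1 (l2.congr fun n => (A5 _ (by linarith [n.cast_nonneg (α := ℝ)])).symm)
  have Em : ∫ ω, m ω ∂P = 3 := by
    rw [integral_const_mul, integral_sub im (integrable_const _), integral_add im (integrable_const _)] at A6
    simp at A6
    linarith
  have tEX : Tendsto (fun n : ℕ => ∫ ω, XT γ ((n:ℝ) + 1) ω ∂P) atTop (𝓝 2) := by
    have : (2:ℝ) = ∫ ω, (m ω - 1) ∂P := by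
      rw [integral_sub im (integrable_const _), Em]; simp; norm_num
    rw [this]
    refine tendsto_integral_of_dominated_convergence m (fun n => (hγ.XT_meas (pos n)).aestronglyMeasurable) im ?_ tX
    intro n
    filter_upwards [hae] with ω h
    rw [Real.norm_eq_abs, abs_of_nonneg (XT_nonneg γ _ _)]
    exact (hγ.XT_le (pos n) ω).trans (h.2.2 n)
  have tET : Tendsto (fun n : ℕ => ∫ ω, tauT γ ((n:ℝ) + 1) ω ∂P) atTop (𝓝 (1/2)) := by
    have := tEX.const_mul (1/4)
    norm_num at this ⊢
    refine this.congr fun n => ?_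
    rw [(hγ.A7 (pos n)).2]; ring
  have mono : ∀ᵐ ω ∂P, Monotone fun n : ℕ => ENNReal.ofReal (tauT γ ((n:ℝ) + 1) ω) := by
    refine ae_of_all _ fun ω => monotone_nat_of_le_succ fun n => ?_
    apply ENNReal.ofReal_le_ofReal
    have hb : BddBelow {s | 0 ≤ s ∧ (1 ≤ Dx (fun u => sqBessel4 γ u ω) s ∨ (n:ℝ) + 1 ≤ s)} := ⟨0, fun r hr => hr.1⟩
    refine csInf_le hb ⟨(hγ.tauT_mem (pos _).le ω).1, ?_⟩
    rcases (cross_mem (a := 1) (Dx_cont (hγ.U_cont ω)) (pos (n+1)).le).2 with h | h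
    · exact Or.inl h
    · refine Or.inr (le_trans ?_ h)
      push_cast; linarith
  have hmct := lintegral_tendsto_of_tendsto_of_monotone (μ := P)
    (f := fun (n : ℕ) ω => ENNReal.ofReal (tauT γ ((n:ℝ) + 1) ω)) (F := fun ω => ENNReal.ofReal (τ ω))
    (fun n => (hγ.tauT_meas (pos n)).ennreal_ofReal.aemeasurable) mono
    (by filter_upwards [tT] with ω h using ENNReal.tendsto_ofReal h)
  have eT : ∀ n : ℕ, ∫⁻ ω, ENNReal.ofReal (tauT γ ((n:ℝ) + 1) ω) ∂P = ENNReal.ofReal (∫ ω, tauT γ ((n:ℝ) + 1) ω ∂P) := by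
    intro n
    rw [ofReal_integral_eq_lintegral_ofReal]
    · refine (integrable_const ((n:ℝ) + 1)).mono' (hγ.tauT_meas (pos n)).aestronglyMeasurable (ae_of_all _ fun ω => ?_)
      have := hγ.tauT_mem (pos n).le ω
      rw [Real.norm_eq_abs, abs_of_nonneg this.1]; exact this.2
    · exact ae_of_all _ fun ω => (hγ.tauT_mem (pos n).le ω).1
  simp only [eT] at hmct
  have := tendsto_nhds_unique hmct (ENNReal.tendsto_ofReal tET)
  rw [integral_eq_lintegral_of_nonneg_ae _ aτ.aestronglyMeasurable]
  · simp only [hτ] at this ⊢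
    rw [this]; simp
  · exact ae_of_all _ fun ω => Real.sInf_nonneg fun r hr => hr.1
end A

end part7

section part8
open MeasureTheory ProbabilityTheory Real Set Filter
open scoped ENNReal NNReal Topology

/-- first hitting time of level `x` -/
noncomputable def TT (x : ℝ) (f : ℝ → ℝ) : ℝ≥0∞ :=
  ⨆ q : ℚ, if Mx f (max (q:ℝ) 0) < x then ENNReal.ofReal (max (q:ℝ) 0) else 0
/-- maximal drawdown before the first hitting time of level `x` -/
noncomputable def DD (x : ℝ) (f : ℝ → ℝ) : ℝ≥0∞ :=
  ⨆ q : ℚ, if Mx f (max (q:ℝ) 0) < x then ENNReal.ofReal (Dx f (max (q:ℝ) 0)) else 0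

lemma measurable_TT : Measurable (fun p : ℝ × (ℝ → ℝ) => TT p.1 p.2) := by
  unfold TT
  refine Measurable.iSup fun q => Measurable.ite ?_ measurable_const measurable_const
  exact measurableSet_lt ((measurable_Mx _).comp measurable_snd) measurable_fst

lemma measurable_DD : Measurable (fun p : ℝ × (ℝ → ℝ) => DD p.1 p.2) := by
  unfold DD
  refine Measurable.iSup fun q => Measurable.ite ?_ ?_ measurable_const
  · exact measurableSet_lt ((measurable_Mx _).comp measurable_snd) measurable_fst
  · exact ((measurable_Dx _).comp measurable_snd).ennreal_ofReal

lemma TT_congr {x : ℝ} {f g : ℝ → ℝ} (h : ∀ t, 0 ≤ t → f t = g t) : TT x f = TT x g := by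
  unfold TT
  congr 1; ext q
  rw [Mx_congr (le_max_right _ _) fun u hu => h u hu.1]

lemma DD_congr {x : ℝ} {f g : ℝ → ℝ} (h : ∀ t, 0 ≤ t → f t = g t) : DD x f = DD x g := by
  unfold DD
  congr 1; ext q
  rw [Mx_congr (le_max_right _ _) fun u hu => h u hu.1, Dx_congr (le_max_right _ _) fun u hu => h u hu.1]

section
variable {f : ℝ → ℝ} (hf : Continuous f) {x t : ℝ}
include hf

lemma sup_eq (A : ℝ → ℝ) (hA : Continuous A) (hm : ∀ u v, 0 ≤ u → u ≤ v → A u ≤ A v) (ht : 0 < t)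
    (h1 : ∀ u, 0 ≤ u → u < t → Mx f u < x) (h2 : x ≤ Mx f t) :
    (⨆ q : ℚ, if Mx f (max (q:ℝ) 0) < x then ENNReal.ofReal (A (max (q:ℝ) 0)) else 0) = ENNReal.ofReal (A t) := by
  apply le_antisymm
  · refine iSup_le fun q => ?_
    split_ifs with h
    · apply ENNReal.ofReal_le_ofReal
      refine hm _ _ (le_max_right _ _) ?_
      by_contra! h3
      have := Mx_mono hf ht.le h3.le
      linarith
    · exact bot_le
  · refine le_of_forall_lt fun c hc => ?_
    have h3 : Tendsto (fun u => ENNReal.ofReal (A u)) (𝓝[<] t) (𝓝 (ENNReal.ofReal (A t))) :=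
      ((ENNReal.continuous_ofReal.comp hA).tendsto t).mono_left nhdsWithin_le_nhds
    have h4 := (h3.eventually_const_lt hc).and (Ioo_mem_nhdsLT ht)
    obtain ⟨l, hl, hl2⟩ := (mem_nhdsLT_iff_exists_Ioo_subset' ht).1 h4
    obtain ⟨q, hq1, hq2⟩ := exists_rat_btwn (show l < t from hl)
    obtain ⟨h5, h6⟩ := hl2 ⟨hq1, hq2⟩
    refine lt_of_lt_of_le h5 (le_iSup_of_le q ?_)
    rw [max_eq_left h6.1.le, if_pos (h1 _ h6.1.le hq2)]

lemma hit_spec {h : ℝ} (h0 : f 0 < x) (hh : 0 ≤ h) (hx : x ≤ Mx f h) :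
    ∃ t, 0 < t ∧ t ≤ h ∧ f t = x ∧ Mx f t = x ∧ (∀ u, 0 ≤ u → u < t → Mx f u < x) ∧
      TT x f = ENNReal.ofReal t ∧ DD x f = ENNReal.ofReal (Dx f t) := by
  have hA := Mx_cont hf
  have hmono : ∀ s u, 0 ≤ s → s ≤ u → Mx f s ≤ Mx f u := fun s u hs h => Mx_mono hf hs h
  obtain ⟨c1, c2⟩ := cross_mem (a := x) hA hh
  have c3 := cross_le (A := Mx f) (a := x) hh
  have c4 := cross_val_le (a := x) hA hmono hh (by rw [Mx_zero hf]; exact h0.le)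
  have c5 := fun u (hu : 0 ≤ u) => lt_cross (a := x) hA hmono hh hu
  set t := cross (Mx f) x h
  have c6 : Mx f t = x := by
    apply le_antisymm c4
    rcases c2 with c2 | c2
    · exact c2
    · rw [le_antisymm c3 c2]; exact hx
  have c7 : 0 < t := by
    rcases eq_or_lt_of_le c1 with c | c
    · rw [← c, Mx_zero hf] at c6; linarith
    · exact c
  have c8 : ∀ u, 0 ≤ u → u < t → Mx f u < x := fun u hu h => ((c5 u hu).1 h).1
  refine ⟨t, c7, c3, ?_, c6, c8, ?_, ?_⟩
  · obtain ⟨u, hu, h'⟩ := exists_Mx hf c7.le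
    rcases eq_or_lt_of_le hu.2 with h2 | h2
    · rw [← h2, h', c6]
    · have := c8 u hu.1 h2
      have := le_Mx hf hu.1 le_rfl
      linarith
  · exact sup_eq hf (fun u => u) continuous_id (fun u v _ h => h) c7 c8 c6.ge
  · exact sup_eq hf (Dx f) (Dx_cont hf) (fun u v hu h => Dx_mono hf hu h) c7 c8 c6.ge

lemma hit_of_lt (h : TT x f < ∞) : ∃ n : ℕ, x ≤ Mx f n := by
  by_contra! h'
  have : TT x f = ∞ := by
    refine ENNReal.eq_top_of_forall_nnreal_le fun r => ?_
    obtain ⟨n, hn⟩ := exists_nat_gt r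
    refine (ENNReal.coe_lt_coe.2 hn).le.trans (le_iSup_of_le (n:ℚ) ?_)
    have e : max (((n:ℚ)):ℝ) 0 = n := by rw [Rat.cast_natCast]; exact max_eq_left n.cast_nonneg
    rw [e, if_pos (h' n)]; simp
  exact h.ne this

lemma TT_le_iff (h0 : f 0 < x) {s : ℝ} (hs : 0 ≤ s) : TT x f ≤ ENNReal.ofReal s ↔ x ≤ Mx f s := by
  constructor
  · intro h
    obtain ⟨n, hn⟩ := hit_of_lt hf (h.trans_lt ENNReal.ofReal_lt_top)
    obtain ⟨t, ht, -, -, h3, -, h4, -⟩ := hit_spec hf h0 n.cast_nonneg hn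
    rw [h4, ENNReal.ofReal_le_ofReal_iff hs] at h
    rw [← h3]; exact Mx_mono hf ht.le h
  · intro h
    obtain ⟨t, ht, h5, -, h3, -, h4, -⟩ := hit_spec hf h0 hs h
    rw [h4]; exact ENNReal.ofReal_le_ofReal h5

lemma TT_pos (h0 : f 0 < x) : 0 < TT x f := by
  rw [pos_iff_ne_zero]; intro h
  have := (TT_le_iff hf h0 le_rfl).1 (by simp [h])
  rw [Mx_zero hf] at this; linarith

/-- scaling -/
lemma Mx_scale {c : ℝ} (hc : 0 < c) {s : ℝ} (hs : 0 ≤ s) : Mx (fun t => c⁻¹ * f (c ^ 2 * t)) s = c⁻¹ * Mx f (c ^ 2 * s) := by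
  have hg : Continuous fun t => c⁻¹ * f (c ^ 2 * t) := by fun_prop
  apply le_antisymm
  · obtain ⟨u, hu, h⟩ := exists_Mx hg hs
    rw [← h]
    have := le_Mx hf (u := c ^ 2 * u) (s := c ^ 2 * s) (by have := hu.1; positivity) (by have := hu.2; gcongr)
    gcongr
  · obtain ⟨u, hu, h⟩ := exists_Mx hf (s := c ^ 2 * s) (by positivity)
    rw [← h]
    have := le_Mx hg (u := u / c ^ 2) (s := s) (by have := hu.1; positivity) (by rw [div_le_iff₀ (by positivity)]; linarith [hu.2])
    rwa [mul_div_cancel₀ _ (by positivity)] at this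

lemma Dx_scale {c : ℝ} (hc : 0 < c) {s : ℝ} (hs : 0 ≤ s) : Dx (fun t => c⁻¹ * f (c ^ 2 * t)) s = c⁻¹ * Dx f (c ^ 2 * s) := by
  have hg : Continuous fun t => c⁻¹ * f (c ^ 2 * t) := by fun_prop
  apply le_antisymm
  · obtain ⟨u, v, h0, h1, h2, h⟩ := exists_Dx hg hs
    rw [← h]
    have := le_Dx hf (u := c ^ 2 * u) (v := c ^ 2 * v) (s := c ^ 2 * s) (by positivity) (by gcongr) (by gcongr)
    rw [← mul_sub]; gcongr
  · obtain ⟨u, v, h0, h1, h2, h⟩ := exists_Dx hf (s := c ^ 2 * s) (by positivity)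
    rw [← h]
    have := le_Dx hg (u := u / c ^ 2) (v := v / c ^ 2) (s := s) (by positivity) (by gcongr) (by rw [div_le_iff₀ (by positivity)]; linarith)
    rw [mul_div_cancel₀ _ (by positivity), mul_div_cancel₀ _ (by positivity)] at this
    rwa [mul_sub]

lemma scale_spec (hx : 0 < x) (h0 : f 0 = 0) :
    TT x f = ENNReal.ofReal (x ^ 2) * TT 1 (fun t => x⁻¹ * f (x ^ 2 * t)) ∧
    (TT x f < ∞ → DD x f = ENNReal.ofReal x * DD 1 (fun t => x⁻¹ * f (x ^ 2 * t))) := by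
  have hg : Continuous fun t => x⁻¹ * f (x ^ 2 * t) := by fun_prop
  have hg0 : x⁻¹ * f (x ^ 2 * 0) < 1 := by simp [h0]
  by_cases h : TT x f < ∞
  · obtain ⟨n, hn⟩ := hit_of_lt hf h
    obtain ⟨t, ht, -, h1, h2, h3, h4, h5⟩ := hit_spec hf (by rw [h0]; exact hx) n.cast_nonneg hn
    have e : Mx (fun t => x⁻¹ * f (x ^ 2 * t)) (t / x ^ 2) = 1 := by
      rw [Mx_scale hf hx (by positivity), mul_div_cancel₀ _ (by positivity), h2]
      exact inv_mul_cancel₀ hx.ne'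
    obtain ⟨t', ht', -, h1', h2', h3', h4', h5'⟩ := hit_spec hg (x := 1) hg0 (by positivity) e.ge
    have e2 : x ^ 2 * t' = t := by
      apply le_antisymm
      · by_contra! hlt
        have := h3' (t / x ^ 2) (by positivity) (by rw [div_lt_iff₀ (by positivity)]; linarith)
        linarith
      · by_contra! hlt
        have := h3 _ (by positivity) hlt
        rw [Mx_scale hf hx ht'.le] at h2'
        have : x⁻¹ * Mx f (x ^ 2 * t') < x⁻¹ * x := by gcongr
        rw [inv_mul_cancel₀ hx.ne'] at this
        linarith
    refine ⟨?_, fun _ => ?_⟩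
    · rw [h4, h4', ← ENNReal.ofReal_mul (by positivity), e2]
    · rw [h5, h5', ← ENNReal.ofReal_mul hx.le, Dx_scale hf hx ht'.le, e2]
      congr 1; field_simp
  · refine ⟨?_, fun h' => absurd h' h⟩
    have h1 : TT x f = ∞ := not_lt_top_iff.1 h
    by_contra h2
    have h3 : TT 1 (fun t => x⁻¹ * f (x ^ 2 * t)) < ∞ := by
      by_contra h4
      rw [not_lt_top_iff.1 h4, ENNReal.mul_top (by simp; positivity)] at h2
      exact h2 h1
    obtain ⟨n, hn⟩ := hit_of_lt hg h3
    rw [Mx_scale hf hx n.cast_nonneg] at hn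
    have h5 : x ≤ Mx f (x ^ 2 * n) := by
      rw [inv_mul_eq_div, le_div_iff₀ hx] at hn; linarith
    have := (TT_le_iff hf (by rw [h0]; exact hx) (by positivity)).2 h5
    rw [h1] at this
    exact (this.trans_lt ENNReal.ofReal_lt_top).ne rfl
end

end part8

section part9
open MeasureTheory ProbabilityTheory Real Set Filter
open scoped ENNReal NNReal Topology

noncomputable def gS (h x : ℝ) (f : ℝ → ℝ) (n : ℕ) (a : ℝ → ℝ≥0∞) : ℝ≥0∞ :=
  ∑ k ∈ Finset.range n, {y | Mx f (h * k / n) < y ∧ y ≤ Mx f (h * ((k + 1 : ℕ) : ℝ) / n)}.indicator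
    (fun _ => a (h * ((k + 1 : ℕ) : ℝ) / n)) x

section
variable {f : ℝ → ℝ} (hf : Continuous f) (h0 : f 0 = 0) {h x : ℝ} (hh : 0 < h)
include hf h0 hh

lemma gS_zero (hx : ¬ (0 < x ∧ x ≤ Mx f h)) (n : ℕ) (a : ℝ → ℝ≥0∞) : gS h x f n a = 0 := by
  classical
  refine Finset.sum_eq_zero fun k hk => ?_
  have hk := Finset.mem_range.1 hk
  rw [indicator_apply, if_neg]
  rintro ⟨h1, h2⟩
  apply hx
  have m1 := grid_mem hh.le hk.le
  have m2 : h * ((k + 1 : ℕ) : ℝ) / n ∈ Icc 0 h := grid_mem hh.le hk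
  have e1 := le_Mx hf le_rfl m1.1
  have e2 := Mx_mono hf m2.1 m2.2
  exact ⟨by linarith, by linarith⟩

lemma gS_eq {t : ℝ} (ht0 : 0 < t) (hth : t ≤ h) (h1 : Mx f t = x) (h2 : ∀ u, 0 ≤ u → u < t → Mx f u < x)
    {n : ℕ} (hn : 0 < n) (a : ℝ → ℝ≥0∞) : gS h x f n a = a (h * (⌈(n:ℝ) * t / h⌉₊ : ℝ) / n) := by
  classical
  have hn' : (0:ℝ) < n := by exact_mod_cast hn
  have key : ∀ s, 0 ≤ s → (Mx f s < x ↔ s < t) := fun s hs =>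
    ⟨fun h => by by_contra! h'; have := Mx_mono hf ht0.le h'; linarith, h2 s hs⟩
  have hc : 0 < ⌈(n:ℝ) * t / h⌉₊ := Nat.ceil_pos.2 (by positivity)
  obtain ⟨j, hj⟩ := Nat.exists_eq_succ_of_ne_zero hc.ne'
  have hjn : j < n := by
    have := grid_ceil_le hh hth n
    omega
  unfold gS
  rw [Finset.sum_eq_single j]
  · rw [indicator_apply, if_pos]
    · rw [hj]
    · refine ⟨(key _ (by positivity)).2 ((grid_lt_iff hh hn).2 (by omega)), ?_⟩
      rw [← not_lt, key _ (by positivity), grid_lt_iff hh hn]; omega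
  · intro k _ hkj
    rw [indicator_apply, if_neg]
    rintro ⟨h3, h4⟩
    rw [key _ (by positivity), grid_lt_iff hh hn] at h3
    rw [← not_lt, key _ (by positivity), grid_lt_iff hh hn] at h4
    omega
  · intro h'; exact absurd (Finset.mem_range.2 hjn) h'

lemma gS_tendsto (a : ℝ → ℝ≥0∞) (b : ℝ≥0∞) (hb : ∀ t, 0 < t → t ≤ h → TT x f = ENNReal.ofReal t →
      DD x f = ENNReal.ofReal (Dx f t) → f t = x → ContinuousAt a t ∧ a t = b) :
    Tendsto (fun n => gS h x f n a) atTop (𝓝 (if 0 < x ∧ x ≤ Mx f h then b else 0)) := by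
  split_ifs with hx
  · obtain ⟨t, ht, hth, h1, h2, h3, h4, h5⟩ := hit_spec hf (by rw [h0]; exact hx.1) hh.le hx.2
    obtain ⟨h6, h7⟩ := hb t ht hth h4 h5 h1
    rw [← h7]
    refine (h6.tendsto.comp (grid_tendsto hh ht.le)).congr' ?_
    filter_upwards [eventually_gt_atTop 0] with n hn
    rw [gS_eq hf h0 hh ht hth h2 h3 hn]; rfl
  · refine tendsto_const_nhds.congr fun n => (gS_zero hf h0 hh hx n a).symm

lemma gS_le (a : ℝ → ℝ≥0∞) (C : ℝ≥0∞) (hC : ∀ s ∈ Icc 0 h, a s ≤ C) (n : ℕ) :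
    gS h x f n a ≤ (Ioc 0 (Mx f h)).indicator (fun _ => C) x := by
  classical
  rcases Nat.eq_zero_or_pos n with rfl | hn
  · simp [gS]
  by_cases hx : 0 < x ∧ x ≤ Mx f h
  · obtain ⟨t, ht, hth, h1, h2, h3, h4, h5⟩ := hit_spec hf (by rw [h0]; exact hx.1) hh.le hx.2
    rw [gS_eq hf h0 hh ht hth h2 h3 hn, indicator_apply, if_pos (show x ∈ Ioc 0 (Mx f h) from hx)]
    exact hC _ (grid_mem hh.le (grid_ceil_le hh hth n))
  · rw [gS_zero hf h0 hh hx n a]; exact bot_le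
end

noncomputable def gF (ε h x : ℝ) (f : ℝ → ℝ) : ℝ≥0∞ :=
  if 0 < x ∧ x ≤ Mx f h then ENNReal.ofReal (√(TT x f).toReal / (|(DD x f).toReal| + ε)) else 0

noncomputable def phiT (x : ℝ) (f : ℝ → ℝ) : ℝ≥0∞ := gaussianPDF 0 (1 - (TT x f).toReal).toNNReal 0

section
variable {Ω : Type*} [MeasurableSpace Ω] {P : Measure Ω} [IsProbabilityMeasure P] {N : ℝ → Ω → ℝ}

lemma measurable_gaussianPDF_prod (v : ℝ≥0) {α : Type*} [MeasurableSpace α] {g : α → ℝ} (hg : Measurable g) :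
    Measurable fun y => gaussianPDF 0 v (g y) := (measurable_gaussianPDF 0 v).comp hg

lemma IsStdBM.key_term (hN : IsStdBM P N) {r s : ℝ} (hr : 0 ≤ r) (hrs : r ≤ s) (hs1 : s < 1)
    (A : ℝ → ℝ≥0∞) (hA : Measurable A) :
    ∫⁻ ω, {y | Mx (fun u => N u ω) r < y ∧ y ≤ Mx (fun u => N u ω) s}.indicator
        (fun _ => A (Dx (fun u => N u ω) s)) (N 1 ω) ∂P
    = ∫⁻ ω, (∫⁻ x, {y | Mx (fun u => N u ω) r < y ∧ y ≤ Mx (fun u => N u ω) s}.indicator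
        (fun _ => A (Dx (fun u => N u ω) s) * gaussianPDF 0 (1 - s).toNNReal (x - N s ω)) x) ∂P := by
  classical
  have hs := hr.trans hrs
  set Φ : (ℝ → ℝ) × ℝ → ℝ≥0∞ := fun p =>
    if Mx p.1 r < p.1 s + p.2 ∧ p.1 s + p.2 ≤ Mx p.1 s then A (Dx p.1 s) else 0 with hΦ
  have m : ∀ r, Measurable fun p : (ℝ → ℝ) × ℝ => Mx p.1 r := fun r => (_root_.measurable_Mx r).comp measurable_fst
  have ms : Measurable fun p : (ℝ → ℝ) × ℝ => p.1 s + p.2 := by fun_prop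
  have hΦm : Measurable Φ := by
    refine Measurable.ite ((measurableSet_lt (m r) ms).inter (measurableSet_le ms (m s))) ?_ measurable_const
    exact hA.comp ((_root_.measurable_Dx s).comp measurable_fst)
  have e := hN.freeze hs hs1.le Φ hΦm
  simp only [hΦ, Mx_stp hr hrs, Mx_stp hs le_rfl, Dx_stp hs le_rfl, stp_of _ hs le_rfl, add_sub_cancel] at e
  simp only [indicator_apply, mem_ofPred_eq]
  rw [e]
  refine lintegral_congr fun ω => ?_
  have hv : (1 - s).toNNReal ≠ 0 := by rw [← pos_iff_ne_zero]; simp [hs1]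
  rw [gaussianReal_of_var_ne_zero _ hv, lintegral_withDensity_eq_lintegral_mul _ (measurable_gaussianPDF _ _)]
  · rw [← lintegral_sub_right_eq_self _ (N s ω)]
    refine lintegral_congr fun x => ?_
    simp only [Pi.mul_apply, add_sub_cancel]
    split_ifs
    · rw [mul_comm]
    · simp
  · refine Measurable.ite ?_ measurable_const measurable_const
    have m3 : Measurable fun y => N s ω + y := by fun_prop
    exact (measurableSet_lt measurable_const m3).inter (measurableSet_le m3 measurable_const)

lemma gaussianPDFReal_le {v : ℝ≥0} {c : ℝ} (hc : 0 < c) (hv : c ≤ v) (y : ℝ) :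
    gaussianPDFReal 0 v y ≤ (√(2 * π * c))⁻¹ := by
  rw [gaussianPDFReal]
  calc _ ≤ (√(2 * π * v))⁻¹ * 1 := by
        gcongr
        rw [Real.exp_le_one_iff]
        apply div_nonpos_of_nonpos_of_nonneg
        · nlinarith [sq_nonneg (y - 0)]
        · positivity
    _ ≤ _ := by rw [mul_one]; gcongr

set_option maxHeartbeats 1000000 in
lemma IsStdBM.keyF (hN : IsStdBM P N) {h ε : ℝ} (hh : 0 < h) (h1 : h < 1) (hε : 0 < ε) :
    ∫⁻ ω, gF ε h (N 1 ω) (fun u => N u ω) ∂P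
      = ∫⁻ p, gF ε h p.2 (fun u => N u p.1) * phiT p.2 (fun u => N u p.1) ∂(P.prod volume) := by
  classical
  set F : ℝ → ℝ → ℝ := fun s d => √s / (|d| + ε) with hF
  have Fpos : ∀ s d, 0 ≤ F s d := fun s d => by simp only [hF]; positivity
  have Fle : ∀ s ∈ Icc 0 h, ∀ d, F s d ≤ 1 / ε := fun s hs d => by
    simp only [hF]
    have : √s ≤ 1 := by rw [Real.sqrt_le_one]; linarith [hs.2]
    gcongr
    linarith [abs_nonneg d]
  set a : Ω → ℝ → ℝ≥0∞ := fun ω s => ENNReal.ofReal (F s (Dx (fun u => N u ω) s)) with ha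
  set b : Ω → ℝ → ℝ → ℝ≥0∞ := fun ω x s => ENNReal.ofReal (F s (Dx (fun u => N u ω) s)) *
    gaussianPDF 0 (1 - s).toNNReal (x - N s ω) with hb
  have Fm : ∀ s, Measurable fun d => ENNReal.ofReal (F s d) := fun s => by simp only [hF]; fun_prop
  have mM : ∀ s, Measurable fun p : Ω × ℝ => Mx (fun u => N u p.1) s := fun s => (hN.measurable_Mx s).comp measurable_fst
  have mLt : ∀ n k : ℕ, Measurable fun p : Ω × ℝ =>
      {y | Mx (fun u => N u p.1) (h * k / n) < y ∧ y ≤ Mx (fun u => N u p.1) (h * ((k + 1 : ℕ) : ℝ) / n)}.indicator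
      (fun _ => a p.1 (h * ((k + 1 : ℕ) : ℝ) / n)) p.2 := by
    intro n k
    simp only [indicator_apply, mem_ofPred_eq]
    refine Measurable.ite ((measurableSet_lt (mM _) measurable_snd).inter (measurableSet_le measurable_snd (mM _))) ?_ measurable_const
    exact (Fm _).comp ((hN.measurable_Dx _).comp measurable_fst)
  have mRt : ∀ n k : ℕ, Measurable fun p : Ω × ℝ =>
      {y | Mx (fun u => N u p.1) (h * k / n) < y ∧ y ≤ Mx (fun u => N u p.1) (h * ((k + 1 : ℕ) : ℝ) / n)}.indicator
      (fun _ => b p.1 p.2 (h * ((k + 1 : ℕ) : ℝ) / n)) p.2 := by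
    intro n k
    simp only [indicator_apply, mem_ofPred_eq]
    refine Measurable.ite ((measurableSet_lt (mM _) measurable_snd).inter (measurableSet_le measurable_snd (mM _))) ?_ measurable_const
    refine ((Fm _).comp ((hN.measurable_Dx _).comp measurable_fst)).mul (measurable_gaussianPDF_prod _ ?_)
    exact measurable_snd.sub ((hN.measurable _).comp measurable_fst)
  have mN1 : Measurable fun ω => ((ω, N 1 ω) : Ω × ℝ) := measurable_id.prodMk (hN.measurable 1)
  have mLt' : ∀ n k : ℕ, Measurable fun ω : Ω =>
      {y | Mx (fun u => N u ω) (h * k / n) < y ∧ y ≤ Mx (fun u => N u ω) (h * ((k + 1 : ℕ) : ℝ) / n)}.indicator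
      (fun _ => a ω (h * ((k + 1 : ℕ) : ℝ) / n)) (N 1 ω) := fun n k => (mLt n k).comp mN1
  have sL : ∀ n : ℕ, Measurable fun ω => gS h (N 1 ω) (fun u => N u ω) n (a ω) := fun n => by
    unfold gS; exact Finset.measurable_fun_sum _ fun k _ => mLt' n k
  have sR : ∀ n : ℕ, Measurable fun p : Ω × ℝ => gS h p.2 (fun u => N u p.1) n (b p.1 p.2) := fun n => by
    unfold gS; exact Finset.measurable_fun_sum _ fun k _ => mRt n k
  -- equality along grids
  have eqn : ∀ n : ℕ, ∫⁻ ω, gS h (N 1 ω) (fun u => N u ω) n (a ω) ∂P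
      = ∫⁻ p, gS h p.2 (fun u => N u p.1) n (b p.1 p.2) ∂(P.prod volume) := by
    intro n
    simp only [gS]
    rw [lintegral_finset_sum _ fun k _ => mLt' n k, lintegral_finset_sum _ fun k _ => mRt n k]
    refine Finset.sum_congr rfl fun k hk => ?_
    have hk := Finset.mem_range.1 hk
    have m1 := grid_mem hh.le hk.le
    have m2 : h * ((k + 1 : ℕ) : ℝ) / n ∈ Icc 0 h := grid_mem hh.le hk
    rw [lintegral_prod _ (mRt n k).aemeasurable]
    refine hN.key_term m1.1 ?_ (m2.2.trans_lt h1) (fun d => ENNReal.ofReal (F (h * ((k + 1 : ℕ) : ℝ) / n) d)) (Fm _)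
    gcongr; omega
  have hspec : ∀ ω t x, 0 < t → t ≤ h → TT x (fun u => N u ω) = ENNReal.ofReal t → DD x (fun u => N u ω) = ENNReal.ofReal (Dx (fun u => N u ω) t) →
      ContinuousAt (fun s => F s (Dx (fun u => N u ω) s)) t ∧
      F t (Dx (fun u => N u ω) t) = √(TT x (fun u => N u ω)).toReal / (|(DD x (fun u => N u ω)).toReal| + ε) := by
    intro ω t x ht hth hT hD
    constructor
    · have := Dx_cont (hN.cont ω)
      simp only [hF]
      refine ContinuousAt.div (by fun_prop) (by fun_prop) ?_
      positivity
    · rw [hT, hD, ENNReal.toReal_ofReal ht.le, ENNReal.toReal_ofReal (Dx_nonneg (hN.cont ω) ht.le)]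
  have lim1 : Tendsto (fun n => ∫⁻ ω, gS h (N 1 ω) (fun u => N u ω) n (a ω) ∂P) atTop
      (𝓝 (∫⁻ ω, gF ε h (N 1 ω) (fun u => N u ω) ∂P)) := by
    refine tendsto_lintegral_of_dominated_convergence (fun _ => ENNReal.ofReal (1 / ε)) ?_ ?_ ?_ ?_
    · exact sL
    · refine fun n => ae_of_all _ fun ω => (gS_le (hN.cont ω) (hN.start ω) hh (a ω) _ (fun s hs => ?_) n).trans
        (indicator_le_self' (fun _ _ => bot_le) _)
      exact ENNReal.ofReal_le_ofReal (Fle s hs _)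
    · simp
    · refine ae_of_all _ fun ω => gS_tendsto (hN.cont ω) (hN.start ω) hh (a ω) _ fun t ht hth hT hD hx => ?_
      obtain ⟨c1, c2⟩ := hspec ω t _ ht hth hT hD
      exact ⟨ENNReal.continuous_ofReal.continuousAt.comp c1, by rw [← c2]⟩
  have lim2 : Tendsto (fun n => ∫⁻ p, gS h p.2 (fun u => N u p.1) n (b p.1 p.2) ∂(P.prod volume)) atTop
      (𝓝 (∫⁻ p, gF ε h p.2 (fun u => N u p.1) * phiT p.2 (fun u => N u p.1) ∂(P.prod volume))) := by
    set C := ENNReal.ofReal (1 / ε) * ENNReal.ofReal (√(2 * π * (1 - h)))⁻¹ with hC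
    refine tendsto_lintegral_of_dominated_convergence
      (fun p => (Ioc 0 (Mx (fun u => N u p.1) h)).indicator (fun _ => C) p.2) ?_ ?_ ?_ ?_
    · exact sR
    · refine fun n => ae_of_all _ fun p => gS_le (hN.cont p.1) (hN.start p.1) hh (b p.1 p.2) _ (fun s hs => ?_) n
      refine mul_le_mul' (ENNReal.ofReal_le_ofReal (Fle s hs _)) (ENNReal.ofReal_le_ofReal ?_)
      refine gaussianPDFReal_le (by linarith) ?_ _
      rw [Real.coe_toNNReal _ (by linarith [hs.2])]; linarith [hs.2]
    · rw [lintegral_prod]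
      · have : ∀ ω, ∫⁻ y, (Ioc 0 (Mx (fun u => N u ω) h)).indicator (fun _ => C) y
            = C * ENNReal.ofReal (Mx (fun u => N u ω) h) := by
          intro ω
          rw [lintegral_indicator measurableSet_Ioc]; simp
        simp only [this]
        rw [lintegral_const_mul _ (hN.measurable_Mx h).ennreal_ofReal]
        refine (ENNReal.mul_lt_top (by simp [hC, ENNReal.mul_lt_top]) ?_).ne
        exact (hasFiniteIntegral_iff_ofReal (ae_of_all _ fun ω => hN.Mx_nonneg hh.le ω)).1 (hN.integrable_Mx hh).2
      · apply Measurable.aemeasurable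
        simp only [indicator_apply, mem_Ioc]
        exact Measurable.ite ((measurableSet_lt measurable_const measurable_snd).inter (measurableSet_le measurable_snd (mM _)))
          measurable_const measurable_const
    · refine ae_of_all _ fun p => ?_
      have e : gF ε h p.2 (fun u => N u p.1) * phiT p.2 (fun u => N u p.1)
        = if 0 < p.2 ∧ p.2 ≤ Mx (fun u => N u p.1) h then
          ENNReal.ofReal (√(TT p.2 (fun u => N u p.1)).toReal / (|(DD p.2 (fun u => N u p.1)).toReal| + ε)) * phiT p.2 (fun u => N u p.1) else 0 := by
        unfold gF; split_ifs <;> simp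
      rw [e]
      refine gS_tendsto (hN.cont p.1) (hN.start p.1) hh _ _ fun t ht hth hT hD hx => ?_
      obtain ⟨c1, c2⟩ := hspec p.1 t _ ht hth hT hD
      have c3 : ContinuousAt (fun s => gaussianPDFReal 0 (1 - s).toNNReal (p.2 - N s p.1)) t := by
        have := hN.cont p.1
        unfold gaussianPDFReal
        have c4 : ContinuousAt (fun s : ℝ => (((1 - s).toNNReal : ℝ≥0) : ℝ)) t := by
          have : Continuous (fun s : ℝ => (((1 - s).toNNReal : ℝ≥0) : ℝ)) := by fun_prop
          exact this.continuousAt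
        have c5 : (0:ℝ) < ((1 - t).toNNReal : ℝ≥0) := by rw [Real.coe_toNNReal _ (by linarith)]; linarith
        refine ContinuousAt.mul (ContinuousAt.inv₀ (ContinuousAt.sqrt (continuousAt_const.mul c4)) (by positivity)) ?_
        refine Real.continuous_exp.continuousAt.comp ?_
        refine ContinuousAt.div (by fun_prop) (continuousAt_const.mul c4) (by positivity)
      constructor
      · have : b p.1 p.2 = fun s => ENNReal.ofReal (F s (Dx (fun u => N u p.1) s) * gaussianPDFReal 0 (1 - s).toNNReal (p.2 - N s p.1)) := by
          ext s
          simp only [hb, gaussianPDF]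
          rw [ENNReal.ofReal_mul (Fpos _ _)]
        rw [this]
        exact ENNReal.continuous_ofReal.continuousAt.comp (c1.mul c3)
      · simp only [hb, phiT]
        rw [c2, hx, sub_self, hT, ENNReal.toReal_ofReal ht.le]
  exact tendsto_nhds_unique (lim1.congr eqn) lim2
end

end part9

section part10
open MeasureTheory ProbabilityTheory Real Set Filter
open scoped ENNReal NNReal Topology

noncomputable def GG (x : ℝ) (f : ℝ → ℝ) : ℝ≥0∞ :=
  if 0 < x ∧ TT x f < 1 then ENNReal.ofReal (√(TT x f).toReal) / DD x f else 0

lemma measurable_gF (ε h : ℝ) : Measurable (fun p : ℝ × (ℝ → ℝ) => gF ε h p.1 p.2) := by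
  unfold gF
  refine Measurable.ite ?_ ?_ measurable_const
  · exact (measurableSet_lt measurable_const measurable_fst).inter
      (measurableSet_le measurable_fst ((measurable_Mx h).comp measurable_snd))
  · apply Measurable.ennreal_ofReal
    exact measurable_TT.ennreal_toReal.sqrt.div
      ((_root_.continuous_abs.measurable.comp measurable_DD.ennreal_toReal).add_const _)

lemma measurable_GG : Measurable (fun p : ℝ × (ℝ → ℝ) => GG p.1 p.2) := by
  unfold GG
  refine Measurable.ite ?_ ?_ measurable_const
  · exact (measurableSet_lt measurable_const measurable_fst).inter
      (measurableSet_lt measurable_TT measurable_const)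
  · exact measurable_TT.ennreal_toReal.sqrt.ennreal_ofReal.div measurable_DD

lemma gaussianPDF_zero (τ : ℝ) : gaussianPDF 0 (1 - τ).toNNReal 0 = ENNReal.ofReal ((√(2 * π * ((1 - τ).toNNReal : ℝ)))⁻¹) := by
  simp [gaussianPDF, gaussianPDFReal]

lemma measurable_phiT : Measurable (fun p : ℝ × (ℝ → ℝ) => phiT p.1 p.2) := by
  simp only [phiT, gaussianPDF_zero]
  have := measurable_TT.ennreal_toReal
  fun_prop

section
variable {f : ℝ → ℝ} (hf : Continuous f) (h0 : f 0 = 0) (x : ℝ)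
include hf h0

lemma gF_mono {ε ε' h h' : ℝ} (hh : 0 ≤ h) (hhh : h ≤ h') (hε : 0 < ε') (hεε : ε' ≤ ε) : gF ε h x f ≤ gF ε' h' x f := by
  unfold gF
  by_cases hx : 0 < x ∧ x ≤ Mx f h
  · rw [if_pos hx, if_pos ⟨hx.1, hx.2.trans (Mx_mono hf hh hhh)⟩]
    gcongr
  · rw [if_neg hx]; exact bot_le

lemma gF_tendsto : Tendsto (fun j : ℕ => gF (1 / ((j:ℝ) + 1)) (1 - 1 / ((j:ℝ) + 2)) x f) atTop (𝓝 (GG x f)) := by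
  have hpos : ∀ j : ℕ, (0:ℝ) ≤ 1 - 1 / ((j:ℝ) + 2) := fun j => by
    rw [sub_nonneg, div_le_one (by positivity)]; linarith [(Nat.cast_nonneg j : (0:ℝ) ≤ j)]
  have hlt : ∀ j : ℕ, 1 - 1 / ((j:ℝ) + 2) < 1 := fun j => by
    have : (0:ℝ) < 1 / ((j:ℝ) + 2) := by positivity
    linarith
  unfold GG
  split_ifs with hx
  · obtain ⟨n, hn⟩ := hit_of_lt hf (hx.2.trans ENNReal.one_lt_top)
    obtain ⟨t, ht, -, h1, h2, h3, h4, h5⟩ := hit_spec hf (by rw [h0]; exact hx.1) n.cast_nonneg hn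
    have ht1 : t < 1 := by
      have := hx.2; rw [h4] at this; simpa using this
    have hD := Dx_nonneg hf ht.le
    have e : ∀ᶠ j : ℕ in atTop, gF (1 / ((j:ℝ) + 1)) (1 - 1 / ((j:ℝ) + 2)) x f
        = ENNReal.ofReal (√t) / ENNReal.ofReal (Dx f t + 1 / ((j:ℝ) + 1)) := by
      have l : Tendsto (fun j : ℕ => 1 - 1 / ((j:ℝ) + 2)) atTop (𝓝 (1 - 0)) := by
        refine tendsto_const_nhds.sub ?_
        have := (tendsto_one_div_add_atTop_nhds_zero_nat (𝕜 := ℝ)).comp (tendsto_add_atTop_nat 1)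
        refine this.congr fun j => ?_
        simp only [Function.comp]; push_cast; congr 1; ring
      rw [sub_zero] at l
      filter_upwards [l.eventually_const_lt ht1] with j hj
      have : x ≤ Mx f (1 - 1 / ((j:ℝ) + 2)) := by rw [← h2]; exact Mx_mono hf ht.le hj.le
      unfold gF
      rw [if_pos ⟨hx.1, this⟩, h4, h5, ENNReal.toReal_ofReal ht.le, ENNReal.toReal_ofReal hD, abs_of_nonneg hD,
        ENNReal.ofReal_div_of_pos (by positivity)]
    rw [h4, h5, ENNReal.toReal_ofReal ht.le]
    refine Tendsto.congr' (e.mono fun _ h => h.symm) ?_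
    refine ENNReal.Tendsto.const_div ?_ (Or.inr ENNReal.ofReal_ne_top)
    have := (tendsto_one_div_add_atTop_nhds_zero_nat (𝕜 := ℝ)).const_add (Dx f t)
    rw [add_zero] at this
    exact ENNReal.tendsto_ofReal this
  · refine tendsto_const_nhds.congr fun j => ?_
    unfold gF
    rw [if_neg]
    rintro ⟨h1, h2⟩
    apply hx
    refine ⟨h1, ((TT_le_iff hf (by rw [h0]; exact h1) (hpos j)).2 h2).trans_lt ?_⟩
    rw [ENNReal.ofReal_lt_one]; exact hlt j
end

section
variable {Ω : Type*} [MeasurableSpace Ω] {P : Measure Ω} [IsProbabilityMeasure P] {N : ℝ → Ω → ℝ}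

lemma IsStdBM.keyG (hN : IsStdBM P N) :
    ∫⁻ ω, GG (N 1 ω) (fun u => N u ω) ∂P
      = ∫⁻ p, GG p.2 (fun u => N u p.1) * phiT p.2 (fun u => N u p.1) ∂(P.prod volume) := by
  have hpos : ∀ j : ℕ, (0:ℝ) < 1 - 1 / ((j:ℝ) + 2) := fun j => by
    rw [sub_pos, div_lt_one (by positivity)]; linarith [(Nat.cast_nonneg j : (0:ℝ) ≤ j)]
  have hlt : ∀ j : ℕ, 1 - 1 / ((j:ℝ) + 2) < 1 := fun j => by
    have : (0:ℝ) < 1 / ((j:ℝ) + 2) := by positivity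
    linarith
  have mono : ∀ ω x, Monotone fun j : ℕ => gF (1 / ((j:ℝ) + 1)) (1 - 1 / ((j:ℝ) + 2)) x (fun u => N u ω) := by
    intro ω x i j hij
    have hij' : (i:ℝ) ≤ j := by exact_mod_cast hij
    refine gF_mono (hN.cont ω) (hN.start ω) x (hpos i).le ?_ (by positivity) ?_
    · gcongr
    · gcongr
  have m1 : Measurable fun ω => ((N 1 ω, fun u => N u ω) : ℝ × (ℝ → ℝ)) := (hN.measurable 1).prodMk hN.measurable_path
  have m2 : Measurable fun p : Ω × ℝ => ((p.2, fun u => N u p.1) : ℝ × (ℝ → ℝ)) :=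
    measurable_snd.prodMk (hN.measurable_path.comp measurable_fst)
  have l1 : Tendsto (fun j : ℕ => ∫⁻ ω, gF (1 / ((j:ℝ) + 1)) (1 - 1 / ((j:ℝ) + 2)) (N 1 ω) (fun u => N u ω) ∂P) atTop
      (𝓝 (∫⁻ ω, GG (N 1 ω) (fun u => N u ω) ∂P)) :=
    lintegral_tendsto_of_tendsto_of_monotone (fun j => ((measurable_gF _ _).comp m1).aemeasurable)
      (ae_of_all _ fun ω => mono ω _) (ae_of_all _ fun ω => gF_tendsto (hN.cont ω) (hN.start ω) _)
  have l2 : Tendsto (fun j : ℕ => ∫⁻ p, gF (1 / ((j:ℝ) + 1)) (1 - 1 / ((j:ℝ) + 2)) p.2 (fun u => N u p.1) * phiT p.2 (fun u => N u p.1) ∂(P.prod volume)) atTop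
      (𝓝 (∫⁻ p, GG p.2 (fun u => N u p.1) * phiT p.2 (fun u => N u p.1) ∂(P.prod volume))) :=
    lintegral_tendsto_of_tendsto_of_monotone (fun j => (((measurable_gF _ _).comp m2).mul (measurable_phiT.comp m2)).aemeasurable)
      (ae_of_all _ fun p i j hij => mul_le_mul_left (mono p.1 _ hij) _)
      (ae_of_all _ fun p => ENNReal.Tendsto.mul_const (gF_tendsto (hN.cont p.1) (hN.start p.1) _)
        (Or.inr ENNReal.ofReal_ne_top))
  refine tendsto_nhds_unique (l1.congr fun j => ?_) l2
  exact hN.keyF (hpos j) (hlt j) (by positivity)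

lemma IsStdBM.scaling (hN : IsStdBM P N) {x : ℝ} (hx : 0 < x) (Ψ : ℝ≥0∞ × ℝ≥0∞ → ℝ≥0∞) (hΨ : Measurable Ψ)
    (h0 : ∀ d, Ψ (∞, d) = 0) :
    ∫⁻ ω, Ψ (TT x (fun u => N u ω), DD x (fun u => N u ω)) ∂P
      = ∫⁻ ω, Ψ (ENNReal.ofReal (x ^ 2) * TT 1 (fun u => N u ω), ENNReal.ofReal x * DD 1 (fun u => N u ω)) ∂P := by
  have m1 : Measurable (TT 1) := measurable_TT.comp (measurable_const.prodMk measurable_id : Measurable fun f : ℝ → ℝ => ((1:ℝ), f))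
  have m2 : Measurable (DD 1) := measurable_DD.comp (measurable_const.prodMk measurable_id : Measurable fun f : ℝ → ℝ => ((1:ℝ), f))
  have := hN.lintegral_path_eq (hN.scale hx) (fun f => Ψ (ENNReal.ofReal (x ^ 2) * TT 1 f, ENNReal.ofReal x * DD 1 f))
    (hΨ.comp ((m1.const_mul _).prodMk (m2.const_mul _))) (fun f g h => by rw [TT_congr h, DD_congr h])
  rw [this]
  refine lintegral_congr fun ω => ?_
  obtain ⟨h1, h2⟩ := scale_spec (hN.cont ω) hx (hN.start ω)
  rw [← h1]
  by_cases h : TT x (fun u => N u ω) < ∞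
  · rw [h2 h]
  · rw [not_lt_top_iff.1 h, h0, h0]
end

lemma arcsin_lint {a : ℝ} (ha : 0 < a) :
    ∫⁻ x in Ioo 0 (1 / a), ENNReal.ofReal (a * (√(2 * π * (1 - x ^ 2 * a ^ 2)))⁻¹)
      = ENNReal.ofReal ((√(2 * π))⁻¹ * (π / 2)) := by
  have hle : (0:ℝ) ≤ 1 / a := by positivity
  have hc : ContinuousOn (fun x => (√(2 * π))⁻¹ * arcsin (a * x)) (Icc 0 (1 / a)) := by
    have := continuous_arcsin; fun_prop
  have hd : ∀ x ∈ Ioo 0 (1 / a), HasDerivAt (fun x => (√(2 * π))⁻¹ * arcsin (a * x)) (a * (√(2 * π * (1 - x ^ 2 * a ^ 2)))⁻¹) x := by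
    intro x hx
    have h1 : a * x < 1 := by have := hx.2; rw [lt_div_iff₀ ha] at this; linarith
    have h2 : 0 < a * x := mul_pos ha hx.1
    have := ((hasDerivAt_arcsin (x := a * x) (by linarith) h1.ne).comp x ((hasDerivAt_id x).const_mul a)).const_mul (√(2 * π))⁻¹
    refine HasDerivAt.congr_deriv this ?_
    rw [show (1 - x ^ 2 * a ^ 2) = 1 - (a * x) ^ 2 by ring, Real.sqrt_mul (by positivity) (1 - (a * x) ^ 2), mul_inv]
    ring
  have hnn : ∀ x ∈ Ioo 0 (1 / a), 0 ≤ a * (√(2 * π * (1 - x ^ 2 * a ^ 2)))⁻¹ := fun x _ => by positivity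
  have hi := intervalIntegral.integrableOn_deriv_of_nonneg hc hd hnn
  have hI := intervalIntegral.integral_eq_sub_of_hasDerivAt_of_le hle hc hd
    ((intervalIntegrable_iff_integrableOn_Ioc_of_le hle).2 hi)
  rw [intervalIntegral.integral_of_le hle, integral_Ioc_eq_integral_Ioo] at hI
  rw [← ofReal_integral_eq_lintegral_ofReal (hi.mono_set Ioo_subset_Ioc_self) (ae_of_all _ fun x => by positivity), hI]
  rw [mul_one_div_cancel ha.ne']; simp

noncomputable def KK (p : ℝ≥0∞ × ℝ≥0∞) : ℝ≥0∞ :=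
  if p.1 < 1 then ENNReal.ofReal (√p.1.toReal) / p.2 * gaussianPDF 0 (1 - p.1.toReal).toNNReal 0 else 0

lemma measurable_KK : Measurable KK := by
  unfold KK
  refine Measurable.ite (measurableSet_lt measurable_fst measurable_const) ?_ measurable_const
  simp only [gaussianPDF_zero]
  fun_prop

lemma KK_lint (T D : ℝ≥0∞) (hT : 0 < T) :
    ∫⁻ x in Ioi (0:ℝ), KK (ENNReal.ofReal (x ^ 2) * T, ENNReal.ofReal x * D)
      = ENNReal.ofReal ((√(2 * π))⁻¹ * (π / 2)) * (if T < ∞ then D⁻¹ else 0) := by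
  by_cases h : T < ∞
  · rw [if_pos h]
    obtain ⟨t, rfl⟩ : ∃ t, T = ENNReal.ofReal t := ⟨T.toReal, (ENNReal.ofReal_toReal h.ne).symm⟩
    have ht : 0 < t := ENNReal.ofReal_pos.1 hT
    have ha : 0 < √t := Real.sqrt_pos.2 ht
    rw [← arcsin_lint ha, ← lintegral_mul_const _ (by fun_prop), ← lintegral_indicator measurableSet_Ioi,
      ← lintegral_indicator measurableSet_Ioo]
    congr 1; ext x
    classical
    rw [indicator_apply, indicator_apply]
    by_cases hx : 0 < x
    · rw [if_pos (show x ∈ Ioi 0 from hx)]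
      unfold KK
      simp only [← ENNReal.ofReal_mul (sq_nonneg x)]
      have e : x ^ 2 * t < 1 ↔ x < 1 / √t := by
        rw [lt_div_iff₀ ha, ← sq_lt_one_iff₀ (a := x * √t) (by positivity), mul_pow, Real.sq_sqrt ht.le]
      by_cases h1 : x < 1 / √t
      · rw [if_pos (ENNReal.ofReal_lt_one.2 (e.2 h1)), if_pos (show x ∈ Ioo 0 (1 / √t) from ⟨hx, h1⟩),
          ENNReal.toReal_ofReal (by positivity), gaussianPDF_zero, Real.coe_toNNReal _ (by linarith [e.2 h1]),
          Real.sqrt_mul (sq_nonneg x), Real.sqrt_sq hx.le, ENNReal.ofReal_mul hx.le,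
          ENNReal.mul_div_mul_left _ _ (by simpa using hx) ENNReal.ofReal_ne_top,
          ENNReal.ofReal_mul ha.le, div_eq_mul_inv, Real.sq_sqrt ht.le]
        ring
      · rw [if_neg (fun h2 => h1 (e.1 (ENNReal.ofReal_lt_one.1 h2))), if_neg (fun h2 : x ∈ Ioo 0 (1 / √t) => h1 h2.2)]
    · rw [if_neg (fun h2 : x ∈ Ioi 0 => hx h2), if_neg (fun h2 : x ∈ Ioo 0 (1 / √t) => hx h2.1)]
  · rw [if_neg h, mul_zero, not_lt_top_iff.1 h]
    rw [setLIntegral_congr_fun (g := fun _ => 0) measurableSet_Ioi]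
    · simp
    · intro x hx
      have hx : (0:ℝ) < x := hx
      simp only [KK]
      rw [ENNReal.mul_top (by simp; positivity)]
      simp


end part10

section part11
open MeasureTheory ProbabilityTheory Real Set Filter
open scoped ENNReal NNReal Topology

attribute [local irreducible] TT DD
section
variable {Ω : Type*} [MeasurableSpace Ω] {P : Measure Ω} [IsProbabilityMeasure P] {N : ℝ → Ω → ℝ}

lemma IsStdBM.mp1 (hN : IsStdBM P N) (x : ℝ) : Measurable fun ω => ((x, fun u => N u ω) : ℝ × (ℝ → ℝ)) :=
  measurable_const.prodMk hN.measurable_path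
lemma IsStdBM.mp2 (hN : IsStdBM P N) : Measurable fun p : Ω × ℝ => ((p.2, fun u => N u p.1) : ℝ × (ℝ → ℝ)) :=
  measurable_snd.prodMk (hN.measurable_path.comp measurable_fst)
lemma IsStdBM.mT (hN : IsStdBM P N) (x : ℝ) : Measurable fun ω => TT x (fun u => N u ω) :=
  measurable_TT.comp (hN.mp1 x)
lemma IsStdBM.mD (hN : IsStdBM P N) (x : ℝ) : Measurable fun ω => DD x (fun u => N u ω) :=
  measurable_DD.comp (hN.mp1 x)
lemma IsStdBM.mT2 (hN : IsStdBM P N) : Measurable fun p : Ω × ℝ => TT p.2 (fun u => N u p.1) :=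
  measurable_TT.comp hN.mp2
lemma IsStdBM.mD2 (hN : IsStdBM P N) : Measurable fun p : Ω × ℝ => DD p.2 (fun u => N u p.1) :=
  measurable_DD.comp hN.mp2
section
attribute [local irreducible] GG phiT
lemma IsStdBM.mG2 (hN : IsStdBM P N) : Measurable fun p : Ω × ℝ => GG p.2 (fun u => N u p.1) :=
  measurable_GG.comp hN.mp2
lemma IsStdBM.mPhi2 (hN : IsStdBM P N) : Measurable fun p : Ω × ℝ => phiT p.2 (fun u => N u p.1) :=
  measurable_phiT.comp hN.mp2
end

lemma IsStdBM.keyR (hN : IsStdBM P N) :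
    ∫⁻ ω, GG (N 1 ω) (fun u => N u ω) ∂P
      = ENNReal.ofReal ((√(2 * π))⁻¹ * (π / 2)) *
        ∫⁻ ω, (if TT 1 (fun u => N u ω) < ∞ then (DD 1 (fun u => N u ω))⁻¹ else 0) ∂P := by
  have mT := hN.mT 1
  have mD := hN.mD 1
  have m3 : Measurable fun p : Ω × ℝ => GG p.2 (fun u => N u p.1) * phiT p.2 (fun u => N u p.1) :=
    hN.mG2.mul hN.mPhi2
  rw [hN.keyG, lintegral_prod_symm _ m3.aemeasurable]
  have e : ∀ x : ℝ, ∫⁻ ω, GG x (fun u => N u ω) * phiT x (fun u => N u ω) ∂P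
      = (Ioi (0:ℝ)).indicator (fun x => ∫⁻ ω, KK (ENNReal.ofReal (x ^ 2) * TT 1 (fun u => N u ω), ENNReal.ofReal x * DD 1 (fun u => N u ω)) ∂P) x := by
    classical
    intro x
    rw [indicator_apply]
    split_ifs with hx
    · have hx : 0 < x := hx
      rw [← hN.scaling hx KK measurable_KK (fun d => by simp [KK])]
      refine lintegral_congr fun ω => ?_
      simp only [GG, KK, phiT, hx, true_and]
      split_ifs <;> simp
    · have hx : ¬ 0 < x := hx
      simp [GG, hx]
  have m4 : Measurable (Function.uncurry fun (x : ℝ) (ω : Ω) =>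
      KK (ENNReal.ofReal (x ^ 2) * TT 1 (fun u => N u ω), ENNReal.ofReal x * DD 1 (fun u => N u ω))) := by
    have a1 : Measurable fun p : ℝ × Ω => ENNReal.ofReal (p.1 ^ 2) * TT 1 (fun u => N u p.2) :=
      (measurable_fst.pow_const 2).ennreal_ofReal.mul (mT.comp measurable_snd)
    have a2 : Measurable fun p : ℝ × Ω => ENNReal.ofReal p.1 * DD 1 (fun u => N u p.2) :=
      measurable_fst.ennreal_ofReal.mul (mD.comp measurable_snd)
    exact measurable_KK.comp (a1.prodMk a2)
  have m5 : Measurable fun ω => (if TT 1 (fun u => N u ω) < ∞ then (DD 1 (fun u => N u ω))⁻¹ else 0) :=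
    Measurable.ite (measurableSet_lt mT measurable_const) mD.inv measurable_const
  have e2 := fun ω => KK_lint (TT 1 (fun u => N u ω)) (DD 1 (fun u => N u ω)) (TT_pos (hN.cont ω) (by simp [hN.start]))
  rw [← lintegral_const_mul _ m5, lintegral_congr e, lintegral_indicator measurableSet_Ioi,
    lintegral_lintegral_swap m4.aemeasurable]
  exact lintegral_congr e2
end

end part11

section part12
open MeasureTheory ProbabilityTheory Real Set Filter
open scoped ENNReal NNReal Topology

lemma gauss_Ioi_lt : gaussianReal 0 1 (Ioi (-1)) < 1 := by
  by_contra! h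
  have h2 : gaussianReal 0 1 (Ioi (-1 : ℝ))ᶜ = 0 := by
    rw [prob_compl_eq_zero_iff measurableSet_Ioi]
    exact le_antisymm prob_le_one h
  have := gaussianReal_absolutelyContinuous' 0 (v := 1) one_ne_zero h2
  simp at this

section
variable {f : ℝ → ℝ} (hf : Continuous f)
include hf

lemma cross_Dx_eq {n : ℝ} (hn : 0 ≤ n) (h : 1 ≤ Dx f n) :
    Dx f (cross (Dx f) 1 n) = 1 ∧ Mx f (cross (Dx f) 1 n) - f (cross (Dx f) 1 n) = 1 := by
  have hA := Dx_cont hf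
  have hmono : ∀ s u, 0 ≤ s → s ≤ u → Dx f s ≤ Dx f u := fun s u hs h => Dx_mono hf hs h
  obtain ⟨c1, c2⟩ := cross_mem (a := 1) hA hn
  have c3 := cross_le (A := Dx f) (a := 1) hn
  have c4 := cross_val_le (a := 1) hA hmono hn (by rw [Dx_zero hf]; norm_num)
  have c5 := fun u (hu : 0 ≤ u) => lt_cross (a := 1) hA hmono hn hu
  set t := cross (Dx f) 1 n
  have c6 : Dx f t = 1 := by
    apply le_antisymm c4
    rcases c2 with c2 | c2
    · exact c2
    · rw [le_antisymm c3 c2]; exact h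
  refine ⟨c6, ?_⟩
  obtain ⟨v, hv, h'⟩ := exists_Dx' hf c1
  rcases eq_or_lt_of_le hv.2 with e | e
  · rw [e] at h'; rw [h', c6]
  · have := ((c5 v hv.1).1 e).1
    have := Mx_sub_le_Dx hf hv.1
    linarith

lemma cross_Dx_stable {m n : ℝ} (hm : 0 ≤ m) (hmn : m ≤ n) (h : 1 ≤ Dx f m) :
    cross (Dx f) 1 n = cross (Dx f) 1 m := by
  have hA := Dx_cont hf
  have hmono : ∀ s u, 0 ≤ s → s ≤ u → Dx f s ≤ Dx f u := fun s u hs h => Dx_mono hf hs h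
  obtain ⟨c1, c2⟩ := cross_mem (a := 1) hA hm
  obtain ⟨d1, d2⟩ := cross_mem (a := 1) hA (hm.trans hmn)
  apply le_antisymm
  · exact cross_le_of c1 (cross_Dx_eq hf hm h).1.ge
  · exact cross_le_of d1 (cross_Dx_eq hf (hm.trans hmn) (h.trans (hmono _ _ hm hmn))).1.ge

lemma cross_Dx_mono {m n : ℝ} (hm : 0 ≤ m) (hmn : m ≤ n) :
    cross (Dx f) 1 m ≤ cross (Dx f) 1 n := by
  by_cases h : 1 ≤ Dx f m
  · rw [cross_Dx_stable hf hm hmn h]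
  · have hA := Dx_cont hf
    refine (cross_le hm).trans ?_
    obtain ⟨d1, d2⟩ := cross_mem (a := 1) hA (hm.trans hmn)
    by_contra! h2
    rcases d2 with d2 | d2
    · exact h (d2.trans (Dx_mono hf d1 h2.le))
    · linarith

lemma vol_set {n : ℝ} (hn : 0 ≤ n) (h0 : f 0 = 0) (h : 1 ≤ Dx f n) :
    volume {a : ℝ | 0 < a ∧ TT a f < ∞ ∧ DD a f < 1} = ENNReal.ofReal (Mx f (cross (Dx f) 1 n)) := by
  have hA := Dx_cont hf
  have hmono : ∀ s u, 0 ≤ s → s ≤ u → Dx f s ≤ Dx f u := fun s u hs h => Dx_mono hf hs h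
  obtain ⟨c1, c2⟩ := cross_mem (a := 1) hA hn
  have c3 := cross_le (A := Dx f) (a := 1) hn
  have c5 := fun u (hu : 0 ≤ u) => lt_cross (a := 1) hA hmono hn hu
  obtain ⟨e1, e2⟩ := cross_Dx_eq hf hn h
  set t := cross (Dx f) 1 n
  have s1 : Ioo 0 (Mx f t) ⊆ {a : ℝ | 0 < a ∧ TT a f < ∞ ∧ DD a f < 1} := by
    rintro a ⟨ha, ha2⟩
    obtain ⟨u, u1, u2, u3, u4, u5, u6, u7⟩ := hit_spec hf (x := a) (by rw [h0]; exact ha) c1 ha2.le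
    refine ⟨ha, by rw [u6]; exact ENNReal.ofReal_lt_top, ?_⟩
    rw [u7, ENNReal.ofReal_lt_one]
    have : u < t := lt_of_le_of_ne u2 (by rintro rfl; linarith)
    exact ((c5 u u1.le).1 this).1
  have s2 : {a : ℝ | 0 < a ∧ TT a f < ∞ ∧ DD a f < 1} ⊆ Ioc 0 (Mx f t) := by
    rintro a ⟨ha, ha2, ha3⟩
    refine ⟨ha, ?_⟩
    obtain ⟨k, hk⟩ := hit_of_lt hf ha2
    obtain ⟨u, u1, u2, u3, u4, u5, u6, u7⟩ := hit_spec hf (x := a) (by rw [h0]; exact ha) k.cast_nonneg hk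
    rw [u7, ENNReal.ofReal_lt_one] at ha3
    rw [← u4]
    refine Mx_mono hf u1.le ?_
    by_contra! h3
    have := hmono _ _ c1 h3.le
    linarith
  apply le_antisymm
  · refine (measure_mono s2).trans ?_
    rw [Real.volume_Ioc, sub_zero]
  · refine le_trans ?_ (measure_mono s1)
    rw [Real.volume_Ioo, sub_zero]
end

section
variable {Ω : Type*} [MeasurableSpace Ω] {P : Measure Ω} [IsProbabilityMeasure P] {N : ℝ → Ω → ℝ}

lemma IsStdBM.dd_hit (hN : IsStdBM P N) : ∀ᵐ ω ∂P, ∃ n : ℕ, 1 ≤ Dx (fun u => N u ω) n := by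
  have key : ∀ n : ℕ, P {ω | ¬ ∃ n : ℕ, 1 ≤ Dx (fun u => N u ω) n} ≤ gaussianReal 0 1 (Ioi (-1)) ^ n := by
    intro n
    have h := (hN.indep n (fun i => (i : ℕ)) (fun i => by positivity) (fun i j h => by simpa using h)).measure_inter_preimage_eq_mul
      Finset.univ (sets := fun _ => Ioi (-1)) (fun i _ => measurableSet_Ioi)
    have e : ∀ i : Fin n, P ((fun ω => N ((i.succ : Fin (n+1)) : ℕ) ω - N ((i.castSucc : Fin (n+1)) : ℕ) ω) ⁻¹' Ioi (-1)) = gaussianReal 0 1 (Ioi (-1)) := by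
      intro i
      have mm : Measurable (fun ω => N ((i.succ : Fin (n+1)) : ℕ) ω - N ((i.castSucc : Fin (n+1)) : ℕ) ω) := (hN.measurable _).sub (hN.measurable _)
      rw [← Measure.map_apply mm measurableSet_Ioi]
      have := hN.gauss ((i.castSucc : Fin (n+1)) : ℕ) ((i.succ : Fin (n+1)) : ℕ) (by positivity) (by simp)
      rw [this]
      simp
    simp only [e, Finset.prod_const, Finset.card_univ, Fintype.card_fin] at h
    rw [← h]
    refine measure_mono fun ω hω => ?_
    simp only [mem_iInter, mem_preimage, mem_Ioi]
    intro i _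
    by_contra! h2
    refine hω ⟨i + 1, ?_⟩
    have := le_Dx (hN.cont ω) (u := (i:ℕ)) (v := ((i + 1 : ℕ) : ℝ)) (s := ((i + 1 : ℕ) : ℝ)) (by positivity) (by simp) le_rfl
    simp only [Fin.val_succ, Fin.val_castSucc] at h2
    linarith
  have h0 : P {ω | ¬ ∃ n : ℕ, 1 ≤ Dx (fun u => N u ω) n} = 0 :=
    le_antisymm (ge_of_tendsto' (ENNReal.tendsto_pow_atTop_nhds_zero_of_lt_one gauss_Ioi_lt) key) bot_le
  exact h0

lemma IsStdBM.stop_mean (hN : IsStdBM P N) {t : ℝ} (ht : 0 < t) :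
    Integrable (fun ω => N (cross (Dx (fun u => N u ω)) 1 t) ω) P ∧
    Integrable (fun ω => Mx (fun u => N u ω) (cross (Dx (fun u => N u ω)) 1 t)) P ∧
    ∫ ω, N (cross (Dx (fun u => N u ω)) 1 t) ω ∂P = 0 := by
  have hmono : ∀ ω, ∀ s u, 0 ≤ s → s ≤ u → Dx (fun u => N u ω) s ≤ Dx (fun u => N u ω) u := fun ω s u hs h => Dx_mono (hN.cont ω) hs h
  have hS : ∀ ω, cross (Dx (fun u => N u ω)) 1 t ∈ Icc 0 t := fun ω =>
    ⟨(cross_mem (a := 1) (Dx_cont (hN.cont ω)) ht.le).1, cross_le ht.le⟩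
  have hlt : ∀ s, 0 ≤ s → {ω | s < cross (Dx (fun u => N u ω)) 1 t} = {ω | Dx (fun u => N u ω) s < 1 ∧ s < t} := by
    intro s hs; ext ω
    exact lt_cross (a := 1) (Dx_cont (hN.cont ω)) (hmono ω) ht.le hs
  have hSm : ∀ s, 0 ≤ s → MeasurableSet {ω | s < cross (Dx (fun u => N u ω)) 1 t} := by
    intro s hs
    rw [hlt s hs]
    exact (measurableSet_lt (hN.measurable_Dx s) measurable_const).inter (MeasurableSet.const _)
  have hK : Integrable (fun ω => Mx (fun u => N u ω) t + Mx (fun u => - N u ω) t) P :=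
    (hN.integrable_Mx ht).add (hN.neg.integrable_Mx ht)
  have i1 := stop_integrable (Z := N) ht (fun s _ => hN.measurable s) hN.cont hK (fun s hs ω => hN.abs_le hs ω) hS hSm
  have i2 := stop_integrable (Z := fun s ω => Mx (fun u => N u ω) s) ht (fun s _ => hN.measurable_Mx s) (fun ω => Mx_cont (hN.cont ω))
    (hN.integrable_Mx ht) (fun s hs ω => by
      rw [abs_of_nonneg (hN.Mx_nonneg hs.1 ω)]; exact Mx_mono (hN.cont ω) hs.1 hs.2) hS hSm
  refine ⟨i1, i2, ?_⟩
  have o := optional_stopping (Z := N) ht (fun s _ => hN.measurable s) hN.cont hK (fun s hs ω => hN.abs_le hs ω) hS hSm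
  have z : ∀ n : ℕ, ∑ k ∈ Finset.range n, ∫ ω in {ω | t * k / n < cross (Dx (fun u => N u ω)) 1 t},
      (N (t * ((k + 1 : ℕ) : ℝ) / n) ω - N (t * k / n) ω) ∂P = 0 := by
    intro n
    refine Finset.sum_eq_zero fun k hk => ?_
    have hk0 : (0:ℝ) ≤ t * k / n := by positivity
    rw [← integral_indicator (hSm _ hk0)]
    have := hN.integral_past_mul (s := t * k / n) (t := t * ((k + 1 : ℕ) : ℝ) / n) hk0 (by gcongr; simp)
      (fun f => if Dx f (t * k / n) < 1 ∧ t * k / n < t then 1 else 0)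
      (Measurable.ite ((measurableSet_lt (_root_.measurable_Dx _) measurable_const).inter (MeasurableSet.const _)) measurable_const measurable_const)
    rw [← this]
    congr 1; ext ω
    classical
    rw [indicator_apply, Dx_stp hk0 le_rfl]
    have hiff : t * k / n < cross (Dx (fun u => N u ω)) 1 t ↔ Dx (fun u => N u ω) (t * k / n) < 1 ∧ t * k / n < t :=
      lt_cross (a := 1) (Dx_cont (hN.cont ω)) (hmono ω) ht.le hk0
    simp only [mem_ofPred_eq, hiff]
    split_ifs <;> simp
  simp only [z, hN.start, integral_zero, sub_zero] at o
  exact (tendsto_nhds_unique o tendsto_const_nhds)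

lemma IsStdBM.stop_lint (hN : IsStdBM P N) :
    ∫⁻ ω, (⨆ n : ℕ, ENNReal.ofReal (Mx (fun u => N u ω) (cross (Dx (fun u => N u ω)) 1 (n + 1)))) ∂P = 1 := by
  have hS : ∀ ω, ∀ t : ℝ, 0 ≤ t → cross (Dx (fun u => N u ω)) 1 t ∈ Icc 0 t := fun ω t ht =>
    ⟨(cross_mem (a := 1) (Dx_cont (hN.cont ω)) ht).1, cross_le ht⟩
  have hi := fun n : ℕ => hN.stop_mean (t := n + 1) (by positivity)
  have hmon : ∀ ω, Monotone fun n : ℕ => ENNReal.ofReal (Mx (fun u => N u ω) (cross (Dx (fun u => N u ω)) 1 (n + 1))) := by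
    intro ω m n hmn
    apply ENNReal.ofReal_le_ofReal
    exact Mx_mono (hN.cont ω) (hS ω _ (by positivity)).1 (cross_Dx_mono (hN.cont ω) (by positivity) (by simpa using hmn))
  rw [lintegral_iSup' (fun n => (hi n).2.1.aemeasurable.ennreal_ofReal) (ae_of_all _ hmon)]
  have hm2 : Monotone fun n : ℕ => ∫⁻ ω, ENNReal.ofReal (Mx (fun u => N u ω) (cross (Dx (fun u => N u ω)) 1 (n + 1))) ∂P :=
    fun m n h => lintegral_mono fun ω => hmon ω h
  refine tendsto_nhds_unique (tendsto_atTop_iSup hm2) ?_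
  have e : ∀ n : ℕ, ∫⁻ ω, ENNReal.ofReal (Mx (fun u => N u ω) (cross (Dx (fun u => N u ω)) 1 (n + 1))) ∂P
      = ENNReal.ofReal (∫ ω, (Mx (fun u => N u ω) (cross (Dx (fun u => N u ω)) 1 (n + 1)) - N (cross (Dx (fun u => N u ω)) 1 (n + 1)) ω) ∂P) := by
    intro n
    rw [integral_sub (hi n).2.1 (hi n).1, (hi n).2.2, sub_zero,
      ofReal_integral_eq_lintegral_ofReal (hi n).2.1 (ae_of_all _ fun ω => hN.Mx_nonneg (hS ω _ (by positivity)).1 ω)]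
  simp only [e]
  rw [← ENNReal.ofReal_one]
  refine ENNReal.tendsto_ofReal ?_
  suffices hs : Tendsto (fun n : ℕ => ∫ ω, (Mx (fun u => N u ω) (cross (Dx (fun u => N u ω)) 1 (n + 1)) - N (cross (Dx (fun u => N u ω)) 1 (n + 1)) ω) ∂P)
      atTop (𝓝 (∫ ω, (fun _ => (1:ℝ)) ω ∂P)) by simpa using hs
  refine tendsto_integral_of_dominated_convergence (fun _ => 1) (fun n => ((hi n).2.1.sub (hi n).1).aestronglyMeasurable)
    (integrable_const _) (fun n => ae_of_all _ fun ω => ?_) ?_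
  · have h1 := (hS ω (n + 1) (by positivity)).1
    have h2 := le_Mx (hN.cont ω) h1 le_rfl
    rw [Real.norm_eq_abs, abs_of_nonneg (by linarith)]
    refine (Mx_sub_le_Dx (hN.cont ω) h1).trans ?_
    exact cross_val_le (Dx_cont (hN.cont ω)) (fun s u hs h => Dx_mono (hN.cont ω) hs h) (by positivity) (by rw [Dx_zero (hN.cont ω)]; norm_num)
  · filter_upwards [hN.dd_hit] with ω ⟨k, hk⟩
    refine tendsto_const_nhds.congr' ?_
    filter_upwards [eventually_ge_atTop k] with n hn
    refine (cross_Dx_eq (hN.cont ω) (n := n + 1) (by positivity) (hk.trans (Dx_mono (hN.cont ω) (by positivity) ?_))).2.symm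
    have : (k:ℝ) ≤ n := by exact_mod_cast hn
    linarith

lemma inv_lint (D : ℝ≥0∞) : ∫⁻ a in Ioi (0:ℝ), (if ENNReal.ofReal a * D < 1 then 1 else 0) = D⁻¹ := by
  have : ∀ a ∈ Ioi (0:ℝ), (if ENNReal.ofReal a * D < 1 then (1:ℝ≥0∞) else 0) = ({a : ℝ | ENNReal.ofReal a < D⁻¹}).indicator 1 a := by
    classical
    intro a ha
    have ha : 0 < a := ha
    rw [indicator_apply]
    have : ENNReal.ofReal a * D < 1 ↔ a ∈ {a : ℝ | ENNReal.ofReal a < D⁻¹} := by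
      rw [mem_ofPred_eq]
      rw [ENNReal.lt_inv_iff_lt_inv, mul_comm, ← ENNReal.lt_div_iff_mul_lt (Or.inl (by simpa using ha)) (Or.inl ENNReal.ofReal_ne_top), one_div]
    simp only [this, Pi.one_apply]
  rw [setLIntegral_congr_fun measurableSet_Ioi this, lintegral_indicator_one (measurableSet_lt ENNReal.measurable_ofReal measurable_const)]
  rw [Measure.restrict_apply (measurableSet_lt ENNReal.measurable_ofReal measurable_const)]
  rcases eq_or_ne D⁻¹ ∞ with h | h
  · rw [h]
    have : ({a : ℝ | ENNReal.ofReal a < ∞} ∩ Ioi 0) = Ioi 0 := by ext a; simp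
    rw [this, Real.volume_Ioi]
  · have : ({a : ℝ | ENNReal.ofReal a < D⁻¹} ∩ Ioi 0) = Ioo 0 (D⁻¹).toReal := by
      ext a
      simp only [mem_inter_iff, mem_ofPred_eq, mem_Ioi, mem_Ioo]
      rw [and_comm]
      refine and_congr_right fun ha => ?_
      rw [ENNReal.ofReal_lt_iff_lt_toReal ha.le h]
    rw [this, Real.volume_Ioo, sub_zero, ENNReal.ofReal_toReal h]
end

end part12

section part13
open MeasureTheory ProbabilityTheory Real Set Filter
open scoped ENNReal NNReal Topology

attribute [local irreducible] TT DD

noncomputable def Psi (p : ℝ≥0∞ × ℝ≥0∞) : ℝ≥0∞ := if p.1 < ∞ ∧ p.2 < 1 then 1 else 0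
lemma measurable_Psi : Measurable Psi :=
  Measurable.ite ((measurableSet_lt measurable_fst measurable_const).inter (measurableSet_lt measurable_snd measurable_const))
    measurable_const measurable_const

lemma Psi_lint (T D : ℝ≥0∞) :
    ∫⁻ x in Ioi (0:ℝ), Psi (ENNReal.ofReal (x ^ 2) * T, ENNReal.ofReal x * D) = if T < ∞ then D⁻¹ else 0 := by
  have : ∀ x ∈ Ioi (0:ℝ), Psi (ENNReal.ofReal (x ^ 2) * T, ENNReal.ofReal x * D)
      = if T < ∞ then (if ENNReal.ofReal x * D < 1 then 1 else 0) else 0 := by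
    intro x hx
    have hx : 0 < x := hx
    have : ENNReal.ofReal (x ^ 2) * T < ∞ ↔ T < ∞ := by
      constructor
      · intro h
        by_contra h2
        rw [not_lt_top_iff.1 h2, ENNReal.mul_top (by simp; positivity)] at h
        exact lt_irrefl _ h
      · intro h; exact ENNReal.mul_lt_top ENNReal.ofReal_lt_top h
    unfold Psi
    simp only [this]
    split_ifs <;> simp_all
  rw [setLIntegral_congr_fun measurableSet_Ioi this]
  split_ifs with h
  · exact inv_lint D
  · simp

section
variable {Ω : Type*} [MeasurableSpace Ω] {P : Measure Ω} [IsProbabilityMeasure P] {N : ℝ → Ω → ℝ}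

lemma IsStdBM.J_eq (hN : IsStdBM P N) :
    ∫⁻ ω, (if TT 1 (fun u => N u ω) < ∞ then (DD 1 (fun u => N u ω))⁻¹ else 0) ∂P = 1 := by
  have mT := hN.mT 1
  have mD := hN.mD 1
  have m4 : Measurable (Function.uncurry fun (ω : Ω) (x : ℝ) =>
      Psi (ENNReal.ofReal (x ^ 2) * TT 1 (fun u => N u ω), ENNReal.ofReal x * DD 1 (fun u => N u ω))) := by
    have a1 : Measurable fun p : Ω × ℝ => ENNReal.ofReal (p.2 ^ 2) * TT 1 (fun u => N u p.1) :=
      (measurable_snd.pow_const 2).ennreal_ofReal.mul (mT.comp measurable_fst)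
    have a2 : Measurable fun p : Ω × ℝ => ENNReal.ofReal p.2 * DD 1 (fun u => N u p.1) :=
      measurable_snd.ennreal_ofReal.mul (mD.comp measurable_fst)
    exact measurable_Psi.comp (a1.prodMk a2)
  have m5 : Measurable (Function.uncurry fun (x : ℝ) (ω : Ω) =>
      Psi (TT x (fun u => N u ω), DD x (fun u => N u ω))) := by
    have a1 : Measurable fun p : ℝ × Ω => TT p.1 (fun u => N u p.2) := hN.mT2.comp measurable_swap
    have a2 : Measurable fun p : ℝ × Ω => DD p.1 (fun u => N u p.2) := hN.mD2.comp measurable_swap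
    exact measurable_Psi.comp (a1.prodMk a2)
  have e := fun ω => Psi_lint (TT 1 (fun u => N u ω)) (DD 1 (fun u => N u ω))
  rw [← lintegral_congr e, lintegral_lintegral_swap m4.aemeasurable]
  have e2 : ∀ x ∈ Ioi (0:ℝ), ∫⁻ ω, Psi (ENNReal.ofReal (x ^ 2) * TT 1 (fun u => N u ω), ENNReal.ofReal x * DD 1 (fun u => N u ω)) ∂P
      = ∫⁻ ω, Psi (TT x (fun u => N u ω), DD x (fun u => N u ω)) ∂P := fun x hx =>
    (hN.scaling hx Psi measurable_Psi (fun d => by simp [Psi])).symm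
  rw [setLIntegral_congr_fun measurableSet_Ioi e2, lintegral_lintegral_swap m5.aemeasurable, ← hN.stop_lint]
  refine lintegral_congr_ae ?_
  filter_upwards [hN.dd_hit] with ω ⟨k, hk⟩
  have hv := vol_set (hN.cont ω) k.cast_nonneg (hN.start ω) hk
  have ms : MeasurableSet {a : ℝ | TT a (fun u => N u ω) < ∞ ∧ DD a (fun u => N u ω) < 1} := by
    have a1 : Measurable fun a : ℝ => TT a (fun u => N u ω) := hN.mT2.comp (measurable_const.prodMk measurable_id : Measurable fun a : ℝ => (ω, a))
    have a2 : Measurable fun a : ℝ => DD a (fun u => N u ω) := hN.mD2.comp (measurable_const.prodMk measurable_id : Measurable fun a : ℝ => (ω, a))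
    exact (measurableSet_lt a1 measurable_const).inter (measurableSet_lt a2 measurable_const)
  have e3 : ∀ a : ℝ, Psi (TT a (fun u => N u ω), DD a (fun u => N u ω))
      = ({a : ℝ | TT a (fun u => N u ω) < ∞ ∧ DD a (fun u => N u ω) < 1}).indicator 1 a := by
    classical
    intro a
    rw [indicator_apply]; rfl
  rw [lintegral_congr e3, lintegral_indicator_one ms, Measure.restrict_apply ms]
  have e4 : {a : ℝ | TT a (fun u => N u ω) < ∞ ∧ DD a (fun u => N u ω) < 1} ∩ Ioi 0
      = {a : ℝ | 0 < a ∧ TT a (fun u => N u ω) < ∞ ∧ DD a (fun u => N u ω) < 1} := by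
    ext a; simp [and_comm]
  rw [e4, hv]
  apply le_antisymm
  · refine le_iSup_of_le k ?_
    rw [cross_Dx_stable (hN.cont ω) (n := (k:ℝ) + 1) k.cast_nonneg (by linarith) hk]
  · refine iSup_le fun n => ?_
    apply ENNReal.ofReal_le_ofReal
    refine Mx_mono (hN.cont ω) (cross_mem (a := 1) (Dx_cont (hN.cont ω)) (by positivity)).1 ?_
    rcases le_total (n + 1 : ℝ) k with h | h
    · exact cross_Dx_mono (hN.cont ω) (by positivity) h
    · rw [cross_Dx_stable (hN.cont ω) k.cast_nonneg h hk]

lemma IsStdBM.G_lint (hN : IsStdBM P N) :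
    ∫⁻ ω, GG (N 1 ω) (fun u => N u ω) ∂P = ENNReal.ofReal ((√(2 * π))⁻¹ * (π / 2)) := by
  rw [hN.keyR, hN.J_eq, mul_one]
end

end part13

section part14
open MeasureTheory ProbabilityTheory Real Set Filter
open scoped ENNReal NNReal Topology

section
variable {Ω : Type*} [MeasurableSpace Ω] {P : Measure Ω} [IsProbabilityMeasure P] {N : ℝ → Ω → ℝ}

lemma IsStdBM.map_one (hN : IsStdBM P N) : P.map (N 1) = gaussianReal 0 1 := by
  have := hN.gauss 0 1 le_rfl zero_le_one
  simpa [hN.start] using this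

lemma IsStdBM.pos_ne (hN : IsStdBM P N) : ∫⁻ ω, ENNReal.ofReal (N 1 ω) ∂P ≠ 0 := by
  intro h
  rw [lintegral_eq_zero_iff (hN.measurable 1).ennreal_ofReal] at h
  have h2 : P.map (N 1) (Ioi 0) = 0 := by
    rw [Measure.map_apply (hN.measurable 1) measurableSet_Ioi]
    refine measure_mono_null ?_ h
    intro ω hω h3
    have hω : 0 < N 1 ω := hω
    simp at h3
    linarith
  rw [hN.map_one] at h2
  have := gaussianReal_absolutelyContinuous' 0 (v := 1) one_ne_zero h2
  simp at this

lemma IsStdBM.ne_zero (hN : IsStdBM P N) : ∀ᵐ ω ∂P, N 1 ω ≠ 0 := by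
  have h2 : P.map (N 1) {0} = 0 := by
    rw [hN.map_one]
    exact gaussianReal_absolutelyContinuous 0 (v := 1) one_ne_zero (by simp)
  rw [Measure.map_apply (hN.measurable 1) (measurableSet_singleton _)] at h2
  rw [ae_iff]
  simp only [not_not]
  exact h2

lemma IsStdBM.lt_Mx (hN : IsStdBM P N) : ∀ᵐ ω ∂P, N 1 ω < Mx (fun u => N u ω) 1 := by
  set E := ∫⁻ ω, ENNReal.ofReal (Mx (fun u => N u ω) 1) ∂P with hE
  set h := ∫⁻ ω, ENNReal.ofReal (N 1 ω) ∂P with hh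
  set A : Set Ω := {ω | Mx (fun u => N u ω) 1 = N 1 ω} with hA
  have mA : MeasurableSet A := measurableSet_eq_fun (hN.measurable_Mx 1) (hN.measurable 1)
  have hEt : E ≠ ∞ := by
    have := (hN.integrable_Mx one_pos).lintegral_lt_top
    exact this.ne
  have eM : ∀ c : ℝ, 0 < c → ∫⁻ ω, ENNReal.ofReal (Mx (fun u => N u ω) (c ^ 2)) ∂P = ENNReal.ofReal c * E := by
    intro c hc
    have := hN.lintegral_path_eq (hN.scale hc) (fun f => ENNReal.ofReal (Mx f 1)) (_root_.measurable_Mx 1).ennreal_ofReal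
      (fun f g hfg => by rw [Mx_congr zero_le_one fun u hu => hfg u hu.1])
    rw [hE, this, ← lintegral_const_mul]
    · refine lintegral_congr fun ω => ?_
      rw [Mx_scale (hN.cont ω) hc zero_le_one, ← ENNReal.ofReal_mul hc.le, mul_one, ← mul_assoc, mul_inv_cancel₀ hc.ne', one_mul]
    · exact ((hN.scale hc).measurable_Mx 1).ennreal_ofReal
  have eN : ∀ c : ℝ, 0 < c → ∫⁻ y, ENNReal.ofReal y ∂(gaussianReal 0 (c ^ 2).toNNReal) = ENNReal.ofReal c * h := by
    intro c hc
    have := hN.lintegral_path_eq (hN.scale hc) (fun f => ENNReal.ofReal (f 1)) (measurable_pi_apply 1).ennreal_ofReal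
      (fun f g hfg => by rw [hfg 1 zero_le_one])
    rw [hh, this, ← lintegral_const_mul]
    · have e := hN.gauss 0 (c ^ 2) le_rfl (by positivity)
      simp only [hN.start, sub_zero] at e
      rw [← e, lintegral_map ENNReal.measurable_ofReal (hN.measurable _)]
      refine lintegral_congr fun ω => ?_
      simp only []
      rw [← ENNReal.ofReal_mul hc.le, mul_one, ← mul_assoc, mul_inv_cancel₀ hc.ne', one_mul]
    · exact ((hN.scale hc).measurable 1).ennreal_ofReal
  have key : ∀ c : ℝ, 0 < c → P A * h ≤ ENNReal.ofReal c * E := by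
    intro c hc
    have mf : MeasurableSet {f : ℝ → ℝ | Mx f 1 = f 1} := measurableSet_eq_fun (_root_.measurable_Mx 1) (measurable_pi_apply 1)
    have mΦ : Measurable (fun p : (ℝ → ℝ) × ℝ => ({f : ℝ → ℝ | Mx f 1 = f 1}.indicator 1 p.1 : ℝ≥0∞) * ENNReal.ofReal p.2) :=
      ((measurable_one.indicator mf).comp measurable_fst).mul measurable_snd.ennreal_ofReal
    have fr := hN.freeze (s := 1) (t := 1 + c ^ 2) zero_le_one (by nlinarith)
      (fun p => ({f : ℝ → ℝ | Mx f 1 = f 1}.indicator 1 p.1 : ℝ≥0∞) * ENNReal.ofReal p.2) mΦ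
    have ei : ∀ ω, ({f : ℝ → ℝ | Mx f 1 = f 1}.indicator 1 (stp 1 fun u => N u ω) : ℝ≥0∞) = A.indicator 1 ω := by
      classical
      intro ω
      rw [indicator_apply, indicator_apply]
      have : (stp 1 (fun u => N u ω) ∈ {f : ℝ → ℝ | Mx f 1 = f 1}) ↔ ω ∈ A := by
        rw [hA, mem_ofPred_eq, mem_ofPred_eq, Mx_stp zero_le_one le_rfl, stp_of _ zero_le_one le_rfl]
      simp only [this]; rfl
    simp only [ei] at fr
    have fr2 : ∫⁻ ω, A.indicator 1 ω * ENNReal.ofReal (N (1 + c ^ 2) ω - N 1 ω) ∂P = P A * (ENNReal.ofReal c * h) := by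
      rw [fr]
      simp_rw [lintegral_const_mul _ ENNReal.measurable_ofReal]
      rw [lintegral_mul_const _ (measurable_one.indicator mA), lintegral_indicator_one mA, add_sub_cancel_left, eN c hc]
    have q : E + P A * (ENNReal.ofReal c * h) ≤ ENNReal.ofReal (√(1 + c ^ 2)) * E := by
      rw [← eM _ (by positivity), ← fr2, hE, ← lintegral_add_left (hN.measurable_Mx 1).ennreal_ofReal, Real.sq_sqrt (by positivity)]
      refine lintegral_mono fun ω => ?_
      classical
      rw [indicator_apply]
      have g1 := Mx_mono (hN.cont ω) (s := 1) (t := 1 + c ^ 2) zero_le_one (by nlinarith)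
      split_ifs with hω
      · have hω : Mx (fun u => N u ω) 1 = N 1 ω := hω
        have g2 := le_Mx (hN.cont ω) (u := 1 + c ^ 2) (s := 1 + c ^ 2) (by positivity) le_rfl
        have g3 := hN.Mx_nonneg zero_le_one ω
        simp only [Pi.one_apply, one_mul]
        rcases le_total 0 (N (1 + c ^ 2) ω - N 1 ω) with g4 | g4
        · rw [← ENNReal.ofReal_add g3 g4]
          apply ENNReal.ofReal_le_ofReal
          linarith
        · rw [ENNReal.ofReal_of_nonpos g4, add_zero]
          exact ENNReal.ofReal_le_ofReal g1
      · simp only [zero_mul, add_zero]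
        exact ENNReal.ofReal_le_ofReal g1
    have q2 : √(1 + c ^ 2) ≤ 1 + c * c := by
      rw [Real.sqrt_le_left (by positivity)]
      nlinarith [sq_nonneg (c * c)]
    have q3 := q.trans (mul_le_mul_left (ENNReal.ofReal_le_ofReal q2) _)
    rw [ENNReal.ofReal_add zero_le_one (by positivity), ENNReal.ofReal_one, add_mul, one_mul, ENNReal.ofReal_mul hc.le] at q3
    have q4 := (ENNReal.add_le_add_iff_left hEt).1 q3
    have q5 : ENNReal.ofReal c * (P A * h) ≤ ENNReal.ofReal c * (ENNReal.ofReal c * E) := by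
      calc _ = P A * (ENNReal.ofReal c * h) := by ring
        _ ≤ _ := q4
        _ = _ := by ring
    exact (ENNReal.mul_le_mul_iff_right (by simpa using hc) ENNReal.ofReal_ne_top).1 q5
  have z : P A * h = 0 := by
    have lim : Tendsto (fun c : ℝ => ENNReal.ofReal c * E) (𝓝[>] 0) (𝓝 (ENNReal.ofReal 0 * E)) := by
      refine ENNReal.Tendsto.mul_const ?_ (Or.inr hEt)
      exact (ENNReal.continuous_ofReal.tendsto 0).mono_left nhdsWithin_le_nhds
    have := ge_of_tendsto lim (b := P A * h) (by
      filter_upwards [self_mem_nhdsWithin] with c hc using key c hc)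
    simpa using this
  have zA : P A = 0 := (mul_eq_zero.1 z).resolve_right hN.pos_ne
  rw [ae_iff]
  refine measure_mono_null ?_ zA
  intro ω hω
  have hω : ¬ N 1 ω < Mx (fun u => N u ω) 1 := hω
  exact le_antisymm (not_lt.1 hω) (le_Mx (hN.cont ω) zero_le_one le_rfl)
end

end part14

section part15
open MeasureTheory ProbabilityTheory Real Set Filter
open scoped ENNReal NNReal Topology

noncomputable def Nh (w : ℝ → ℝ) (t : ℝ) : ℝ := w (max t 1) - w (max (1 - t) 0)
noncomputable def lz (w : ℝ → ℝ) : ℝ := sSup {t ∈ Icc (0:ℝ) 1 | w t = 0}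
noncomputable def mtl (w : ℝ → ℝ) (s : ℝ) : ℝ := |w (lz w + s * (1 - lz w))| / √(1 - lz w)

lemma Nh_of {w : ℝ → ℝ} {t : ℝ} (h1 : t ≤ 1) : Nh w t = w 1 - w (1 - t) := by
  unfold Nh; rw [max_eq_right h1, max_eq_left (by linarith)]

lemma path_red {w : ℝ → ℝ} (hw : Continuous w) (h0 : w 0 = 0) (h1 : 0 < w 1) (hM : Nh w 1 < Mx (Nh w) 1) :
    1 / Dx (mtl w) 1 = (GG (Nh w 1) (Nh w)).toReal := by
  have hN : Continuous (Nh w) := by unfold Nh; fun_prop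
  have hm : Continuous (mtl w) := by
    unfold mtl
    fun_prop
  have e1 : Nh w 1 = w 1 := by rw [Nh_of le_rfl]; simp [h0]
  have e0 : Nh w 0 = 0 := by rw [Nh_of zero_le_one]; simp
  obtain ⟨u, hu, hu2⟩ := exists_Mx hN zero_le_one
  have hu1 : u < 1 := lt_of_le_of_ne hu.2 (by rintro rfl; linarith)
  obtain ⟨T, t1, t2, t3, t4, t5, t6, t7⟩ := hit_spec hN (x := Nh w 1) (h := u) (by rw [e0, e1]; exact h1) hu.1
    (by rw [← hu2] at hM; exact hM.le.trans (le_Mx hN hu.1 le_rfl))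
  have tl : T < 1 := t2.trans_lt hu1
  have z : w (1 - T) = 0 := by rw [Nh_of tl.le, e1] at t3; linarith
  have pos : ∀ s, 0 ≤ s → s < T → 0 < w (1 - s) := by
    intro s hs hsT
    have := (le_Mx hN hs le_rfl).trans_lt (t5 s hs hsT)
    rw [Nh_of (hsT.le.trans tl.le), e1] at this
    linarith
  have g : lz w = 1 - T := by
    refine IsGreatest.csSup_eq ⟨⟨⟨by linarith, by linarith⟩, z⟩, ?_⟩
    rintro t ⟨⟨ht0, ht1⟩, ht⟩
    by_contra! h
    have := pos (1 - t) (by linarith) (by linarith)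
    rw [sub_sub_cancel, ht] at this
    exact lt_irrefl _ this
  have sT : 0 < √T := Real.sqrt_pos.2 t1
  have em : ∀ s, 0 ≤ s → s ≤ 1 → mtl w s = (w 1 - Nh w (T * (1 - s))) / √T := by
    intro s hs hs1
    have a1 : T * (1 - s) ≤ T := by nlinarith
    have a0 : 0 ≤ T * (1 - s) := by nlinarith
    unfold mtl
    rw [g, Nh_of (a1.trans tl.le), sub_sub_cancel, show 1 - T + s * T = 1 - T * (1 - s) by ring, sub_sub_cancel, abs_of_nonneg]
    rcases eq_or_lt_of_le a1 with h | h
    · rw [h, z]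
    · exact (pos _ a0 h).le
  have eD : Dx (mtl w) 1 = Dx (Nh w) T / √T := by
    apply le_antisymm
    · obtain ⟨a, b, ha, hab, hb, h⟩ := exists_Dx hm zero_le_one
      rw [← h, em a ha (hab.trans hb), em b (ha.trans hab) hb, ← sub_div]
      gcongr
      have := le_Dx hN (u := T * (1 - b)) (v := T * (1 - a)) (s := T) (by nlinarith) (by nlinarith) (by nlinarith)
      linarith
    · obtain ⟨a, b, ha, hab, hb, h⟩ := exists_Dx hN t1.le
      have ba : 0 ≤ 1 - b / T := by rw [sub_nonneg, div_le_one t1]; exact hb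
      have := le_Dx hm (u := 1 - b / T) (v := 1 - a / T) (s := 1) ba (by gcongr) (by simp; positivity)
      refine le_trans (le_of_eq ?_) this
      rw [← h, em _ ba (by simp; exact div_nonneg (ha.trans hab) t1.le), em _ (ba.trans (by gcongr)) (by simp; positivity), ← sub_div]
      congr 1
      have q : ∀ y, T * (1 - (1 - y / T)) = y := by intro y; field_simp; ring
      rw [q, q]; ring
  unfold GG
  rw [if_pos ⟨by rw [e1]; exact h1, by rw [t6]; exact ENNReal.ofReal_lt_one.2 tl⟩, t6, t7, ENNReal.toReal_div,
    ENNReal.toReal_ofReal t1.le, ENNReal.toReal_ofReal sT.le, ENNReal.toReal_ofReal (Dx_nonneg hN t1.le), eD, one_div_div]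

section
variable {Ω : Type*} [MeasurableSpace Ω] {P : Measure Ω} [IsProbabilityMeasure P] {W : ℝ → Ω → ℝ} {m : ℝ → Ω → ℝ}

lemma maxDD_eq {f : ℝ → ℝ} (hf : Continuous f) {ω : Ω} (h : ∀ s ∈ Icc (0:ℝ) 1, m s ω = f s) : maxDDOn m 1 ω = Dx f 1 := by
  have e : ∀ s : Icc (0:ℝ) 1, runMax m s ω - m s ω = Mx f s - f s := by
    rintro ⟨s, hs⟩
    have : runMax m s ω = runMax (fun s (_ : Ω) => f s) s ω := by
      unfold runMax
      congr 1; ext ⟨u, hu⟩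
      exact h u ⟨hu.1, hu.2.trans hs.2⟩
    simp only []
    rw [this, runMax_eq hf hs.1, h s hs]
  unfold maxDDOn
  simp only [e]
  have hb : ∀ s : Icc (0:ℝ) 1, Mx f s - f s ≤ Dx f 1 := fun s =>
    (Mx_sub_le_Dx hf s.2.1).trans (Dx_mono hf s.2.1 s.2.2)
  have : Nonempty (Icc (0:ℝ) 1) := ⟨⟨0, by simp⟩⟩
  apply le_antisymm
  · exact ciSup_le hb
  · obtain ⟨v, hv, h'⟩ := exists_Dx' hf zero_le_one
    rw [← h']
    exact le_ciSup (f := fun s : Icc (0:ℝ) 1 => Mx f s - f s) ⟨Dx f 1, by rintro _ ⟨s, rfl⟩; exact hb s⟩ ⟨v, hv⟩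

lemma mtl_neg (w : ℝ → ℝ) : mtl (fun u => - w u) = mtl w := by
  have : lz (fun u => - w u) = lz w := by unfold lz; simp only [neg_eq_zero]
  ext s; unfold mtl; rw [this, abs_neg]

attribute [local irreducible] GG

lemma IsStdBM.mG1 (hN : IsStdBM P W) : Measurable fun ω => GG (W 1 ω) (fun u => W u ω) :=
  hN.mG2.comp (measurable_id.prodMk (hN.measurable 1) : Measurable fun ω => (ω, W 1 ω))

lemma IsBrownianMeander.main (hm : IsBrownianMeander P m) : ∫ ω, 1 / maxDDOn m 1 ω ∂P = √(π / 2) := by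
  obtain ⟨W, hW, h⟩ := hm
  have r1 := hW.reverse
  have r2 := hW.neg.reverse
  have i1 := r1.G_lint
  have i2 := r2.G_lint
  have l1 := r1.lt_Mx
  have l2 := r2.lt_Mx
  have M1 := r1.mG1
  have M2 := r2.mG1
  have x1 : ∀ w : ℝ → ℝ, ¬ 0 < Nh w 1 → GG (Nh w 1) (Nh w) = 0 := by
    intro w hw
    unfold GG
    rw [if_neg (fun h => hw h.1)]
  have c : ∀ᵐ ω ∂P, 1 / maxDDOn m 1 ω = (GG (Nh (fun u => W u ω) 1) (Nh (fun u => W u ω))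
      + GG (Nh (fun u => - W u ω) 1) (Nh (fun u => - W u ω))).toReal := by
    filter_upwards [l1, l2, hW.ne_zero] with ω l1 l2 h0
    have hw := hW.cont ω
    have hw' : Continuous fun u => - W u ω := hw.neg
    have hc : Continuous (mtl (fun u => W u ω)) := by unfold mtl; fun_prop
    rw [maxDD_eq hc (h ω)]
    have n1 : Nh (fun u => W u ω) 1 = W 1 ω := by rw [Nh_of le_rfl]; simp [hW.start]
    have n2 : Nh (fun u => - W u ω) 1 = - W 1 ω := by rw [Nh_of le_rfl]; simp [hW.start]
    rcases lt_or_gt_of_ne h0 with h0 | h0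
    · rw [x1 _ (by rw [n1]; linarith), zero_add, ← path_red hw' (by simp [hW.start]) (by linarith) l2, mtl_neg]
    · rw [x1 (fun u => - W u ω) (by rw [n2]; linarith), add_zero, ← path_red hw (by simp [hW.start]) h0 l1]
  rw [integral_congr_ae c]
  have M3 : Measurable fun ω => GG (Nh (fun u => W u ω) 1) (Nh (fun u => W u ω))
      + GG (Nh (fun u => - W u ω) 1) (Nh (fun u => - W u ω)) := M1.add M2
  have tot : ∫⁻ ω, (GG (Nh (fun u => W u ω) 1) (Nh (fun u => W u ω))
      + GG (Nh (fun u => - W u ω) 1) (Nh (fun u => - W u ω))) ∂P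
      = ENNReal.ofReal ((√(2 * π))⁻¹ * (π / 2)) + ENNReal.ofReal ((√(2 * π))⁻¹ * (π / 2)) := by
    refine (lintegral_add_left M1 _).trans ?_
    exact congrArg₂ (· + ·) i1 i2
  rw [integral_toReal M3.aemeasurable (ae_lt_top M3 (by rw [tot]; exact ENNReal.add_ne_top.2 ⟨ENNReal.ofReal_ne_top, ENNReal.ofReal_ne_top⟩)), tot, ← ENNReal.ofReal_add (by positivity) (by positivity),
    ENNReal.toReal_ofReal (by positivity)]
  have hp := Real.pi_pos
  have s1 : √(2 * π) = 2 * √(π / 2) := by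
    rw [show 2 * π = 2 ^ 2 * (π / 2) by ring, Real.sqrt_mul (by norm_num), Real.sqrt_sq (by norm_num)]
  have s2 : √(π / 2) * √(π / 2) = π / 2 := Real.mul_self_sqrt (by positivity)
  have s3 : 0 < √(π / 2) := Real.sqrt_pos.2 (by positivity)
  rw [s1]
  field_simp
  nlinarith
end


end part15

open scoped ENNReal

/-- `E[1 / sup_{s ∈ [0,1]} (m̄(s) - m(s))] = √(2π) · E[τ₁^U]`, where `m` is
a standard Brownian meander and `τ₁^U` the unit drawdown time of a squared
four-dimensional Bessel process `U` started at `0`. -/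
theorem meander_inv_maxDrawdown_eq_sqBessel4_drawdown_time
    {Ω : Type*} [MeasurableSpace Ω] (P : Measure Ω) [IsProbabilityMeasure P]
    {Ω' : Type*} [MeasurableSpace Ω'] (Q : Measure Ω') [IsProbabilityMeasure Q]
    (m : ℝ → Ω → ℝ) (hm : IsBrownianMeander P m)
    (γ : ℝ → Ω' → EuclideanSpace ℝ (Fin 4)) (hγ : IsStdBMVec 4 Q γ) :
    ∫ ω, 1 / maxDDOn m 1 ω ∂P
      = Real.sqrt (2 * π) * ∫ ω, ddTime 1 (sqBessel4 γ) ω ∂Q := by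
  rw [hm.main, hγ.main]
  have s1 : √(2 * π) = 2 * √(π / 2) := by
    rw [show 2 * π = 2 ^ 2 * (π / 2) by ring, Real.sqrt_mul (by norm_num), Real.sqrt_sq (by norm_num)]
  rw [s1]; ring
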